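/- Let f ∈ ℤ[X,Y,Z] be a nonzero homogeneous polynomial of degree d with 1 ≤ d ≤ 3. Then the following are equivalent: (1) there exists N ∈ ℕ such that for every prime number p ≥ N the quotient ring 𝔽_p[X,Y,Z]/(f_p) is F-split, where f_p denotes the image of f under coefficientwise reduction ℤ[X,Y,Z] → 𝔽_p[X,Y,Z]; (2) there exist a ℂ-algebra automorphism φ of ℂ[X,Y,Z] and a monomial order on ℂ[X,Y,Z] such that the leading monomial of φ(f_ℂ) is squarefree, where f_ℂ is the image of f in ℂ[X,Y,Z]. -/

import Mathlib

/-- `lt` is (the strict relation of) a monomial order on exponent vectors: a strict total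
order for which `0` (i.e. the monomial `1`) is the least element and which is compatible
with addition of exponent vectors (i.e. with multiplication of monomials). -/
def IsMonomialOrder {σ : Type*} (lt : (σ →₀ ℕ) → (σ →₀ ℕ) → Prop) : Prop :=
  IsStrictTotalOrder (σ →₀ ℕ) lt ∧
    (∀ u : σ →₀ ℕ, u ≠ 0 → lt 0 u) ∧
    (∀ u v w : σ →₀ ℕ, lt u v → lt (u + w) (v + w))

/-- `d` is the leading monomial of `f` with respect to the strict order `lt` on
exponent vectors: `d` occurs in `f` and dominates every other exponent in the support. -/
def IsLeadingMonomial {σ : Type*} {R : Type*} [CommSemiring R]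
    (lt : (σ →₀ ℕ) → (σ →₀ ℕ) → Prop) (f : MvPolynomial σ R) (d : σ →₀ ℕ) : Prop :=
  d ∈ f.support ∧ ∀ e ∈ f.support, e ≠ d → lt e d

/-- A commutative ring `R` (of characteristic `p`) is `F`-split if there is an additive
map `φ : R → R` with `φ (r ^ p * s) = r * φ s` and `φ 1 = 1`, i.e. the Frobenius splits. -/
def IsFSplit (p : ℕ) (R : Type*) [CommRing R] : Prop :=
  ∃ φ : R →+ R, (∀ r s : R, φ (r ^ p * s) = r * φ s) ∧ φ 1 = 1


section
open PowerSeries in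
/-- `Ev P z w`: the power series `P` converges at `z` to `w`. -/
def Ev (P : PowerSeries ℂ) (z w : ℂ) : Prop := HasSum (fun n => coeff n P * z ^ n) w

namespace Ev
open PowerSeries

theorem unique {P : PowerSeries ℂ} {z w w' : ℂ} (h : Ev P z w) (h' : Ev P z w') : w = w' :=
  HasSum.unique h h'

theorem add {P Q : PowerSeries ℂ} {z w v : ℂ} (h : Ev P z w) (h' : Ev Q z v) :
    Ev (P + Q) z (w + v) := by
  unfold Ev at *
  simpa [add_mul] using HasSum.add h h'

theorem neg {P : PowerSeries ℂ} {z w : ℂ} (h : Ev P z w) : Ev (-P) z (-w) := by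
  unfold Ev at *
  simpa using HasSum.neg h

theorem sub {P Q : PowerSeries ℂ} {z w v : ℂ} (h : Ev P z w) (h' : Ev Q z v) :
    Ev (P - Q) z (w - v) := by
  simpa [sub_eq_add_neg] using h.add h'.neg

theorem mul {P Q : PowerSeries ℂ} {z w v : ℂ} (h : Ev P z w) (h' : Ev Q z v) :
    Ev (P * Q) z (w * v) := by
  unfold Ev at *
  have e : (fun n => coeff n (P * Q) * z ^ n) = fun n =>
      ∑ kl ∈ Finset.HasAntidiagonal.antidiagonal n, (coeff kl.1 P * z ^ kl.1) * (coeff kl.2 Q * z ^ kl.2) := by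
    funext n
    rw [coeff_mul, Finset.sum_mul]
    refine Finset.sum_congr rfl fun kl hkl => ?_
    rw [← Finset.HasAntidiagonal.mem_antidiagonal.mp hkl, pow_add]; ring
  have s1 := h.summable.norm
  have s2 := h'.summable.norm
  have := tsum_mul_tsum_eq_tsum_sum_antidiagonal_of_summable_norm s1 s2
  rw [h.tsum_eq, h'.tsum_eq] at this
  rw [e, this]
  exact (summable_norm_sum_mul_antidiagonal_of_summable_norm s1 s2).of_norm.hasSum

theorem const (c z : ℂ) : Ev (C c) z c := by
  unfold Ev
  have := hasSum_single (f := fun n => coeff n (C c) * z ^ n) 0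
    (fun n hn => by simp [coeff_C, hn])
  simpa using this

theorem one (z : ℂ) : Ev 1 z 1 := by simpa using const 1 z
theorem zero (z : ℂ) : Ev 0 z 0 := by simpa using const 0 z

theorem X (z : ℂ) : Ev X z z := by
  unfold Ev
  have := hasSum_single (f := fun n => coeff n (PowerSeries.X : PowerSeries ℂ) * z ^ n) 1
    (fun n hn => by simp [coeff_X, hn])
  simpa using this

theorem pow {P : PowerSeries ℂ} {z w : ℂ} (h : Ev P z w) (n : ℕ) : Ev (P ^ n) z (w ^ n) := by
  induction n with
  | zero => simpa using one z
  | succ n ih => rw [pow_succ, pow_succ]; exact ih.mul h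

theorem smul {P : PowerSeries ℂ} {z w : ℂ} (h : Ev P z w) (c : ℂ) : Ev (C c * P) z (c * w) :=
  (const c z).mul h

theorem prod {ι : Type*} (s : Finset ι) {P : ι → PowerSeries ℂ} {z : ℂ} {w : ι → ℂ}
    (h : ∀ i ∈ s, Ev (P i) z (w i)) : Ev (∏ i ∈ s, P i) z (∏ i ∈ s, w i) := by
  classical
  induction s using Finset.induction_on with
  | empty => simpa using one z
  | insert a s ha ih =>
    rw [Finset.prod_insert ha, Finset.prod_insert ha]
    exact (h a (by simp)).mul (ih fun i hi => h i (by simp [hi]))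

theorem sum {ι : Type*} (s : Finset ι) {P : ι → PowerSeries ℂ} {z : ℂ} {w : ι → ℂ}
    (h : ∀ i ∈ s, Ev (P i) z (w i)) : Ev (∑ i ∈ s, P i) z (∑ i ∈ s, w i) := by
  classical
  induction s using Finset.induction_on with
  | empty => simpa using zero z
  | insert a s ha ih =>
    rw [Finset.sum_insert ha, Finset.sum_insert ha]
    exact (h a (by simp)).add (ih fun i hi => h i (by simp [hi]))

theorem rescale {P : PowerSeries ℂ} {z w a : ℂ} (h : Ev P (a * z) w) :
    Ev (rescale a P) z w := by
  unfold Ev at *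
  convert h using 2 with n
  rw [coeff_rescale, mul_pow]; ring

theorem expand_iff {P : PowerSeries ℂ} {z w : ℂ} (l : ℕ) (hl : l ≠ 0) :
    Ev (expand l hl P) z w ↔ Ev P (z ^ l) w := by
  unfold Ev
  have hinj : Function.Injective (fun n : ℕ => l * n) := fun a b hab => by
    simpa [hl] using hab
  rw [← hinj.hasSum_iff]
  · apply iff_of_eq; congr 1; funext n
    simp only [Function.comp]
    rw [coeff_expand_mul, ← pow_mul]
  · intro n hn
    rw [coeff_expand_of_not_dvd, zero_mul]
    rintro ⟨m, rfl⟩; exact hn ⟨m, rfl⟩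

theorem expand {P : PowerSeries ℂ} {z w : ℂ} (l : ℕ) (hl : l ≠ 0) (h : Ev P (z ^ l) w) :
    Ev (expand l hl P) z w := (expand_iff l hl).2 h

theorem hasFPowerSeries {P : PowerSeries ℂ} {r : NNReal} (hr : 0 < r)
    (h : ∀ z : ℂ, ‖z‖ < r → Summable fun n => coeff n P * z ^ n) :
    HasFPowerSeriesOnBall (fun z => ∑' n, coeff n P * z ^ n)
      (FormalMultilinearSeries.ofScalars ℂ (fun n => coeff n P)) 0 r where
  r_le := by
    refine ENNReal.le_of_forall_nnreal_lt fun r' hr' => ?_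
    refine FormalMultilinearSeries.le_radius_of_summable_norm _ ?_
    have := (h (r' : ℝ) (by simpa using hr')).norm
    refine this.congr fun n => ?_
    rw [FormalMultilinearSeries.ofScalars_norm]
    simp
  r_pos := by exact_mod_cast hr
  hasSum := by
    intro y hy
    have hy' : ‖y‖ < r := by simpa using hy
    have := (h y hy').hasSum
    simp only [zero_add]
    refine HasSum.congr_fun this fun n => ?_
    rw [FormalMultilinearSeries.ofScalars_apply_eq, smul_eq_mul]

theorem eq_of_eventually {P Q : PowerSeries ℂ} {r : ℝ} (hr : 0 < r) {f : ℂ → ℂ}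
    (hP : ∀ z : ℂ, ‖z‖ < r → z ≠ 0 → Ev P z (f z)) (hQ : ∀ z : ℂ, ‖z‖ < r → z ≠ 0 → Ev Q z (f z)) :
    P = Q := by
  rw [← sub_eq_zero]
  have key : ∀ z : ℂ, ‖z‖ < r → z ≠ 0 → Ev (P - Q) z 0 := fun z hz h0 => by
    simpa using (hP z hz h0).sub (hQ z hz h0)
  set R := P - Q
  lift r to NNReal using hr.le
  have hr' : 0 < r := by exact_mod_cast hr
  have hF := hasFPowerSeries (P := R) hr' (fun z hz => by
    by_cases h0 : z = 0
    · subst h0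
      apply summable_of_ne_finset_zero (s := {0})
      intro b hb; simp at hb; simp [hb]
    · exact (key z hz h0).summable)
  have h1 : ∀ᶠ z in nhdsWithin (0 : ℂ) {0}ᶜ, (∑' n, coeff n R * z ^ n) = 0 := by
    have : Metric.ball (0 : ℂ) r ∈ nhds (0 : ℂ) := Metric.ball_mem_nhds _ hr
    filter_upwards [nhdsWithin_le_nhds this, self_mem_nhdsWithin] with z hz h0
    exact (key z (by simpa using hz) h0).tsum_eq
  have h2 := hF.analyticAt.frequently_zero_iff_eventually_zero.1 h1.frequently
  have h3 : FormalMultilinearSeries.ofScalars ℂ (fun n => coeff n R) = 0 :=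
    HasFPowerSeriesAt.eq_zero (hF.hasFPowerSeriesAt.congr h2)
  ext n
  have := congrArg (fun p => FormalMultilinearSeries.coeff p n) h3
  rw [FormalMultilinearSeries.coeff_ofScalars] at this
  rw [this]; rfl

end Ev

end

section
namespace EK
open PowerSeries
open Polynomial (nthRootsFinset)

/-- The product of `B (z T)` over the `l`-th roots of unity `z`. -/
noncomputable def nrm (R : Type*) [CommRing R] [IsDomain R] (l : ℕ) (B : PowerSeries ℤ) :
    PowerSeries R :=
  ∏ z ∈ nthRootsFinset l (1 : R), PowerSeries.rescale z (PowerSeries.map (Int.castRingHom R) B)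

theorem map_rescale' {R S : Type*} [CommRing R] [CommRing S] (f : R →+* S) (z : R)
    (P : PowerSeries R) :
    PowerSeries.map f (PowerSeries.rescale z P) =
      PowerSeries.rescale (f z) (PowerSeries.map f P) := by
  ext n; simp [PowerSeries.coeff_rescale]

theorem map_intCast' {R S : Type*} [CommRing R] [CommRing S] (f : R →+* S)
    (P : PowerSeries ℤ) :
    PowerSeries.map f (PowerSeries.map (Int.castRingHom R) P) =
      PowerSeries.map (Int.castRingHom S) P := by
  ext n; simp

theorem image_nthRoots {R S : Type*} [CommRing R] [IsDomain R] [CommRing S] [IsDomain S]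
    (f : R →+* S) (hf : Function.Injective f) {l : ℕ} (hl : 0 < l) {ζ : R}
    (hζ : IsPrimitiveRoot ζ l) :
    (nthRootsFinset l (1 : R)).map ⟨f, hf⟩ = nthRootsFinset l (1 : S) := by
  apply Finset.eq_of_subset_of_card_le
  · intro x hx
    obtain ⟨y, hy, rfl⟩ := Finset.mem_map.1 hx
    have := (Polynomial.mem_nthRootsFinset hl (1 : R)).1 hy
    refine (Polynomial.mem_nthRootsFinset hl (1 : S)).2 ?_
    simp [← map_pow, this]
  · rw [Finset.card_map, hζ.card_nthRootsFinset, (hζ.map_of_injective hf).card_nthRootsFinset]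

theorem nrm_map {R S : Type*} [CommRing R] [IsDomain R] [CommRing S] [IsDomain S]
    (f : R →+* S) (hf : Function.Injective f) {l : ℕ} (hl : 0 < l) {ζ : R}
    (hζ : IsPrimitiveRoot ζ l) (B : PowerSeries ℤ) :
    PowerSeries.map f (nrm R l B) = nrm S l B := by
  unfold nrm
  rw [← image_nthRoots f hf hl hζ, Finset.prod_map, map_prod]
  refine Finset.prod_congr rfl fun z _ => ?_
  rw [map_rescale', map_intCast']; rfl

theorem nrm_coeff_eq_zero {R : Type*} [CommRing R] [IsDomain R] {l : ℕ} (hl : 0 < l) {ζ : R}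
    (hζ : IsPrimitiveRoot ζ l) (B : PowerSeries ℤ) {n : ℕ} (hn : ¬ l ∣ n) :
    coeff n (nrm R l B) = 0 := by
  have h : PowerSeries.rescale ζ (nrm R l B) = nrm R l B := by
    unfold nrm
    rw [map_prod]
    simp_rw [PowerSeries.rescale_rescale]
    have hu : IsUnit ζ := hζ.isUnit hl.ne'
    refine Finset.prod_bij (fun z _ => z * ζ) ?_ ?_ ?_ ?_
    · intro z hz
      rw [Polynomial.mem_nthRootsFinset hl] at hz ⊢
      rw [mul_pow, hz, hζ.pow_eq_one, one_mul]
    · intro a _ b _ hab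
      exact hu.mul_right_cancel hab
    · intro b hb
      rw [Polynomial.mem_nthRootsFinset hl] at hb
      obtain ⟨u, rfl⟩ := hu
      refine ⟨b * ↑u⁻¹, ?_, by simp⟩
      rw [Polynomial.mem_nthRootsFinset hl, mul_pow, hb, one_mul, ← Units.val_pow_eq_pow_val,
        inv_pow]
      have : u ^ l = 1 := by ext; simpa using hζ.pow_eq_one
      rw [this]; simp
    · intro a _
      rfl
  have h2 := congrArg (coeff n) h
  rw [PowerSeries.coeff_rescale] at h2
  have h3 : (ζ ^ n - 1) * coeff n (nrm R l B) = 0 := by rw [sub_mul, h2]; ring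
  rcases mul_eq_zero.1 h3 with h4 | h4
  · exact absurd (hζ.dvd_of_pow_eq_one n (sub_eq_zero.1 h4)) hn
  · exact h4

theorem pow_char_eq_expand (p : ℕ) [Fact p.Prime] (P : PowerSeries (ZMod p)) :
    P ^ p = expand p (Fact.out : p.Prime).ne_zero P := by
  have hp : p.Prime := Fact.out
  have : CharP (PowerSeries (ZMod p)) p := charP_of_injective_ringHom (C_injective (R := ZMod p)) p
  have hpoly : ∀ T : Polynomial (ZMod p), (T : PowerSeries (ZMod p)) ^ p =
      expand p hp.ne_zero (T : PowerSeries (ZMod p)) := by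
    intro T
    induction T using Polynomial.induction_on' with
    | add a b ha hb => rw [Polynomial.coe_add, add_pow_char, ha, hb, map_add]
    | monomial n a =>
      rw [Polynomial.coe_monomial, expand_monomial]
      have h1 : monomial n a = C a * (X : PowerSeries (ZMod p)) ^ n := by
        ext m; rw [coeff_monomial, coeff_C_mul, coeff_X_pow]; split_ifs <;> simp
      have h2 : monomial (p * n) a = C a * (X : PowerSeries (ZMod p)) ^ (p * n) := by
        ext m; rw [coeff_monomial, coeff_C_mul, coeff_X_pow]; split_ifs <;> simp
      rw [h1, h2, mul_pow, ← pow_mul, mul_comm n p, ← map_pow, ZMod.pow_card]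
  ext n
  obtain ⟨Q, hQ⟩ : ∃ Q : PowerSeries (ZMod p), P = ((trunc (n + 1) P : Polynomial (ZMod p)) : PowerSeries (ZMod p)) + X ^ (n + 1) * Q := by
    have : X ^ (n + 1) ∣ P - ((trunc (n + 1) P : Polynomial (ZMod p)) : PowerSeries (ZMod p)) := by
      rw [X_pow_dvd_iff]
      intro m hm
      rw [map_sub, Polynomial.coeff_coe, coeff_trunc, if_pos hm, sub_self]
    obtain ⟨Q, hQ⟩ := this
    exact ⟨Q, by rw [← hQ]; ring⟩
  rw [hQ, add_pow_char, hpoly, map_add, map_add, map_add, mul_pow, map_mul (expand p _), map_pow (expand p _), expand_X,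
    ← pow_mul, ← pow_mul]
  have hle : ¬ p * (n + 1) ≤ n := by nlinarith [hp.two_le]
  have hle' : ¬ (n + 1) * p ≤ n := by nlinarith [hp.two_le]
  rw [coeff_X_pow_mul', coeff_X_pow_mul', if_neg hle, if_neg hle']

theorem expand_injective' {R : Type*} [CommRing R] (l : ℕ) (hl : l ≠ 0) {P Q : PowerSeries R}
    (h : expand l hl P = expand l hl Q) : P = Q := by
  ext n
  rw [← coeff_expand_mul l hl P n, h, coeff_expand_mul]

theorem intCast_eq_of_charP {k : Type*} [Field k] (p : ℕ) [CharP k p] {P Q : PowerSeries ℤ}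
    (h : PowerSeries.map (Int.castRingHom k) P = PowerSeries.map (Int.castRingHom k) Q) :
    PowerSeries.map (Int.castRingHom (ZMod p)) P = PowerSeries.map (Int.castRingHom (ZMod p)) Q := by
  ext n
  have := congrArg (coeff n) h
  simp only [coeff_map, eq_intCast] at this ⊢
  rw [CharP.intCast_eq_intCast k p] at this
  rwa [ZMod.intCast_eq_intCast_iff]

theorem exists_nrm (l : ℕ) (hl : l.Prime) (B : PowerSeries ℤ) :
    ∃ Cs : PowerSeries ℤ,
      nrm ℂ l B = expand l hl.ne_zero (PowerSeries.map (Int.castRingHom ℂ) Cs) ∧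
      PowerSeries.map (Int.castRingHom (ZMod l)) Cs = PowerSeries.map (Int.castRingHom (ZMod l)) B ∧
      ∀ p : ℕ, p.Prime → ∀ c : ℤ, PowerSeries.map (Int.castRingHom (ZMod p)) B = C (c : ZMod p) →
        PowerSeries.map (Int.castRingHom (ZMod p)) Cs = C ((c : ZMod p) ^ l) := by
  have : NeZero l := ⟨hl.ne_zero⟩
  let K := CyclotomicField l ℚ
  have : IsCyclotomicExtension {l} ℚ K := CyclotomicField.isCyclotomicExtension l ℚ
  have : IsGalois ℚ K := IsCyclotomicExtension.isGalois {l} ℚ K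
  have : NumberField K := IsCyclotomicExtension.numberField {l} ℚ K
  have : FiniteDimensional ℚ K := IsCyclotomicExtension.finiteDimensional {l} ℚ K
  have hζ : IsPrimitiveRoot (IsCyclotomicExtension.zeta l ℚ K) l :=
    IsCyclotomicExtension.zeta_spec l ℚ K
  have hζO := hζ.toInteger_isPrimitiveRoot
  let O := NumberField.RingOfIntegers K
  have hOK : Function.Injective (algebraMap O K) := FaithfulSMul.algebraMap_injective _ _
  have hK : PowerSeries.map (algebraMap O K) (nrm O l B) = nrm K l B :=
    nrm_map _ hOK hl.pos hζO B
  have hIntg : ∀ n, ∃ c : ℤ, coeff n (nrm K l B) = c := by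
    intro n
    have hmem : coeff n (nrm K l B) ∈ (⊥ : IntermediateField ℚ K) := by
      rw [IsGalois.mem_bot_iff_fixed]
      intro σ
      have := nrm_map (σ : K →+* K) σ.injective hl.pos hζ B
      conv_rhs => rw [← this]
      simp
    obtain ⟨r, hr⟩ := IntermediateField.mem_bot.1 hmem
    have hi : IsIntegral ℤ (coeff n (nrm K l B)) := by
      rw [← hK, PowerSeries.coeff_map]
      exact NumberField.RingOfIntegers.isIntegral_coe _
    rw [← hr] at hi
    have hi' : IsIntegral ℤ r :=
      (isIntegral_algebraMap_iff (algebraMap ℚ K).injective).1 hi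
    obtain ⟨c, hc⟩ := IsIntegrallyClosed.isIntegral_iff.1 hi'
    exact ⟨c, by rw [← hr, ← hc]; simp⟩
  choose c hc using hIntg
  let Cs : PowerSeries ℤ := PowerSeries.mk fun n => c (l * n)
  have hCK : nrm K l B = expand l hl.ne_zero (PowerSeries.map (Int.castRingHom K) Cs) := by
    ext n
    by_cases hn : l ∣ n
    · obtain ⟨m, rfl⟩ := hn
      rw [coeff_expand_mul, hc]; simp [Cs]
    · rw [nrm_coeff_eq_zero hl.pos hζ B hn, coeff_expand_of_not_dvd _ _ _ hn]
  have hCO : nrm O l B = expand l hl.ne_zero (PowerSeries.map (Int.castRingHom O) Cs) := by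
    apply PowerSeries.map_injective _ hOK
    rw [hK, hCK, PowerSeries.map_expand, map_intCast']
  have key : ∀ p : ℕ, p.Prime → ∃ (k : Type) (_ : Field k) (_ : CharP k p), Nonempty (O →+* k) := by
    intro p hp
    have hnu : ¬ IsUnit ((p : ℤ) : O) := by
      intro hu
      have : IsUnit (p : ℤ) := by
        obtain ⟨u, hu⟩ := hu
        have h1 : IsIntegral ℤ ((p : ℚ)⁻¹) := by
          have h2 : IsIntegral ℤ (algebraMap ℚ K ((p : ℚ)⁻¹)) := by
            have h3 : algebraMap O K (↑u⁻¹ : O) = algebraMap ℚ K ((p : ℚ)⁻¹) := by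
              have h4 : algebraMap O K (↑u⁻¹ : O) * algebraMap O K (u : O) = 1 := by
                rw [← map_mul]; simp
              rw [hu] at h4
              simp only [Int.cast_natCast, map_natCast] at h4
              rw [map_inv₀, map_natCast]
              exact eq_inv_of_mul_eq_one_left h4
            rw [← h3]
            exact NumberField.RingOfIntegers.isIntegral_coe _
          exact (isIntegral_algebraMap_iff (algebraMap ℚ K).injective).1 h2
        obtain ⟨c, hc⟩ := IsIntegrallyClosed.isIntegral_iff.1 h1
        have hp0 : (p : ℚ) ≠ 0 := by exact_mod_cast hp.ne_zero
        have : (c : ℚ) * p = 1 := by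
          have : (c : ℚ) = (p : ℚ)⁻¹ := by simpa using hc
          rw [this]; field_simp
        have h5 : c * (p : ℤ) = 1 := by exact_mod_cast this
        exact IsUnit.of_mul_eq_one c (by rw [mul_comm]; exact h5)
      have := Int.isUnit_iff_natAbs_eq.1 this
      simp at this
      exact hp.one_lt.ne' this
    obtain ⟨M, hM, hpM⟩ := exists_max_ideal_of_mem_nonunits hnu
    refine ⟨O ⧸ M, Ideal.Quotient.field M, ?_, ⟨Ideal.Quotient.mk M⟩⟩
    let := Ideal.Quotient.field M
    have := Fact.mk hp
    refine (CharP.charP_iff_prime_eq_zero hp).2 ?_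
    have := Ideal.Quotient.eq_zero_iff_mem.2 hpM
    rw [← map_natCast (Ideal.Quotient.mk M)]
    rw [Int.cast_natCast] at this
    exact this
  refine ⟨Cs, ?_, ?_, ?_⟩
  · have e : K →+* ℂ := Classical.choice inferInstance
    rw [← nrm_map e e.injective hl.pos hζ B, hCK, PowerSeries.map_expand, map_intCast']
  · obtain ⟨k, _, _, ⟨g⟩⟩ := key l hl
    have := Fact.mk hl
    have h1 := congrArg (PowerSeries.map g) hCO
    rw [PowerSeries.map_expand, map_intCast'] at h1
    have h2 : PowerSeries.map g (nrm O l B) = (PowerSeries.map (Int.castRingHom k) B) ^ l := by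
      unfold nrm
      rw [map_prod]
      refine (Finset.prod_eq_pow_card ?_).trans
        (congrArg _ hζO.card_nthRootsFinset)
      intro z hz
      rw [Polynomial.mem_nthRootsFinset hl.pos] at hz
      rw [map_rescale', map_intCast']
      have : g z = 1 := by
        have h3 : (g z - 1) ^ l = 0 := by rw [sub_pow_char, ← map_pow, hz]; simp
        exact sub_eq_zero.1 (pow_eq_zero_iff hl.ne_zero |>.1 h3)
      rw [this, PowerSeries.rescale_one]; rfl
    have h3 : (PowerSeries.map (Int.castRingHom k) B) ^ l =
        expand l hl.ne_zero (PowerSeries.map (Int.castRingHom k) B) := by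
      have := congrArg (PowerSeries.map (ZMod.castHom dvd_rfl k))
        (pow_char_eq_expand l (PowerSeries.map (Int.castRingHom (ZMod l)) B))
      rwa [map_pow, map_intCast', PowerSeries.map_expand, map_intCast'] at this
    rw [h2, h3] at h1
    exact (intCast_eq_of_charP l (expand_injective' _ _ h1)).symm
  · intro p hp c hB
    obtain ⟨k, _, _, ⟨g⟩⟩ := key p hp
    have h1 := congrArg (PowerSeries.map g) hCO
    rw [PowerSeries.map_expand, map_intCast'] at h1
    have hBk : PowerSeries.map (Int.castRingHom k) B = C (c : k) := by
      have := congrArg (PowerSeries.map (ZMod.castHom dvd_rfl k)) hB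
      rw [map_intCast', map_C] at this
      simpa using this
    have h2 : PowerSeries.map g (nrm O l B) = (C (c : k)) ^ l := by
      unfold nrm
      rw [map_prod]
      refine (Finset.prod_eq_pow_card ?_).trans
        (congrArg _ hζO.card_nthRootsFinset)
      intro z hz
      rw [map_rescale', map_intCast', hBk]
      ext n
      rw [coeff_rescale, coeff_C]
      split_ifs with h <;> simp [h]
    rw [h2] at h1
    have h4 : PowerSeries.map (Int.castRingHom k) Cs =
        PowerSeries.map (Int.castRingHom k) (C (c ^ l)) := by
      apply expand_injective' l hl.ne_zero
      rw [← h1, map_C, expand_C]; simp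
    rw [intCast_eq_of_charP p h4, map_C]; simp
end EK

end

section
namespace EK
open PowerSeries UpperHalfPlane ModularForm MatrixGroups

/-- `q = exp (2 π i τ)`. -/
noncomputable def qq (τ : ℍ) : ℂ := Function.Periodic.qParam 1 (τ : ℂ)

theorem qq_ne_zero (τ : ℍ) : qq τ ≠ 0 := Function.Periodic.qParam_ne_zero _
theorem norm_qq_lt (τ : ℍ) : ‖qq τ‖ < 1 :=
  Function.Periodic.norm_qParam_lt_one one_pos τ.im_pos

theorem exists_qq {z : ℂ} (h0 : z ≠ 0) (h1 : ‖z‖ < 1) : ∃ τ : ℍ, qq τ = z := by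
  have hr := Function.Periodic.qParam_right_inv (h := 1) one_ne_zero h0
  refine ⟨⟨Function.Periodic.invQParam 1 z, ?_⟩, hr⟩
  have := Function.Periodic.norm_qParam_lt_iff (h := 1) one_pos 0 (Function.Periodic.invQParam 1 z)
  rw [hr] at this
  exact this.1 (by simpa using h1)

theorem qser_unique {P Q : PowerSeries ℂ} {g : ℍ → ℂ} (hP : ∀ τ, Ev P (qq τ) (g τ))
    (hQ : ∀ τ, Ev Q (qq τ) (g τ)) : P = Q := by
  classical
  refine Ev.eq_of_eventually (f := fun z => if h : ∃ τ, qq τ = z then g h.choose else 0) one_pos ?_ ?_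
  · intro z hz h0
    have h := exists_qq h0 hz
    have e := h.choose_spec
    simp only [dif_pos h]
    have := hP h.choose
    rwa [e] at this
  · intro z hz h0
    have h := exists_qq h0 hz
    have e := h.choose_spec
    simp only [dif_pos h]
    have := hQ h.choose
    rwa [e] at this

theorem summable_of_qser {P : PowerSeries ℂ} {g : ℍ → ℂ} (hP : ∀ τ, Ev P (qq τ) (g τ))
    (z : ℂ) (hz : ‖z‖ < 1) : Summable fun n => coeff n P * z ^ n := by
  by_cases h0 : z = 0
  · subst h0
    apply summable_of_ne_finset_zero (s := {0})
    intro b hb; simp at hb; simp [hb]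
  · obtain ⟨τ, rfl⟩ := exists_qq h0 hz
    exact (hP τ).summable

theorem differentiable_of_qser {P : PowerSeries ℂ} {g : ℍ → ℂ} (hP : ∀ τ, Ev P (qq τ) (g τ)) :
    DifferentiableOn ℂ (g ∘ ofComplex) {z | 0 < z.im} := by
  have hF := Ev.hasFPowerSeries (P := P) (r := 1) one_pos (fun z hz => by
    exact summable_of_qser hP z (by simpa using hz))
  have hd := hF.differentiableOn
  have h2 : DifferentiableOn ℂ ((fun z => ∑' n, coeff n P * z ^ n) ∘ Function.Periodic.qParam 1)
      {z | 0 < z.im} := by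
    refine hd.comp ?_ ?_
    · exact (Function.Periodic.differentiable_qParam).differentiableOn
    · intro z hz
      have := Function.Periodic.norm_qParam_lt_one (h := 1) one_pos hz
      have h3 : ‖Function.Periodic.qParam 1 z‖ < ((1 : NNReal) : ℝ) := by simpa using this
      rw [Metric.mem_eball, edist_eq_enorm_sub, sub_zero]
      rw [enorm_eq_nnnorm]
      exact_mod_cast h3
  refine h2.congr fun z hz => ?_
  simp only [Function.comp]
  rw [ofComplex_apply_of_im_pos hz]
  exact ((hP ⟨z, hz⟩).tsum_eq).symm

/-- level one modular forms, concretely -/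
structure MF (k : ℕ) (g : ℍ → ℂ) (P : PowerSeries ℂ) : Prop where
  ev : ∀ τ, Ev P (qq τ) (g τ)
  inv : ∀ τ : ℍ, g (ModularGroup.S • τ) = (τ : ℂ) ^ k * g τ

theorem qq_T (τ : ℍ) : qq (ModularGroup.T • τ) = qq τ := by
  unfold qq
  rw [UpperHalfPlane.modular_T_smul, UpperHalfPlane.coe_vadd]
  unfold Function.Periodic.qParam
  rw [Complex.exp_eq_exp_iff_exists_int]
  exact ⟨1, by push_cast; ring⟩

theorem MF.toForm {k : ℕ} {g : ℍ → ℂ} {P : PowerSeries ℂ} (h : MF k g P) :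
    ∃ f : ModularForm 𝒮ℒ k, ⇑f = g ∧ qExpansion 1 f = P := by
  have hS : g ∣[(k : ℤ)] ModularGroup.S = g := by
    ext τ
    rw [SL_slash_apply, h.inv, ModularGroup.denom_S, zpow_neg, zpow_natCast]
    have := τ.ne_zero
    field_simp
  have hT : g ∣[(k : ℤ)] ModularGroup.T = g := by
    ext τ
    rw [SL_slash_apply]
    have h1 : g (ModularGroup.T • τ) = g τ := by
      have := h.ev (ModularGroup.T • τ)
      rw [qq_T] at this
      exact this.unique (h.ev τ)
    rw [h1]
    rw [ModularGroup.denom_apply]; simp [ModularGroup.T]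
  have hγ := SlashInvariantForm.slash_action_generators_SL2Z hS hT
  have hb : IsBoundedAtImInfty g := by
    refine isBoundedAtImInfty_of_hasSum_qExpansion (h := 1) one_pos (c := fun n => coeff n P) ?_
    intro τ
    exact h.ev τ
  let f : ModularForm 𝒮ℒ k :=
    { toFun := g
      slash_action_eq' := by
        rintro A ⟨A, rfl⟩
        exact hγ A
      holo' := by
        rw [UpperHalfPlane.mdifferentiable_iff]
        exact differentiable_of_qser h.ev
      bdd_at_cusps' := by
        intro c hc
        rw [Subgroup.IsArithmetic.isCusp_iff_isCusp_SL2Z] at hc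
        rw [OnePoint.isBoundedAt_iff_forall_SL2Z hc]
        intro γ _
        rw [hγ γ]; exact hb }
  refine ⟨f, rfl, ?_⟩
  ext n
  have := ModularFormClass.qExpansion_coeff_unique (f := f) (h := 1) one_pos
    one_mem_strictPeriods_SL (c := fun n => coeff n P) (fun τ => h.ev τ) n
  exact this.symm

theorem MF.of_form {k : ℕ} (f : ModularForm 𝒮ℒ k) : MF k f (qExpansion 1 f) where
  ev τ := ModularForm.hasSum_qExpansion (f := f) (h := 1) one_pos one_mem_strictPeriods_SL τ
  inv τ := by
    have := SlashInvariantForm.slash_action_eqn'' f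
      (γ := ((ModularGroup.S : SL(2, ℤ)) : GL (Fin 2) ℝ)) (show _ ∈ 𝒮ℒ from ⟨_, rfl⟩) τ
    rw [ModularGroup.denom_S] at this
    exact_mod_cast this

theorem MF.slash {k : ℕ} {g : ℍ → ℂ} {P : PowerSeries ℂ} (h : MF k g P) (γ : SL(2, ℤ)) (τ : ℍ) :
    g (γ • τ) = ((γ 1 0 : ℂ) * τ + γ 1 1) ^ k * g τ := by
  obtain ⟨f, rfl, -⟩ := h.toForm
  have := SlashInvariantForm.slash_action_eqn'' f
      (γ := ((γ : SL(2, ℤ)) : GL (Fin 2) ℝ)) (show _ ∈ 𝒮ℒ from ⟨_, rfl⟩) τ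
  simpa [ModularGroup.denom_apply] using this

theorem MF.sturm {k : ℕ} {g : ℍ → ℂ} {P : PowerSeries ℂ} (h : MF k g P)
    (h0 : ∀ n ≤ k / 12, coeff n P = 0) : P = 0 ∧ g = 0 := by
  obtain ⟨f, hf, hP⟩ := h.toForm
  have : f = 0 := by
    apply ModularForm.sturm_bound_levelOne_nat
    rw [hP]
    rw [← ENat.add_one_le_iff (ENat.coe_ne_top _)]
    refine PowerSeries.le_order _ _ fun i hi => h0 i ?_
    have : (i : ℕ∞) < ((k / 12 + 1 : ℕ) : ℕ∞) := by simpa using hi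
    have := Nat.cast_lt.1 this
    omega
  subst this
  refine ⟨?_, ?_⟩
  · rw [← hP]; exact UpperHalfPlane.qExpansion_zero 1
  · rw [← hf]; rfl

theorem MF.mul {k k' : ℕ} {g g' : ℍ → ℂ} {P P' : PowerSeries ℂ} (h : MF k g P) (h' : MF k' g' P') :
    MF (k + k') (g * g') (P * P') where
  ev τ := (h.ev τ).mul (h'.ev τ)
  inv τ := by simp only [Pi.mul_apply]; rw [h.inv, h'.inv]; ring

theorem MF.add {k : ℕ} {g g' : ℍ → ℂ} {P P' : PowerSeries ℂ} (h : MF k g P) (h' : MF k g' P') :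
    MF k (g + g') (P + P') where
  ev τ := (h.ev τ).add (h'.ev τ)
  inv τ := by simp only [Pi.add_apply]; rw [h.inv, h'.inv]; ring

theorem MF.sub {k : ℕ} {g g' : ℍ → ℂ} {P P' : PowerSeries ℂ} (h : MF k g P) (h' : MF k g' P') :
    MF k (g - g') (P - P') where
  ev τ := (h.ev τ).sub (h'.ev τ)
  inv τ := by simp only [Pi.sub_apply]; rw [h.inv, h'.inv]; ring

theorem MF.smul {k : ℕ} {g : ℍ → ℂ} {P : PowerSeries ℂ} (h : MF k g P) (c : ℂ) :
    MF k (fun τ => c * g τ) (C c * P) where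
  ev τ := (h.ev τ).smul c
  inv τ := by rw [h.inv]; ring

theorem MF.one : MF 0 1 1 where
  ev τ := Ev.one _
  inv τ := by simp

theorem MF.pow {k : ℕ} {g : ℍ → ℂ} {P : PowerSeries ℂ} (h : MF k g P) (n : ℕ) :
    MF (k * n) (g ^ n) (P ^ n) := by
  induction n with
  | zero => simpa using MF.one
  | succ n ih => rw [pow_succ, pow_succ, mul_add, mul_one]; exact ih.mul h

theorem MF.unique {k : ℕ} {g : ℍ → ℂ} {P Q : PowerSeries ℂ} (h : MF k g P) (h' : MF k g Q) :
    P = Q := qser_unique h.ev h'.ev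

theorem MF.ext {k : ℕ} {g g' : ℍ → ℂ} {P : PowerSeries ℂ} (h : MF k g P) (h' : MF k g' P) :
    g = g' := funext fun τ => (h.ev τ).unique (h'.ev τ)

end EK

end

section
namespace EK
open PowerSeries UpperHalfPlane ModularForm MatrixGroups

/-- homogenization of `Q` in degree `m`, evaluated at `(x, y)`. -/
noncomputable def hom {k R : Type*} [CommRing k] [CommRing R] [Algebra k R]
    (m : ℕ) (Q : Polynomial k) (x y : R) : R :=
  ∑ i ∈ Finset.range (m + 1), algebraMap k R (Q.coeff i) * (x ^ i * y ^ (m - i))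

theorem hom_field {k R : Type*} [CommRing k] [Field R] [Algebra k R]
    (m : ℕ) (Q : Polynomial k) (hQ : Q.natDegree ≤ m) (x y : R) (hy : y ≠ 0) :
    hom m Q x y = y ^ m * Polynomial.aeval (x / y) Q := by
  unfold hom
  rw [Polynomial.aeval_eq_sum_range' (Nat.lt_succ_of_le hQ), Finset.mul_sum]
  refine Finset.sum_congr rfl fun i hi => ?_
  have : i ≤ m := Nat.lt_succ_iff.1 (Finset.mem_range.1 hi)
  obtain ⟨j, rfl⟩ := Nat.exists_eq_add_of_le this
  rw [Algebra.smul_def, div_pow]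
  simp only [add_tsub_cancel_left]
  field_simp
  ring

theorem map_hom {k R S : Type*} [CommRing k] [CommRing R] [Algebra k R] [CommRing S] [Algebra k S]
    (f : R →+* S) (hf : ∀ a : k, f (algebraMap k R a) = algebraMap k S a)
    (m : ℕ) (Q : Polynomial k) (x y : R) :
    f (hom m Q x y) = hom m Q (f x) (f y) := by
  unfold hom
  simp [hf]

theorem hom_mapPoly {k k' R : Type*} [CommRing k] [CommRing k'] [CommRing R] [Algebra k R]
    [Algebra k' R] (f : k →+* k') (hf : ∀ a : k, algebraMap k' R (f a) = algebraMap k R a)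
    (m : ℕ) (Q : Polynomial k) (x y : R) :
    hom m (Q.map f) x y = hom m Q x y := by
  unfold hom
  simp [hf]

theorem hom_mul {k R : Type*} [CommRing k] [CommRing R] [IsDomain R] [Algebra k R]
    (m n : ℕ) (Q Q' : Polynomial k) (hQ : Q.natDegree ≤ m) (hQ' : Q'.natDegree ≤ n)
    (x y : R) (hy : y ≠ 0) : hom m Q x y * hom n Q' x y = hom (m + n) (Q * Q') x y := by
  let K := FractionRing R
  have hinj : Function.Injective (algebraMap R K) := IsFractionRing.injective R K
  apply hinj
  have hf : ∀ a : k, algebraMap R K (algebraMap k R a) = algebraMap k K a := fun a =>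
    (IsScalarTower.algebraMap_apply k R K a).symm
  have hy' : algebraMap R K y ≠ 0 := by
    intro h; exact hy (hinj (by rw [h, map_zero]))
  rw [map_mul, map_hom _ hf, map_hom _ hf, map_hom _ hf, hom_field _ _ hQ _ _ hy',
    hom_field _ _ hQ' _ _ hy',
    hom_field _ _ (Polynomial.natDegree_mul_le.trans (add_le_add hQ hQ')) _ _ hy', map_mul]
  ring

theorem hom_pow {k R : Type*} [CommRing k] [CommRing R] [IsDomain R] [Algebra k R]
    (m n : ℕ) (Q : Polynomial k) (hQ : Q.natDegree ≤ m)
    (x y : R) (hy : y ≠ 0) : hom m Q x y ^ n = hom (m * n) (Q ^ n) x y := by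
  induction n with
  | zero => simp [hom]
  | succ n ih =>
    rw [pow_succ, ih, pow_succ, mul_add, mul_one, hom_mul _ _ _ _ _ hQ _ _ hy]
    exact (Polynomial.natDegree_pow_le).trans (by rw [mul_comm]; gcongr)

theorem hom_sub {k R : Type*} [CommRing k] [CommRing R] [Algebra k R]
    (m : ℕ) (Q Q' : Polynomial k) (x y : R) :
    hom m (Q - Q') x y = hom m Q x y - hom m Q' x y := by
  unfold hom
  rw [← Finset.sum_sub_distrib]
  refine Finset.sum_congr rfl fun i _ => ?_
  rw [Polynomial.coeff_sub, map_sub]; ring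

theorem hom_add {k R : Type*} [CommRing k] [CommRing R] [Algebra k R]
    (m : ℕ) (Q Q' : Polynomial k) (x y : R) :
    hom m (Q + Q') x y = hom m Q x y + hom m Q' x y := by
  unfold hom
  rw [← Finset.sum_add_distrib]
  refine Finset.sum_congr rfl fun i _ => ?_
  rw [Polynomial.coeff_add, map_add]; ring

theorem hom_monomial {k R : Type*} [CommRing k] [CommRing R] [Algebra k R]
    (m i : ℕ) (hi : i ≤ m) (a : k) (x y : R) :
    hom m (Polynomial.monomial i a) x y = algebraMap k R a * (x ^ i * y ^ (m - i)) := by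
  unfold hom
  rw [Finset.sum_eq_single i]
  · rw [Polynomial.coeff_monomial, if_pos rfl]
  · intro b _ hb
    rw [Polynomial.coeff_monomial, if_neg (Ne.symm hb)]; simp
  · intro h; exact absurd (Finset.mem_range.2 (by omega)) h

theorem coeff_mul_pow_of_lt {R : Type*} [CommRing R] (x y : PowerSeries R)
    (hy : coeff 0 y = 0) {n j : ℕ} (h : n < j) : coeff n (x * y ^ j) = 0 := by
  obtain ⟨u, hu⟩ := X_dvd_iff.2 (by simpa using hy : constantCoeff y = 0)
  rw [hu, mul_pow, mul_left_comm, coeff_X_pow_mul', if_neg (by omega)]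

theorem coeff_mul_pow_self {R : Type*} [CommRing R] (x y : PowerSeries R) (hx : coeff 0 x = 1)
    (hy : coeff 0 y = 0) (hy1 : coeff 1 y = 1) (k j : ℕ) : coeff j (x ^ k * y ^ j) = 1 := by
  obtain ⟨u, hu⟩ := X_dvd_iff.2 (by simpa using hy : constantCoeff y = 0)
  have hu1 : constantCoeff u = 1 := by
    rw [hu, ← zero_add 1, coeff_succ_X_mul] at hy1; simpa using hy1
  have hx' : constantCoeff x = 1 := by simpa using hx
  rw [hu, mul_pow, mul_left_comm, coeff_X_pow_mul', if_pos le_rfl, Nat.sub_self]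
  simp [hu1, hx']

theorem hom_eq_zero {k : Type*} [CommRing k] (m : ℕ) (Q : Polynomial k) (hQ : Q.natDegree ≤ m)
    (x y : PowerSeries k) (hx : coeff 0 x = 1)
    (hy : coeff 0 y = 0) (hy1 : coeff 1 y = 1) (h : hom m Q x y = 0) : Q = 0 := by
  by_contra h0
  have h1 := congrArg (coeff (m - Q.natDegree)) h
  unfold hom at h1
  rw [map_sum, Finset.sum_eq_single Q.natDegree] at h1
  · have e : algebraMap k (PowerSeries k) (Q.coeff Q.natDegree) = C (Q.coeff Q.natDegree) := rfl
    rw [e, coeff_C_mul, coeff_mul_pow_self _ _ hx hy hy1, mul_one, map_zero] at h1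
    exact h0 (Polynomial.leadingCoeff_eq_zero.1 h1)
  · intro i hi hne
    have e : algebraMap k (PowerSeries k) (Q.coeff i) = C (Q.coeff i) := rfl
    rw [e, coeff_C_mul]
    rcases lt_or_gt_of_ne hne with hlt | hgt
    · rw [coeff_mul_pow_of_lt _ _ hy (by omega), mul_zero]
    · rw [Polynomial.coeff_eq_zero_of_natDegree_lt hgt, zero_mul]
  · intro hh; exact absurd (Finset.mem_range.2 (by omega)) hh

/-- coefficientwise cast -/
noncomputable abbrev Zc : PowerSeries ℤ →+* PowerSeries ℂ := PowerSeries.map (Int.castRingHom ℂ)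

theorem Zc_injective : Function.Injective Zc :=
  PowerSeries.map_injective _ Int.cast_injective

noncomputable def e4 : ℍ → ℂ := fun τ => ModularForm.E₄ τ
noncomputable def e6 : ℍ → ℂ := fun τ => ModularForm.E₆ τ
noncomputable def dl : ℍ → ℂ := fun τ => ModularForm.discriminant τ
noncomputable def jj : ℍ → ℂ := fun τ => e4 τ ^ 3 / dl τ

theorem dl_ne_zero (τ : ℍ) : dl τ ≠ 0 := ModularForm.discriminant_ne_zero τ
theorem dl_eq (τ : ℍ) : 1728 * dl τ = e4 τ ^ 3 - e6 τ ^ 2 := by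
  unfold dl e4 e6
  rw [ModularForm.discriminant_eq_E₄_cube_sub_E₆_sq]; field_simp

noncomputable def S3 : PowerSeries ℤ := mk fun n => (ArithmeticFunction.sigma 3 n : ℤ)
noncomputable def S5 : PowerSeries ℤ := mk fun n => (ArithmeticFunction.sigma 5 n : ℤ)
noncomputable def P4 : PowerSeries ℤ := 1 + C 240 * S3
noncomputable def P6 : PowerSeries ℤ := 1 - C 504 * S5
noncomputable def S53 : PowerSeries ℤ := mk fun n =>
  (5 * (ArithmeticFunction.sigma 3 n : ℤ) + 7 * (ArithmeticFunction.sigma 5 n : ℤ)) / 12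
noncomputable def PD : PowerSeries ℤ :=
  S53 + C 100 * S3 ^ 2 + C 8000 * S3 ^ 3 - C 147 * S5 ^ 2

theorem S53_eq : C 12 * S53 = C 5 * S3 + C 7 * S5 := by
  ext n
  simp only [S53, S3, S5, coeff_C_mul, map_add, coeff_mk]
  rw [Int.mul_ediv_cancel']
  rw [ArithmeticFunction.sigma_apply, ArithmeticFunction.sigma_apply]
  push_cast
  rw [Finset.mul_sum, Finset.mul_sum, ← Finset.sum_add_distrib]
  refine Finset.dvd_sum fun d _ => ?_
  have : ∀ z : ZMod 12, 5 * z ^ 3 + 7 * z ^ 5 = 0 := by decide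
  have h := this d
  refine (ZMod.intCast_zmod_eq_zero_iff_dvd _ 12).1 ?_
  push_cast
  exact h

theorem PD_eq : C 1728 * PD = P4 ^ 3 - P6 ^ 2 := by
  have h := S53_eq
  have e : (C : ℤ →+* PowerSeries ℤ) = algebraMap ℤ (PowerSeries ℤ) := rfl
  unfold PD P4 P6
  simp only [e, map_ofNat] at h ⊢
  linear_combination 144 * h

theorem coeff_zero_P4 : coeff 0 P4 = 1 := by simp [P4, S3]
theorem coeff_zero_P6 : coeff 0 P6 = 1 := by simp [P6, S5]
theorem coeff_zero_PD : coeff 0 PD = 0 := by simp [PD, S3, S5, S53]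
theorem coeff_one_PD : coeff 1 PD = 1 := by
  have h3 : X ∣ S3 := X_dvd_iff.2 (by simp [S3])
  have h5 : X ∣ S5 := X_dvd_iff.2 (by simp [S5])
  obtain ⟨u, hu⟩ := h3
  obtain ⟨v, hv⟩ := h5
  have a1 : coeff 1 (C 100 * S3 ^ 2) = (0 : ℤ) := by
    rw [coeff_C_mul, hu, mul_pow, coeff_X_pow_mul', if_neg (by norm_num), mul_zero]
  have a2 : coeff 1 (C 8000 * S3 ^ 3) = (0 : ℤ) := by
    rw [coeff_C_mul, hu, mul_pow, coeff_X_pow_mul', if_neg (by norm_num), mul_zero]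
  have a3 : coeff 1 (C 147 * S5 ^ 2) = (0 : ℤ) := by
    rw [coeff_C_mul, hv, mul_pow, coeff_X_pow_mul', if_neg (by norm_num), mul_zero]
  unfold PD
  rw [map_sub, map_add, map_add, a1, a2, a3]
  simp [S53]

theorem MF_e4 : MF 4 e4 (Zc P4) := by
  have h := MF.of_form (k := 4) ModularForm.E₄
  have e : qExpansion 1 ModularForm.E₄ = Zc P4 := by
    ext n
    have := EisensteinSeries.E_qExpansion_coeff (k := 4) (by norm_num) (by decide) n
    rw [this]
    rw [bernoulli_eq_bernoulli'_of_ne_one (by norm_num)]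
    simp only [P4, S3, coeff_map, map_add, coeff_one, coeff_C_mul, coeff_mk, bernoulli'_four]
    split_ifs with h
    · simp [h]
    · simp; norm_num
  rw [e] at h
  exact h

theorem MF_e6 : MF 6 e6 (Zc P6) := by
  have h := MF.of_form (k := 6) ModularForm.E₆
  have e : qExpansion 1 ModularForm.E₆ = Zc P6 := by
    ext n
    have := EisensteinSeries.E_qExpansion_coeff (k := 6) (by norm_num) (by decide) n
    rw [this]
    rw [show bernoulli 6 = 1 / 42 by decide +kernel]
    simp only [P6, S5, coeff_map, map_sub, coeff_one, coeff_C_mul, coeff_mk]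
    split_ifs with h
    · simp [h]
    · simp; norm_num
  rw [e] at h
  exact h

theorem MF_dl : MF 12 dl (Zc PD) := by
  have h := ((MF_e4.pow 3).sub (MF_e6.pow 2)).smul (1 / 1728)
  have e1 : (fun τ => (1 / 1728 : ℂ) * (e4 ^ 3 - e6 ^ 2) τ) = dl := by
    funext τ
    have := dl_eq τ
    simp only [Pi.sub_apply, Pi.pow_apply]
    rw [← this]; field_simp
  have e2 : C (1 / 1728 : ℂ) * (Zc P4 ^ 3 - Zc P6 ^ 2) = Zc PD := by
    rw [← map_pow, ← map_pow, ← map_sub, ← PD_eq, map_mul, map_C, ← mul_assoc, ← map_mul]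
    simp
  rw [e1, e2] at h
  exact h

theorem jj_mul (τ : ℍ) : jj τ * dl τ = e4 τ ^ 3 := by
  unfold jj; field_simp [dl_ne_zero τ]
theorem jj_sub (τ : ℍ) : (jj τ - 1728) * dl τ = e6 τ ^ 2 := by
  rw [sub_mul, jj_mul, dl_eq]; ring

theorem liou (m r : ℕ) (hr : r ≤ m + 1) (g : ℍ → ℂ) (P : PowerSeries ℤ) (h : MF (12 * m) g (Zc P))
    (hord : ∀ n < r, coeff n P = 0) :
    ∃ Q : Polynomial ℤ, (∀ k, m < k + r → Q.coeff k = 0) ∧ P = hom m Q (P4 ^ 3) PD ∧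
      (r ≤ m → Q.coeff (m - r) = coeff r P) ∧
      ∀ τ, g τ = dl τ ^ m * Polynomial.aeval (jj τ) Q := by
  induction hn : m + 1 - r generalizing r g P with
  | zero =>
    have hz : Zc P = 0 ∧ g = 0 := h.sturm fun n hn' => by
      have : n ≤ m := by simpa using hn'
      rw [coeff_map, hord n (by omega)]; simp
    have hP : P = 0 := Zc_injective (by rw [hz.1, map_zero])
    exact ⟨0, by simp, by simp [hP, hom], fun hh => by omega, fun τ => by simp [hz.2]⟩
  | succ n ih =>
    have hrm : r ≤ m := by omega
    set a := coeff r P with ha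
    set P' := P - C a * (P4 ^ (3 * (m - r)) * PD ^ r)
    have hM : MF (12 * m) (g - fun τ => (a : ℂ) * (e4 ^ (3 * (m - r)) * dl ^ r) τ) (Zc P') := by
      have h1 := ((MF_e4.pow (3 * (m - r))).mul (MF_dl.pow r)).smul (a : ℂ)
      have e : 4 * (3 * (m - r)) + 12 * r = 12 * m := by omega
      rw [e] at h1
      have := h.sub h1
      convert this using 1
      simp [P', map_sub, map_mul]
    obtain ⟨Q, hQ1, hQ2, -, hQ4⟩ := ih (r + 1) (by omega) _ P' hM (by
      intro i hi
      rcases Nat.lt_succ_iff_lt_or_eq.1 hi with hlt | rfl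
      · simp only [P']
        rw [map_sub, coeff_C_mul, hord i hlt, coeff_mul_pow_of_lt _ _ coeff_zero_PD hlt]; simp
      · simp only [P']
        rw [map_sub, coeff_C_mul, coeff_mul_pow_self _ _ coeff_zero_P4 coeff_zero_PD coeff_one_PD]
        simp [ha]) (by omega)
    have hsub : m - (m - r) = r := by omega
    refine ⟨Q + Polynomial.monomial (m - r) a, ?_, ?_, ?_, ?_⟩
    · intro k hk
      rw [Polynomial.coeff_add, hQ1 k (by omega), Polynomial.coeff_monomial,
        if_neg (by omega), add_zero]
    · rw [hom_add, hom_monomial _ _ (by omega), ← hQ2, hsub, ← pow_mul]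
      simp only [P']
      have : algebraMap ℤ (PowerSeries ℤ) a = C a := rfl
      rw [this]; ring
    · intro _
      rw [Polynomial.coeff_add, hQ1 _ (by omega), Polynomial.coeff_monomial, if_pos rfl, zero_add]
    · intro τ
      have h1 := hQ4 τ
      simp only [Pi.sub_apply, Pi.mul_apply, Pi.pow_apply] at h1
      rw [map_add, mul_add, ← h1, Polynomial.aeval_monomial, pow_mul (e4 τ), ← jj_mul]
      have : dl τ ^ m = dl τ ^ (m - r) * dl τ ^ r := by rw [← pow_add]; congr 1; omega
      rw [this, mul_pow]
      simp; ring

end EK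

end

section
namespace EK
open PowerSeries UpperHalfPlane ModularForm MatrixGroups

/-- `q d/dq` on power series -/
noncomputable def th (R : Type*) [CommRing R] : Derivation R (PowerSeries R) (PowerSeries R) :=
  (PowerSeries.X : PowerSeries R) • PowerSeries.derivative R

theorem coeff_th {R : Type*} [CommRing R] (P : PowerSeries R) (n : ℕ) :
    coeff n (th R P) = n * coeff n P := by
  simp only [th, Derivation.smul_apply, smul_eq_mul]
  cases n with
  | zero => simp
  | succ n =>
    rw [coeff_succ_X_mul, PowerSeries.coeff_derivative]; push_cast; ring

theorem map_th {R S : Type*} [CommRing R] [CommRing S] (f : R →+* S) (P : PowerSeries R) :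
    PowerSeries.map f (th R P) = th S (PowerSeries.map f P) := by
  ext n; simp [coeff_th]

noncomputable def Dg (g : ℍ → ℂ) (τ : ℍ) : ℂ :=
  (2 * Real.pi * Complex.I)⁻¹ * deriv (g ∘ ofComplex) τ

theorem Ev_deriv {P : PowerSeries ℂ} (F : ℂ → ℂ)
    (hF : ∀ z, ‖z‖ < 1 → Ev P z (F z)) (z : ℂ) (hz : ‖z‖ < 1) :
    DifferentiableAt ℂ F z ∧ Ev (th ℂ P) z (z * deriv F z) := by
  have hps := Ev.hasFPowerSeries (P := P) (r := 1) one_pos (fun z hz =>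
    (hF z (by simpa using hz)).summable)
  have hball : ∀ z : ℂ, z ∈ Metric.ball (0 : ℂ) 1 ↔ ‖z‖ < 1 := fun z => by simp
  have hd0 := hps.differentiableOn
  have hd : DifferentiableOn ℂ F (Metric.ball 0 1) := by
    refine (hd0.mono ?_).congr ?_
    · intro w hw
      rw [Metric.mem_eball, edist_eq_enorm_sub, sub_zero, enorm_eq_nnnorm]
      have h3 : ‖w‖ < ((1 : NNReal) : ℝ) := by simpa using hw
      exact_mod_cast h3
    · intro w hw
      exact ((hF w ((hball w).1 hw)).tsum_eq).symm
  have hda : ∀ w, ‖w‖ < 1 → DifferentiableAt ℂ F w := fun w hw =>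
    hd.differentiableAt (Metric.isOpen_ball.mem_nhds ((hball w).2 hw))
  have e1 : P = mk fun n => (n.factorial : ℂ)⁻¹ * iteratedDeriv n F 0 := by
    refine Ev.eq_of_eventually (r := 1) one_pos (f := F) (fun w hw _ => hF w hw) ?_
    intro w hw _
    have := Complex.hasSum_taylorSeries_on_ball (c := 0) (r := 1) hd ((hball w).2 hw)
    refine HasSum.congr_fun this fun n => ?_
    simp only [coeff_mk, smul_eq_mul, sub_zero]; ring
  refine ⟨hda z hz, ?_⟩
  have hd' : DifferentiableOn ℂ (deriv F) (Metric.ball 0 1) :=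
    hd.deriv Metric.isOpen_ball
  have hs := Complex.hasSum_taylorSeries_on_ball (c := 0) (r := 1) hd' ((hball z).2 hz)
  have e2 : Ev (PowerSeries.derivative ℂ P) z (deriv F z) := by
    refine HasSum.congr_fun hs fun n => ?_
    rw [PowerSeries.coeff_derivative, e1]
    simp only [coeff_mk, smul_eq_mul, sub_zero, ← iteratedDeriv_succ']
    rw [Nat.factorial_succ]
    have : ((n : ℂ) + 1) ≠ 0 := by exact_mod_cast Nat.succ_ne_zero n
    push_cast
    field_simp
  exact (Ev.X z).mul e2

theorem qser_deriv {P : PowerSeries ℂ} {g : ℍ → ℂ} (hP : ∀ τ, Ev P (qq τ) (g τ)) (τ : ℍ) :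
    HasDerivAt (g ∘ ofComplex) (2 * Real.pi * Complex.I * Dg g τ) τ ∧
      Ev (th ℂ P) (qq τ) (Dg g τ) := by
  set F : ℂ → ℂ := fun z => ∑' n, coeff n P * z ^ n
  have hF : ∀ z, ‖z‖ < 1 → Ev P z (F z) := fun z hz => (summable_of_qser hP z hz).hasSum
  obtain ⟨h1, h2⟩ := Ev_deriv F hF (qq τ) (norm_qq_lt τ)
  have hq : HasDerivAt (Function.Periodic.qParam 1) (2 * Real.pi * Complex.I * qq τ) (τ : ℂ) := by
    have := ((hasDerivAt_id (τ : ℂ)).const_mul (2 * Real.pi * Complex.I)).cexp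
    simp only [mul_one, id] at this
    have e : Function.Periodic.qParam 1 = fun z => Complex.exp (2 * Real.pi * Complex.I * z) := by
      funext z; simp [Function.Periodic.qParam]
    unfold qq
    rw [e]
    exact this.congr_deriv (by ring)
  have h3 : HasDerivAt (F ∘ Function.Periodic.qParam 1)
      (deriv F (qq τ) * (2 * Real.pi * Complex.I * qq τ)) (τ : ℂ) :=
    HasDerivAt.comp (τ : ℂ) (show HasDerivAt F _ (Function.Periodic.qParam 1 (τ : ℂ)) from
      h1.hasDerivAt) hq
  have h4 : HasDerivAt (g ∘ ofComplex) (deriv F (qq τ) * (2 * Real.pi * Complex.I * qq τ))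
      (τ : ℂ) := by
    refine h3.congr_of_eventuallyEq ?_
    have : {z : ℂ | 0 < z.im} ∈ nhds (τ : ℂ) :=
      (isOpen_lt continuous_const Complex.continuous_im).mem_nhds τ.im_pos
    filter_upwards [this] with z hz
    simp only [Function.comp]
    rw [ofComplex_apply_of_im_pos hz]
    exact ((hP ⟨z, hz⟩).tsum_eq).symm
  have e : Dg g τ = qq τ * deriv F (qq τ) := by
    unfold Dg
    rw [h4.deriv]
    have := Complex.two_pi_I_ne_zero
    field_simp
  refine ⟨?_, by rw [e]; exact h2⟩
  rw [e]; exact h4.congr_deriv (by ring)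

theorem coe_S_smul (τ : ℍ) : ((ModularGroup.S • τ : ℍ) : ℂ) = -(τ : ℂ)⁻¹ := by
  rw [UpperHalfPlane.modular_S_smul]; simp

theorem Dg_S {g : ℍ → ℂ} {K : ℂ → ℂ} {K' : ℂ} (τ : ℍ)
    (hd : HasDerivAt (g ∘ ofComplex) (2 * Real.pi * Complex.I * Dg g (ModularGroup.S • τ))
      ((ModularGroup.S • τ : ℍ) : ℂ))
    (hK : ∀ τ : ℍ, g (ModularGroup.S • τ) = K τ) (hK' : HasDerivAt K K' τ) :
    Dg g (ModularGroup.S • τ) = (2 * Real.pi * Complex.I)⁻¹ * (τ : ℂ) ^ 2 * K' := by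
  have h0 : (τ : ℂ) ≠ 0 := τ.ne_zero
  have h1 : HasDerivAt (fun z : ℂ => -z⁻¹) ((τ : ℂ) ^ 2)⁻¹ (τ : ℂ) := by
    have := (hasDerivAt_inv h0).neg
    rw [neg_neg] at this
    exact this
  rw [coe_S_smul] at hd
  have h2 := HasDerivAt.comp (τ : ℂ) hd h1
  have h3 : HasDerivAt K (2 * Real.pi * Complex.I * Dg g (ModularGroup.S • τ) *
      ((τ : ℂ) ^ 2)⁻¹) (τ : ℂ) := by
    refine h2.congr_of_eventuallyEq ?_
    have : {z : ℂ | 0 < z.im} ∈ nhds (τ : ℂ) :=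
      (isOpen_lt continuous_const Complex.continuous_im).mem_nhds τ.im_pos
    filter_upwards [this] with z hz
    have hz : 0 < z.im := hz
    have := hK ⟨z, hz⟩
    simp only [Function.comp]
    rw [show K z = K ((⟨z, hz⟩ : ℍ) : ℂ) from rfl, ← this]
    congr 1
    ext
    rw [coe_S_smul]
    have him : 0 < (-z⁻¹).im := by
      have := (ModularGroup.S • (⟨z, hz⟩ : ℍ)).im_pos
      rw [← UpperHalfPlane.coe_im, coe_S_smul] at this
      exact this
    rw [ofComplex_apply_of_im_pos him]
  have e := h3.unique hK'
  rw [← e]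
  have := Complex.two_pi_I_ne_zero
  field_simp

theorem MF.Dg_S {k : ℕ} {g : ℍ → ℂ} {P : PowerSeries ℂ} (h : MF k g P) (τ : ℍ) :
    Dg g (ModularGroup.S • τ) = (τ : ℂ) ^ (k + 2) * Dg g τ +
      (2 * Real.pi * Complex.I)⁻¹ * k * (τ : ℂ) ^ (k + 1) * g τ := by
  have h1 := (qser_deriv h.ev τ).1
  have h2 := (hasDerivAt_pow k (τ : ℂ)).mul h1
  have := EK.Dg_S (g := g) (K := fun z => z ^ k * (g ∘ ofComplex) z) τ
    (qser_deriv h.ev _).1 (fun τ => by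
      rw [h.inv]; simp) h2
  rw [this]
  have := Complex.two_pi_I_ne_zero
  simp only [Function.comp, ofComplex_apply]
  cases k with
  | zero => field_simp; simp; ring
  | succ k => 
    simp only [Nat.add_sub_cancel]
    field_simp; ring

theorem DDg_S {k : ℕ} {g : ℍ → ℂ} {P : PowerSeries ℂ} (h : MF k g P) (τ : ℍ) :
    Dg (Dg g) (ModularGroup.S • τ) = (τ : ℂ) ^ (k + 4) * Dg (Dg g) τ +
      (2 * Real.pi * Complex.I)⁻¹ * (2 * k + 2) * (τ : ℂ) ^ (k + 3) * Dg g τ +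
      ((2 * Real.pi * Complex.I)⁻¹) ^ 2 * (k * (k + 1)) * (τ : ℂ) ^ (k + 2) * g τ := by
  have h1 := (qser_deriv h.ev τ).1
  have hev : ∀ τ, Ev (th ℂ P) (qq τ) (Dg g τ) := fun τ => (qser_deriv h.ev τ).2
  have h1' := (qser_deriv hev τ).1
  have h2 := ((hasDerivAt_pow (k + 2) (τ : ℂ)).mul h1').add
    (((hasDerivAt_pow (k + 1) (τ : ℂ)).const_mul ((2 * Real.pi * Complex.I)⁻¹ * k)).mul h1)
  have := EK.Dg_S (g := Dg g) (K := _) τ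
    (qser_deriv hev _).1 (fun τ => by
      rw [h.Dg_S]; simp) h2
  rw [this]
  have := Complex.two_pi_I_ne_zero
  simp only [Function.comp, ofComplex_apply, Nat.add_sub_cancel]
  rw [show k + 2 - 1 = k + 1 by omega]
  push_cast
  field_simp
  ring

theorem Zc_th (P : PowerSeries ℤ) : th ℂ (Zc P) = Zc (th ℤ P) := (map_th _ P).symm

theorem constCoeff_th {R : Type*} [CommRing R] (P : PowerSeries R) :
    constantCoeff (th R P) = 0 := by
  have := coeff_th P 0
  simpa using this

theorem MF.zero_of_two {k : ℕ} {g : ℍ → ℂ} {P : PowerSeries ℤ} (h : MF k g (Zc P))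
    (n : ℕ) (hk : k / 12 < n) (h0 : X ^ n ∣ P) : P = 0 := by
  have := (h.sturm fun i hi => by
    rw [coeff_map, X_pow_dvd_iff.1 h0 i (by omega)]; simp).1
  exact Zc_injective (by rw [this, map_zero])

theorem exists_PD : ∃ U : PowerSeries ℤ, PD = X * U ∧ constantCoeff U = 1 := by
  obtain ⟨u, hu⟩ := X_dvd_iff.2 (by simpa using coeff_zero_PD : constantCoeff PD = 0)
  refine ⟨u, hu, ?_⟩
  have := coeff_one_PD
  rw [hu, ← zero_add 1, coeff_succ_X_mul] at this; simpa using this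

theorem PD_ne_zero : PD ≠ 0 := fun h => by
  have := coeff_one_PD
  rw [h] at this; simp at this

theorem th_X {R : Type*} [CommRing R] : th R X = X := by
  ext n; rw [coeff_th, coeff_X]; split_ifs with h <;> simp [h]

theorem X_dvd_th {R : Type*} [CommRing R] (P : PowerSeries R) : X ∣ th R P :=
  X_dvd_iff.2 (constCoeff_th P)

theorem X_dvd_sub_one {P : PowerSeries ℤ} (h : coeff 0 P = 1) : X ∣ P - 1 := by
  rw [X_dvd_iff]; simp [← coeff_zero_eq_constantCoeff, h]

theorem ram4_aux : PD * (3 * th ℤ P4) - P4 * th ℤ PD + P6 * PD = 0 := by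
  obtain ⟨U, hU, hU1⟩ := exists_PD
  have hM : MF 18 (fun τ => dl τ * (3 * Dg e4 τ) - e4 τ * Dg dl τ + e6 τ * dl τ)
      (Zc (PD * (3 * th ℤ P4) - P4 * th ℤ PD + P6 * PD)) := by
    refine ⟨fun τ => ?_, fun τ => ?_⟩
    · have a := (qser_deriv MF_e4.ev τ).2
      have b := (qser_deriv MF_dl.ev τ).2
      have := (((MF_dl.ev τ).mul (a.smul 3)).sub ((MF_e4.ev τ).mul b)).add
        ((MF_e6.ev τ).mul (MF_dl.ev τ))
      rw [Zc_th, Zc_th] at this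
      simpa [map_ofNat] using this
    · rw [MF_e4.Dg_S, MF_dl.Dg_S, MF_e4.inv, MF_dl.inv, MF_e6.inv]
      push_cast; ring
  refine hM.zero_of_two 2 (by norm_num) ?_
  obtain ⟨a, ha⟩ := X_dvd_th P4
  obtain ⟨b, hb⟩ := X_dvd_th U
  obtain ⟨c, hc⟩ := X_dvd_sub_one coeff_zero_P4
  obtain ⟨d, hd⟩ := X_dvd_sub_one coeff_zero_P6
  have hP4 : P4 = 1 + X * c := by linear_combination hc
  have hP6 : P6 = 1 + X * d := by linear_combination hd
  rw [ha, hP6, hU, Derivation.leibniz, hb, th_X, hP4]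
  simp only [smul_eq_mul]
  exact ⟨U * a * 3 - U * c + U * d - b - X * c * b, by ring⟩

theorem ram6_aux : PD * (2 * th ℤ P6) - P6 * th ℤ PD + P4 ^ 2 * PD = 0 := by
  obtain ⟨U, hU, hU1⟩ := exists_PD
  have hM : MF 20 (fun τ => dl τ * (2 * Dg e6 τ) - e6 τ * Dg dl τ + e4 τ ^ 2 * dl τ)
      (Zc (PD * (2 * th ℤ P6) - P6 * th ℤ PD + P4 ^ 2 * PD)) := by
    refine ⟨fun τ => ?_, fun τ => ?_⟩
    · have a := (qser_deriv MF_e6.ev τ).2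
      have b := (qser_deriv MF_dl.ev τ).2
      have := (((MF_dl.ev τ).mul (a.smul 2)).sub ((MF_e6.ev τ).mul b)).add
        (((MF_e4.ev τ).pow 2).mul (MF_dl.ev τ))
      rw [Zc_th, Zc_th] at this
      simpa [map_ofNat] using this
    · rw [MF_e6.Dg_S, MF_dl.Dg_S, MF_e4.inv, MF_dl.inv, MF_e6.inv]
      push_cast; ring
  refine hM.zero_of_two 2 (by norm_num) ?_
  obtain ⟨a, ha⟩ := X_dvd_th P6
  obtain ⟨b, hb⟩ := X_dvd_th U
  obtain ⟨c, hc⟩ := X_dvd_sub_one coeff_zero_P4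
  obtain ⟨d, hd⟩ := X_dvd_sub_one coeff_zero_P6
  have hP4 : P4 = 1 + X * c := by linear_combination hc
  have hP6 : P6 = 1 + X * d := by linear_combination hd
  rw [ha, hP6, hU, Derivation.leibniz, hb, th_X, hP4]
  simp only [smul_eq_mul]
  exact ⟨2 * U * a - b - d * U - X * d * b + 2 * c * U + X * c ^ 2 * U, by ring⟩

theorem ram2_aux : PD * (12 * th ℤ (th ℤ PD)) - 13 * th ℤ PD ^ 2 + P4 * PD ^ 2 = 0 := by
  obtain ⟨U, hU, hU1⟩ := exists_PD
  have hM : MF 28 (fun τ => dl τ * (12 * Dg (Dg dl) τ) - 13 * Dg dl τ ^ 2 + e4 τ * dl τ ^ 2)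
      (Zc (PD * (12 * th ℤ (th ℤ PD)) - 13 * th ℤ PD ^ 2 + P4 * PD ^ 2)) := by
    refine ⟨fun τ => ?_, fun τ => ?_⟩
    · have hev : ∀ τ, Ev (th ℂ (Zc PD)) (qq τ) (Dg dl τ) := fun τ => (qser_deriv MF_dl.ev τ).2
      have a := (qser_deriv hev τ).2
      have := (((MF_dl.ev τ).mul (a.smul 12)).sub (((hev τ).pow 2).smul 13)).add
        ((MF_e4.ev τ).mul ((MF_dl.ev τ).pow 2))
      rw [Zc_th, Zc_th] at this
      simpa [map_ofNat] using this
    · rw [DDg_S MF_dl, MF_dl.Dg_S, MF_e4.inv, MF_dl.inv]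
      push_cast; ring
  refine hM.zero_of_two 3 (by norm_num) ?_
  obtain ⟨b, hb⟩ := X_dvd_th U
  obtain ⟨b', hb'⟩ := X_dvd_th (U + X * b)
  obtain ⟨c, hc⟩ := X_dvd_sub_one coeff_zero_P4
  have hP4 : P4 = 1 + X * c := by linear_combination hc
  have h1 : th ℤ PD = X * (U + X * b) := by
    rw [hU, Derivation.leibniz, hb, th_X]; simp only [smul_eq_mul]; ring
  have h2 : th ℤ (th ℤ PD) = X * (U + X * b + X * b') := by
    rw [h1, Derivation.leibniz, hb', th_X]; simp only [smul_eq_mul]; ring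
  rw [h2, h1, hU, hP4]
  exact ⟨12 * U * b + 12 * U * b' - 26 * U * b - 13 * X * b ^ 2 + c * U ^ 2, by ring⟩

theorem exists_P2 : ∃ P2 : PowerSeries ℤ, th ℤ PD = P2 * PD ∧ 3 * th ℤ P4 = P2 * P4 - P6 ∧
    2 * th ℤ P6 = P2 * P6 - P4 ^ 2 ∧ 12 * th ℤ P2 = P2 ^ 2 - P4 := by
  obtain ⟨U, hU, hU1⟩ := exists_PD
  have hu : IsUnit U := by
    rw [PowerSeries.isUnit_iff_constantCoeff, hU1]; exact isUnit_one
  obtain ⟨V, hV⟩ := hu.exists_right_inv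
  have h0 : th ℤ PD = ((U + th ℤ U) * V) * PD := by
    rw [hU, Derivation.leibniz, th_X]; simp only [smul_eq_mul]
    linear_combination (-U * X - X * th ℤ U) * hV
  refine ⟨(U + th ℤ U) * V, h0, ?_, ?_, ?_⟩
  · generalize (U + th ℤ U) * V = P2 at h0
    have := ram4_aux
    rw [h0] at this
    exact mul_left_cancel₀ PD_ne_zero (by linear_combination this)
  · generalize (U + th ℤ U) * V = P2 at h0
    have := ram6_aux
    rw [h0] at this
    exact mul_left_cancel₀ PD_ne_zero (by linear_combination this)
  · generalize (U + th ℤ U) * V = P2 at h0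
    have := ram2_aux
    rw [h0, Derivation.leibniz, h0] at this
    simp only [smul_eq_mul] at this
    exact mul_left_cancel₀ (pow_ne_zero 2 PD_ne_zero) (by linear_combination this)

end EK

end

section
namespace EK
section hasse
open Polynomial Differential

/-- the Hasse polynomial of index `n`. -/
noncomputable def hp {R : Type*} [CommRing R] (n : ℕ) (a b : R) : R :=
  ((X ^ 3 + C a * X + C b : R[X]) ^ n).coeff (2 * n)

theorem hp_map {R S : Type*} [CommRing R] [CommRing S] (f : R →+* S) (n : ℕ) (a b : R) :
    f (hp n a b) = hp n (f a) (f b) := by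
  unfold hp
  rw [← coeff_map]; simp

theorem hp_ode {R : Type*} [CommRing R] [Differential R] (n : ℕ) (hn0 : n ≠ 0)
    (hn : 2 * (n : R) + 1 = 0) (c4 c6 P2 : R) (h4 : 3 * c4′ = P2 * c4 - c6)
    (h6 : 2 * c6′ = P2 * c6 - c4 ^ 2) (h2 : 12 * P2′ = P2 ^ 2 - c4) :
    (36 * 108) * (hp n (-27 * c4) (-54 * c6))′′ = 0 := by
  set F : R[X] := X ^ 3 + C (-27 * c4) * X + C (-54 * c6) with hF
  set h := hp n (-27 * c4) (-54 * c6) with hh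
  set h1 := (X * F ^ n).coeff (2 * n) with hh1
  have key : ∀ A : R[X], (derivative A).coeff (2 * n) = 0 := fun A => by
    rw [coeff_derivative]; push_cast; rw [hn]; simp
  obtain ⟨m, rfl⟩ := Nat.exists_eq_succ_of_ne_zero hn0
  have h4' : C (3 : R) * C c4′ = C P2 * C c4 - C c6 := by
    rw [← C_mul, h4]; simp
  have h6' : C (2 : R) * C c6′ = C P2 * C c6 - C c4 ^ 2 := by
    rw [← C_mul, h6]; simp
  have hn' : 2 * C (((m + 1 : ℕ)) : R) + 1 = 0 := by
    rw [← C_1, show (2 : R[X]) = C 2 from (C_ofNat 2).symm, ← C_mul, ← C_add, hn, C_0]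
  set N : R[X] := C (((m + 1 : ℕ)) : R) with hN
  have hNat : (((m + 1 : ℕ)) : R[X]) = N := by simp [hN]
  have dF : mapCoeffs F = C (-27 : R) * C c4′ * X + C (-54 : R) * C c6′ := by
    rw [hF]
    simp only [map_add, Derivation.leibniz, Derivation.leibniz_pow, mapCoeffs_X, mapCoeffs_C]
    simp
    have a1 : (27 : R)′ = 0 := by exact_mod_cast Derivation.map_natCast Differential.deriv 27
    have a2 : (54 : R)′ = 0 := by exact_mod_cast Derivation.map_natCast Differential.deriv 54
    simp [a1, a2]; ring
  have dF' : mapCoeffs F = C (-9 : R) * (C P2 * C c4 - C c6) * X +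
      C (-27 : R) * (C P2 * C c6 - C c4 ^ 2) := by
    rw [dF, ← h4', ← h6']
    simp only [map_neg, map_ofNat]
    ring
  have dFn : mapCoeffs (F ^ (m + 1)) = N * F ^ m * mapCoeffs F := by
    rw [Derivation.leibniz_pow]
    simp only [Nat.add_sub_cancel, nsmul_eq_mul, smul_eq_mul, hNat]; ring
  have FF : F = X ^ 3 - C (27 : R) * C c4 * X - C (54 : R) * C c6 := by
    rw [hF]; simp; ring
  have F' : derivative F = 3 * X ^ 2 - C (27 : R) * C c4 := by
    rw [hF]; simp
    rw [show (C (2 : R) : R[X]) = 2 from C_ofNat 2]; ring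
  have F'n : derivative (F ^ (m + 1)) = N * F ^ m * derivative F := by
    rw [derivative_pow]; simp only [Nat.add_sub_cancel, hN]
  have I1 : 36 * mapCoeffs (F ^ (m + 1)) + X * F ^ (m + 1) + 3 * C P2 * F ^ (m + 1) =
      derivative ((2 * X ^ 2 - 36 * C c4 - 6 * C P2 * X) * F ^ (m + 1)) := by
    rw [derivative_mul, dFn, F'n, dF', F']
    simp only [derivative_sub, derivative_mul, derivative_X_pow, derivative_C, derivative_X,
      derivative_ofNat, map_neg, map_ofNat]
    have e1 : F ^ (m + 1) = F ^ m * F := pow_succ _ _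
    rw [e1]
    generalize F ^ m = G
    rw [FF]
    simp only [map_ofNat]
    push_cast
    simp only [map_ofNat]
    linear_combination (G * (-3 * X ^ 4 + 81 * C c4 * X ^ 2 + 162 * C c6 * X + 9 * C P2 * X ^ 3 -
      243 * C P2 * C c4 * X - 486 * C P2 * C c6)) * hn'
  have I2 : 108 * (X * mapCoeffs (F ^ (m + 1))) - 27 * C c4 * F ^ (m + 1) -
      9 * C P2 * (X * F ^ (m + 1)) =
      derivative ((54 * C c4 * X + 324 * C c6 - 18 * C P2 * X ^ 2) * F ^ (m + 1)) := by
    rw [derivative_mul, dFn, F'n, dF', F']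
    simp only [derivative_sub, derivative_add, derivative_mul, derivative_X_pow, derivative_C,
      derivative_X, derivative_ofNat, map_neg, map_ofNat]
    have e1 : F ^ (m + 1) = F ^ m * F := pow_succ _ _
    rw [e1]
    generalize F ^ m = G
    rw [FF]
    simp only [map_ofNat]
    push_cast
    simp only [map_ofNat]
    linear_combination (G * (-1458 * C P2 * C c6 * X + 2187 * C c4 ^ 2 * X -
      729 * C P2 * C c4 * X ^ 2 - 81 * C c4 * X ^ 3 + 27 * C P2 * X ^ 4 +
      4374 * C c4 * C c6)) * hn'
  have ofN : ∀ (k : ℕ) [k.AtLeastTwo], (OfNat.ofNat k : R[X]) = C (OfNat.ofNat k) := fun k _ =>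
    (C_ofNat k).symm
  have J1 : 36 * h′ + h1 + 3 * P2 * h = 0 := by
    have := congrArg (fun q => coeff q (2 * (m + 1))) I1
    simp only [key, ofN, ← C_mul, coeff_add, mul_assoc, coeff_C_mul, coeff_mapCoeffs] at this
    rw [hh, hh1]; unfold hp
    linear_combination this
  have J2 : 108 * h1′ - 27 * c4 * h - 9 * P2 * h1 = 0 := by
    have := congrArg (fun q => coeff q (2 * (m + 1))) I2
    have e : X * mapCoeffs (F ^ (m + 1)) = mapCoeffs (X * F ^ (m + 1)) := by
      rw [Derivation.leibniz, mapCoeffs_X]; simp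
    rw [e] at this
    simp only [key, ofN, ← C_mul, coeff_add, coeff_sub, mul_assoc, coeff_C_mul,
      coeff_mapCoeffs] at this
    rw [hh, hh1]; unfold hp
    linear_combination this
  have J3 : 36 * h′′ = - h1′ - 3 * (P2′ * h + P2 * h′) := by
    have e : 36 * h′ = - h1 - 3 * (P2 * h) := by linear_combination J1
    have := congrArg Differential.deriv e
    have a1 : (36 : R)′ = 0 := by exact_mod_cast Derivation.map_natCast Differential.deriv 36
    have a3 : (3 : R)′ = 0 := by exact_mod_cast Derivation.map_natCast Differential.deriv 3
    simp only [Derivation.leibniz, map_sub, map_neg, a1, a3, smul_eq_mul] at this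
    linear_combination this
  linear_combination 108 * J3 - J2 - 27 * h * h2 - 9 * P2 * J1
end hasse
end EK

end

section
namespace EK
open PowerSeries UpperHalfPlane ModularForm MatrixGroups

theorem hp_isob (n : ℕ) : ∃ (S : Finset ℕ) (z : ℕ → ℤ) (i j : ℕ → ℕ),
    (∀ s ∈ S, 2 * i s + 3 * j s = n) ∧ ∀ (R : Type) [CommRing R] (c4 c6 : R),
      hp n (-27 * c4) (-54 * c6) = ∑ s ∈ S, (z s : R) * (c4 ^ i s * c6 ^ j s) := by
  refine ⟨(Finset.range (n + 1)).filter (fun m => 3 * m ≤ 2 * n ∧ n ≤ 2 * m),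
    fun m => n.choose m * (n - m).choose (2 * n - 3 * m) * (-27) ^ (2 * n - 3 * m) *
      (-54) ^ (2 * m - n), fun m => 2 * n - 3 * m, fun m => 2 * m - n, ?_, ?_⟩
  · intro s hs
    simp only [Finset.mem_filter, Finset.mem_range] at hs
    show 2 * (2 * n - 3 * s) + 3 * (2 * s - n) = n
    omega
  · intro R _ c4 c6
    unfold hp
    rw [add_assoc, add_pow, Polynomial.finset_sum_coeff, Finset.sum_filter]
    refine Finset.sum_congr rfl fun m hm => ?_
    have hm : m ≤ n := Nat.lt_succ_iff.1 (Finset.mem_range.1 hm)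
    rw [← pow_mul, mul_assoc, Polynomial.coeff_X_pow_mul', ← Polynomial.C_eq_natCast,
      Polynomial.coeff_mul_C]
    have e : (Polynomial.C (-27 * c4) * Polynomial.X + Polynomial.C (-54 * c6)) ^ (n - m) =
      ∑ k ∈ Finset.range (n - m + 1), Polynomial.C (((-27 * c4) ^ k * (-54 * c6) ^ (n - m - k)) *
        ((n - m).choose k : R)) * Polynomial.X ^ k := by
      rw [add_pow]
      refine Finset.sum_congr rfl fun k _ => ?_
      simp only [mul_pow, map_mul, map_pow, map_natCast]
      ring
    rw [e, Polynomial.finset_sum_coeff]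
    simp only [Polynomial.coeff_C_mul, Polynomial.coeff_X_pow]
    by_cases h1 : 3 * m ≤ 2 * n
    · rw [if_pos h1]
      by_cases h2 : n ≤ 2 * m
      · rw [if_pos ⟨h1, h2⟩, Finset.sum_eq_single (2 * n - 3 * m)]
        · rw [if_pos rfl, show n - m - (2 * n - 3 * m) = 2 * m - n by omega, mul_pow, mul_pow]
          push_cast; ring
        · intro b _ hb; rw [if_neg (Ne.symm hb), mul_zero]
        · intro hb; exact absurd (Finset.mem_range.2 (by omega)) hb
      · rw [if_neg (fun h => h2 h.2), Finset.sum_eq_zero, zero_mul]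
        intro k hk
        have := Finset.mem_range.1 hk
        rw [if_neg (by omega), mul_zero]
    · rw [if_neg h1, if_neg (fun h => h1 h.1)]

noncomputable def HP (n : ℕ) : PowerSeries ℤ := hp n (-27 * P4) (-54 * P6)
noncomputable def hf (n : ℕ) (τ : ℍ) : ℂ := hp n (-27 * e4 τ) (-54 * e6 τ)

theorem MF_hf (n : ℕ) : MF (2 * n) (hf n) (Zc (HP n)) := by
  obtain ⟨S, z, i, j, hij, h⟩ := hp_isob n
  have e1 : Zc (HP n) = ∑ s ∈ S, C (z s : ℂ) * (Zc P4 ^ i s * Zc P6 ^ j s) := by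
    unfold HP; rw [h, map_sum]
    refine Finset.sum_congr rfl fun s _ => ?_
    simp
  refine ⟨fun τ => ?_, fun τ => ?_⟩
  · unfold hf; rw [h, e1]
    exact Ev.sum _ fun s _ => ((((MF_e4.ev τ).pow _).mul ((MF_e6.ev τ).pow _)).smul _)
  · unfold hf; rw [h, h, Finset.mul_sum]
    refine Finset.sum_congr rfl fun s hs => ?_
    rw [MF_e4.inv, MF_e6.inv, ← hij s hs]; ring

theorem exists_abc (n : ℕ) : ∃ α β γ : ℕ, 2 * n + 4 * α + 6 * β = 12 * γ ∧ α ≤ 2 ∧ β ≤ 1 := by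
  have : n % 6 < 6 := Nat.mod_lt _ (by norm_num)
  obtain ⟨q, r, hr, rfl⟩ : ∃ q r, r < 6 ∧ n = 6 * q + r := ⟨n / 6, n % 6, this, by omega⟩
  interval_cases r
  · exact ⟨0, 0, q, by omega, by omega, by omega⟩
  · exact ⟨1, 1, q + 1, by omega, by omega, by omega⟩
  · exact ⟨2, 0, q + 1, by omega, by omega, by omega⟩
  · exact ⟨0, 1, q + 1, by omega, by omega, by omega⟩
  · exact ⟨1, 0, q + 1, by omega, by omega, by omega⟩
  · exact ⟨2, 1, q + 2, by omega, by omega, by omega⟩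

theorem exists_QF (n α β γ : ℕ) (hab : 2 * n + 4 * α + 6 * β = 12 * γ) :
    ∃ Q : Polynomial ℤ, Q.natDegree ≤ γ ∧ ∀ (R : Type) [CommRing R] [IsDomain R] (c4 c6 Δ : R),
      Δ ≠ 0 → 1728 * Δ = c4 ^ 3 - c6 ^ 2 →
      hp n (-27 * c4) (-54 * c6) * (c4 ^ α * c6 ^ β) = hom γ Q (c4 ^ 3) Δ := by
  obtain ⟨S, z, i, j, hij, h⟩ := hp_isob n
  have huv : ∀ s ∈ S, ∃ u v, i s + α = 3 * u ∧ j s + β = 2 * v ∧ u + v = γ := fun s hs => by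
    have := hij s hs
    exact ⟨(i s + α) / 3, (j s + β) / 2, by omega, by omega, by omega⟩
  choose! u v hu hv huv using huv
  obtain ⟨Q, hdeg, hQ⟩ : ∃ Q : Polynomial ℤ, Q.natDegree ≤ γ ∧ ∀ (K : Type) [Field K] [Algebra ℤ K] (x : K),
      Polynomial.aeval x Q = ∑ s ∈ S, (z s : K) * (x ^ u s * (x - 1728) ^ v s) := by
    refine ⟨∑ s ∈ S, Polynomial.C (z s) * (Polynomial.X ^ u s *
      (Polynomial.X - Polynomial.C 1728) ^ v s), ?_, fun K _ _ x => by
        simp only [map_sum, map_mul, map_pow, map_sub, Polynomial.aeval_C, Polynomial.aeval_X]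
        simp only [eq_intCast, Int.cast_ofNat]⟩
    refine Polynomial.natDegree_sum_le_of_forall_le _ _ fun s hs => ?_
    refine (Polynomial.natDegree_C_mul_le _ _).trans (Polynomial.natDegree_mul_le.trans ?_)
    rw [← huv s hs]
    refine add_le_add (Polynomial.natDegree_X_pow_le _) ?_
    refine Polynomial.natDegree_pow_le.trans ?_
    have := Polynomial.natDegree_X_sub_C_le (1728 : ℤ)
    nlinarith
  refine ⟨Q, hdeg, ?_⟩
  · intro R _ _ c4 c6 Δ hΔ hD
    let K := FractionRing R
    have hinj : Function.Injective (algebraMap R K) := IsFractionRing.injective R K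
    apply hinj
    rw [map_hom (algebraMap R K) (fun a => by simp)]
    have hΔ' : algebraMap R K Δ ≠ 0 := fun hh => hΔ (hinj (by rw [hh, map_zero]))
    have hD' := congrArg (algebraMap R K) hD
    rw [h]
    simp only [map_mul, map_sum, map_sub, map_pow, map_intCast, map_ofNat] at hD' ⊢
    generalize algebraMap R K Δ = D at *
    generalize algebraMap R K c4 = x at *
    generalize algebraMap R K c6 = y at *
    rw [hom_field _ _ hdeg _ _ hΔ', hQ, Finset.mul_sum, Finset.sum_mul]
    refine Finset.sum_congr rfl fun s hs => ?_
    have e1 : x ^ i s * x ^ α = (x ^ 3) ^ u s := by rw [← pow_add, hu s hs, pow_mul]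
    have e2 : y ^ j s * y ^ β = (y ^ 2) ^ v s := by rw [← pow_add, hv s hs, pow_mul]
    have e3 : y ^ 2 = D * (x ^ 3 / D - 1728) := by
      rw [mul_sub, mul_div_cancel₀ _ hΔ']; linear_combination hD'
    have e4 : x ^ 3 = D * (x ^ 3 / D) := by rw [mul_div_cancel₀ _ hΔ']
    calc (z s : K) * (x ^ i s * y ^ j s) * (x ^ α * y ^ β)
        = (z s : K) * ((x ^ i s * x ^ α) * (y ^ j s * y ^ β)) := by ring
      _ = _ := by
        rw [e1, e2, e3, mul_pow]
        nth_rw 1 [e4]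
        rw [mul_pow, ← huv s hs, pow_add]
        ring

end EK

end

section
namespace EK
open PowerSeries UpperHalfPlane ModularForm MatrixGroups

theorem hom_eq_zero' {k : Type*} [CommRing k] (m : ℕ) (Q : Polynomial k) (hQ : Q.natDegree ≤ m)
    (x y : PowerSeries k) (hx : coeff 0 x = 1)
    (hy : coeff 0 y = 0) (hy1 : coeff 1 y = 1) (h : ∀ j ≤ m, coeff j (hom m Q x y) = 0) :
    Q = 0 := by
  by_contra h0
  have h1 := h (m - Q.natDegree) (Nat.sub_le _ _)
  unfold hom at h1
  rw [map_sum, Finset.sum_eq_single Q.natDegree] at h1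
  · have e : algebraMap k (PowerSeries k) (Q.coeff Q.natDegree) = C (Q.coeff Q.natDegree) := rfl
    rw [e, coeff_C_mul, coeff_mul_pow_self _ _ hx hy hy1, mul_one] at h1
    exact h0 (Polynomial.leadingCoeff_eq_zero.1 h1)
  · intro i hi hne
    have e : algebraMap k (PowerSeries k) (Q.coeff i) = C (Q.coeff i) := rfl
    rw [e, coeff_C_mul]
    rcases lt_or_gt_of_ne hne with hlt | hgt
    · rw [coeff_mul_pow_of_lt _ _ hy (by omega), mul_zero]
    · rw [Polynomial.coeff_eq_zero_of_natDegree_lt hgt, zero_mul]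
  · intro hh; exact absurd (Finset.mem_range.2 (by omega)) hh

theorem dvd_den_bernoulli (n p : ℕ) [hp : Fact p.Prime] (hpn : p = 2 * n + 1) :
    p ∣ (bernoulli (2 * n)).den := by
  by_contra h
  obtain ⟨z, hz⟩ := Bernoulli.vonStaudt_clausen n
  set S := (Finset.range (2 * n + 2)).filter (fun p => p.Prime ∧ (p - 1) ∣ 2 * n) with hS
  have hpS : p ∈ S := by
    rw [hS, Finset.mem_filter, Finset.mem_range]
    exact ⟨by omega, hp.1, by rw [hpn]; simp⟩
  rw [← Finset.add_sum_erase _ _ hpS] at hz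
  have h1 : ‖((bernoulli (2 * n) : ℚ) : ℚ_[p])‖ ≤ 1 := Padic.norm_rat_le_one h
  have h2 : ∀ q ∈ S.erase p, ((1 / q : ℚ) : ℚ_[p]) ∈ PadicInt.subring p := by
    intro q hq
    rw [Finset.mem_erase, hS, Finset.mem_filter] at hq
    refine Padic.norm_rat_le_one ?_
    rw [one_div, Rat.inv_natCast_den_of_pos hq.2.2.1.pos, Nat.prime_dvd_prime_iff_eq hp.1 hq.2.2.1]
    exact fun hh => hq.1 hh.symm
  have h3 := Subring.sum_mem _ h2
  have h4 : ((1 / p : ℚ) : ℚ_[p]) ∈ PadicInt.subring p := by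
    have e : (1 / p : ℚ) = z - bernoulli (2 * n) - ∑ q ∈ S.erase p, (1 / q : ℚ) := by rw [hz]; ring
    rw [e]; push_cast
    push_cast at h3
    refine Subring.sub_mem _ (Subring.sub_mem _ ?_ h1) h3
    exact Padic.norm_int_le_one z
  have h5 : ‖((1 / p : ℚ) : ℚ_[p])‖ ≤ 1 := h4
  push_cast at h5
  rw [norm_div, norm_one, Padic.norm_p, one_div, inv_inv] at h5
  have := hp.1.one_lt
  have : (1 : ℝ) < p := by exact_mod_cast this
  linarith

theorem exists_PE (n p : ℕ) [hp : Fact p.Prime] (hpn : p = 2 * n + 1) (hp3 : 3 < p) :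
    ∃ (N : ℤ) (PE : PowerSeries ℤ) (g : ℍ → ℂ), (N : ZMod p) ≠ 0 ∧ MF (2 * n) g (Zc PE) ∧
      PowerSeries.map (Int.castRingHom (ZMod p)) PE = C (N : ZMod p) := by
  have h2 : 3 ≤ 2 * n := by omega
  have hd := dvd_den_bernoulli n p hpn
  set B := bernoulli (2 * n) with hB
  refine ⟨B.num, mk fun i => if i = 0 then B.num else
    -(2 * (2 * n) * B.den * ArithmeticFunction.sigma (2 * n - 1) i : ℤ),
    fun τ => (B.num : ℂ) * ModularForm.E h2 τ, ?_, ?_, ?_⟩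
  · rw [Ne, ZMod.intCast_zmod_eq_zero_iff_dvd]
    intro h
    have h' : p ∣ B.num.natAbs := Int.natCast_dvd.1 h
    have := Nat.dvd_gcd h' hd
    rw [B.reduced.gcd_eq_one] at this
    exact hp.1.one_lt.ne' (Nat.dvd_one.1 this)
  · have h := (MF.of_form (k := 2 * n) (ModularForm.E h2)).smul (B.num : ℂ)
    have hnum : (B.num : ℂ) ≠ 0 := by
      have : B.num ≠ 0 := by
        intro h0
        have h1 := Rat.zero_iff_num_zero.2 h0
        rw [h1] at hd
        exact hp.1.one_lt.ne' (Nat.dvd_one.1 hd)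
      exact_mod_cast this
    have e : C (B.num : ℂ) * qExpansion 1 (ModularForm.E h2) = Zc (mk fun i => if i = 0 then B.num else
    -(2 * (2 * n) * B.den * ArithmeticFunction.sigma (2 * n - 1) i : ℤ)) := by
      ext i
      rw [coeff_C_mul, EisensteinSeries.E_qExpansion_coeff h2 (by simp), coeff_map, coeff_mk]
      split_ifs with hi
      · simp
      · have hb : ((bernoulli (2 * n) : ℚ) : ℂ) = B.num / B.den := by
          rw [← hB]; exact Rat.cast_def B
        have hden : (B.den : ℂ) ≠ 0 := by exact_mod_cast B.den_nz
        rw [hb]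
        push_cast
        simp
        field_simp
    rw [e] at h
    exact h
  · ext i
    rw [coeff_map, coeff_mk, coeff_C]
    split_ifs with hi
    · simp
    · have : (B.den : ZMod p) = 0 := (ZMod.natCast_eq_zero_iff _ _).2 hd
      simp [this]

noncomputable def mkDiff {R : Type*} [CommRing R] (D : R →+ R)
    (h : ∀ a b, D (a * b) = a * D b + b * D a) : Differential R :=
  ⟨Derivation.mk' D.toIntLinearMap h⟩

theorem hp_vanish (n p : ℕ) [hp : Fact p.Prime] (hpn : p = 2 * n + 1) (hp3 : 3 < p) (i : ℕ)
    (hi0 : i ≠ 0) (hi : i < p) : coeff i (PowerSeries.map (Int.castRingHom (ZMod p)) (HP n)) = 0 := by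
  obtain ⟨P2, -, h4, h6, h2⟩ := exists_P2
  set f := PowerSeries.map (Int.castRingHom (ZMod p)) with hf
  letI : Differential (PowerSeries (ZMod p)) := mkDiff (th (ZMod p)).toLinearMap.toAddMonoidHom
    fun a b => (th (ZMod p)).leibniz a b
  have hd : ∀ P : PowerSeries ℤ, Differential.deriv (f P) = f (th ℤ P) := fun P => by
    rw [hf, map_th]; rfl
  have hd' : ∀ P : PowerSeries (ZMod p), Differential.deriv P = th (ZMod p) P := fun P => rfl
  have hode := hp_ode (R := PowerSeries (ZMod p)) n (by omega) (by
    have : ((2 * n + 1 : ℕ) : PowerSeries (ZMod p)) = 0 := by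
      rw [← hpn, ← map_natCast (C : ZMod p →+* _)]; simp
    exact_mod_cast this) (f P4) (f P6) (f P2)
    (by rw [hd]; have := congrArg f h4; simpa [show f 3 = 3 from map_ofNat f 3] using this)
    (by rw [hd]; have := congrArg f h6; simpa [show f 2 = 2 from map_ofNat f 2] using this)
    (by rw [hd]; have := congrArg f h2; simpa [show f 12 = 12 from map_ofNat f 12] using this)
  have e : EK.hp n (-27 * f P4) (-54 * f P6) = f (HP n) := by
    unfold HP; rw [hp_map]
    simp [show f 27 = 27 from map_ofNat f 27, show f 54 = 54 from map_ofNat f 54]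
  rw [e, hd', hd'] at hode
  have h := congrArg (coeff i) hode
  have e2 : (36 * 108 : PowerSeries (ZMod p)) = C (36 * 108 : ZMod p) := by
    rw [map_mul]; exact congrArg₂ _ (map_ofNat C 36).symm (map_ofNat C 108).symm
  rw [e2, coeff_C_mul, coeff_th, coeff_th, map_zero] at h
  have hne : ∀ k : ℕ, k ∣ 6 ^ 10 → (k : ZMod p) ≠ 0 := by
    intro k hk h0
    have h1 : p ∣ 6 ^ 10 := ((ZMod.natCast_eq_zero_iff _ _).1 h0).trans hk
    have h2 := Nat.le_of_dvd (by norm_num) (hp.1.dvd_of_dvd_pow h1)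
    have h3 : p ∣ 6 := hp.1.dvd_of_dvd_pow h1
    interval_cases p <;> omega
  have h36 := hne (36 * 108) (by norm_num)
  push_cast at h36
  have hi' : (i : ZMod p) ≠ 0 := by
    rw [Ne, ZMod.natCast_eq_zero_iff]
    exact fun hh => absurd (Nat.le_of_dvd (by omega) hh) (by omega)
  rcases mul_eq_zero.1 h with h | h
  · exact absurd (by rw [← h]; norm_num) h36
  · exact ((mul_eq_zero.1 h).resolve_left hi' |> mul_eq_zero.1).resolve_left hi'

theorem hp_const (n p : ℕ) [hp : Fact p.Prime] (hpn : p = 2 * n + 1) (hp3 : 3 < p) :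
    PowerSeries.map (Int.castRingHom (ZMod p)) (HP n) =
      C ((coeff 0 (HP n) : ℤ) : ZMod p) := by
  obtain ⟨N, PE, g, hN, hg, hPE⟩ := exists_PE n p hpn hp3
  obtain ⟨α, β, γ, habc, hα, hβ⟩ := exists_abc n
  set c := coeff 0 (HP n) with hc
  set f := PowerSeries.map (Int.castRingHom (ZMod p)) with hf
  have hM := (((MF_hf n).smul (N : ℂ)).sub (hg.smul (c : ℂ))).mul ((MF_e4.pow α).mul (MF_e6.pow β))
  set P := C N * HP n - C c * PE with hP
  have eP : Zc (P * (P4 ^ α * P6 ^ β)) = (C (N : ℂ) * Zc (HP n) - C (c : ℂ) * Zc PE) *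
      (Zc P4 ^ α * Zc P6 ^ β) := by simp [hP]
  rw [← eP, show 2 * n + (4 * α + 6 * β) = 12 * γ by omega] at hM
  obtain ⟨Q, hQ, hPQ, -, -⟩ := liou γ 0 (by omega) _ _ hM (by simp)
  have hfP : ∀ i < p, coeff i (f P) = 0 := by
    intro i hi
    have : f P = C (N : ZMod p) * f (HP n) - C (c : ZMod p) * f PE := by simp [hP, hf]
    rw [this, hPE, ← map_mul, map_sub, coeff_C_mul, coeff_C]
    by_cases h0 : i = 0
    · rw [if_pos h0, h0, hf, coeff_map, ← hc]; simp; ring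
    · rw [if_neg h0, hf, hp_vanish n p hpn hp3 i h0 hi]; simp
  have hQ0 : Q.map (Int.castRingHom (ZMod p)) = 0 := by
    refine hom_eq_zero' γ _ ?_ (f (P4 ^ 3)) (f PD) ?_ ?_ ?_ ?_
    · refine Polynomial.natDegree_map_le.trans ?_
      rw [Polynomial.natDegree_le_iff_coeff_eq_zero]
      exact fun k hk => hQ k (by omega)
    · rw [hf, coeff_map]
      have := coeff_zero_P4
      simp at this
      simp [this]
    · rw [hf, coeff_map, coeff_zero_PD]; simp
    · rw [hf, coeff_map, coeff_one_PD]; simp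
    · intro j hj
      rw [hom_mapPoly (Int.castRingHom (ZMod p)) (fun a => by simp), ← map_hom f (fun a => by simp),
        ← hPQ, map_mul, coeff_mul]
      refine Finset.sum_eq_zero fun x hx => ?_
      have := Finset.HasAntidiagonal.mem_antidiagonal.1 hx
      rw [hfP _ (by omega), zero_mul]
  have h0 : f (P * (P4 ^ α * P6 ^ β)) = 0 := by
    rw [hPQ, map_hom f (fun a => by simp), ← hom_mapPoly (k' := ZMod p) (Int.castRingHom (ZMod p)) (fun a => by simp),
      hQ0]
    simp [hom]
  rw [map_mul] at h0
  have hu : f (P4 ^ α * P6 ^ β) ≠ 0 := by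
    intro hh
    have := congrArg constantCoeff hh
    have c4 : constantCoeff (f P4) = 1 := by
      rw [hf, ← coeff_zero_eq_constantCoeff_apply, coeff_map, coeff_zero_P4]; simp
    have c6 : constantCoeff (f P6) = 1 := by
      rw [hf, ← coeff_zero_eq_constantCoeff_apply, coeff_map, coeff_zero_P6]; simp
    rw [map_mul, map_pow, map_pow, map_mul, map_pow, map_pow, c4, c6] at this
    simp at this
  have h1 := (mul_eq_zero.1 h0).resolve_right hu
  have h2 : f P = C (N : ZMod p) * (f (HP n) - C (c : ZMod p)) := by
    simp only [hP, map_sub, map_mul, hPE]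
    simp [hf]; ring
  rw [h2] at h1
  refine sub_eq_zero.1 ((mul_eq_zero.1 h1).resolve_left fun h => hN ?_)
  simpa using congrArg constantCoeff h

end EK

end

section
namespace EK
open PowerSeries UpperHalfPlane ModularForm MatrixGroups Filter Topology

theorem tendsto_of_qser {P : PowerSeries ℂ} {g : ℍ → ℂ} (hP : ∀ τ, Ev P (qq τ) (g τ)) :
    Tendsto g atImInfty (𝓝 (coeff 0 P)) := by
  have hF := Ev.hasFPowerSeries (P := P) (r := 1) one_pos (fun z hz => by
    exact summable_of_qser hP z (by simpa using hz))
  have hc := hF.hasFPowerSeriesAt.analyticAt.continuousAt.tendsto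
  have h2 := hc.comp (qParam_tendsto_atImInfty (h := 1) one_pos)
  have e0 : (∑' n, coeff n P * (0 : ℂ) ^ n) = coeff 0 P := by
    rw [tsum_eq_single 0]
    · simp
    · intro b hb; simp [hb]
  rw [e0] at h2
  refine h2.congr fun τ => ?_
  exact (hP τ).tsum_eq

theorem slash_of_S {g : ℍ → ℂ} (hS : ∀ τ : ℍ, g (ModularGroup.S • τ) = g τ)
    (hT : ∀ τ : ℍ, g (ModularGroup.T • τ) = g τ)
    (hd : DifferentiableOn ℂ (g ∘ ofComplex) {z | 0 < z.im})
    (hb : IsBoundedAtImInfty g) : ∃ c, g = Function.const _ c := by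
  have hS' : g ∣[(0 : ℤ)] ModularGroup.S = g := by
    ext τ; rw [SL_slash_apply, hS]; simp
  have hT' : g ∣[(0 : ℤ)] ModularGroup.T = g := by
    ext τ; rw [SL_slash_apply, hT]; simp
  have hγ := SlashInvariantForm.slash_action_generators_SL2Z hS' hT'
  let f : ModularForm 𝒮ℒ 0 :=
    { toFun := g
      slash_action_eq' := by
        rintro A ⟨A, rfl⟩
        exact hγ A
      holo' := by
        rw [UpperHalfPlane.mdifferentiable_iff]
        exact hd
      bdd_at_cusps' := by
        intro c hc
        rw [Subgroup.IsArithmetic.isCusp_iff_isCusp_SL2Z] at hc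
        rw [OnePoint.isBoundedAt_iff_forall_SL2Z hc]
        intro γ _
        rw [hγ γ]; exact hb }
  exact ModularFormClass.levelOne_weight_zero_const f

theorem MF.T {k : ℕ} {g : ℍ → ℂ} {P : PowerSeries ℂ} (h : MF k g P) (τ : ℍ) :
    g (ModularGroup.T • τ) = g τ := by
  have := h.ev (ModularGroup.T • τ)
  rw [qq_T] at this
  exact this.unique (h.ev τ)

theorem jj_surj (j1 : ℂ) : ∃ τ, jj τ = j1 := by
  by_contra hcon
  push Not at hcon
  have hM := (MF_e4.pow 3).sub (MF_dl.smul j1)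
  set f : ℍ → ℂ := e4 ^ 3 - fun τ => j1 * dl τ with hf
  have hf0 : ∀ τ, f τ ≠ 0 := fun τ h => hcon τ (by
    have h1 : e4 τ ^ 3 - j1 * dl τ = 0 := h
    unfold jj
    rw [div_eq_iff (dl_ne_zero τ)]; linear_combination h1)
  have hlim : Tendsto (fun τ => dl τ / f τ) atImInfty (𝓝 0) := by
    have h1 := tendsto_of_qser MF_dl.ev
    have h2 := tendsto_of_qser hM.ev
    have e1 : coeff 0 (Zc PD) = 0 := by rw [coeff_map, coeff_zero_PD]; simp
    have e2 : coeff 0 (Zc P4 ^ 3 - C j1 * Zc PD) = 1 := by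
      have e4 : constantCoeff (Zc P4) = 1 := by
        rw [← coeff_zero_eq_constantCoeff_apply, coeff_map, coeff_zero_P4]; simp
      rw [map_sub, coeff_C_mul, e1]; simp only [coeff_zero_eq_constantCoeff, map_pow, e4]; simp
    rw [e1] at h1; rw [e2] at h2
    have h3 := h1.div h2 one_ne_zero
    rw [zero_div] at h3
    exact h3
  obtain ⟨c, hc⟩ := slash_of_S (g := fun τ => dl τ / f τ)
    (fun τ => by
      show dl _ / f _ = _
      rw [MF_dl.inv, hM.inv, mul_div_mul_left _ _ (pow_ne_zero _ τ.ne_zero)])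
    (fun τ => by show dl _ / f _ = _; rw [MF_dl.T, hM.T])
    ((differentiable_of_qser MF_dl.ev).div (differentiable_of_qser hM.ev) fun z _ => hf0 _)
    (by
      have := hlim.isBigO_one ℝ
      exact this)
  have hc0 : c = 0 := by
    have : Tendsto (fun τ : ℍ => dl τ / f τ) atImInfty (𝓝 c) := by rw [hc]; exact tendsto_const_nhds
    exact tendsto_nhds_unique this hlim
  have := congrFun hc UpperHalfPlane.I
  rw [hc0] at this
  exact (div_ne_zero (dl_ne_zero _) (hf0 _)) this

noncomputable def jc : ℂ → ℂ := jj ∘ ofComplex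

theorem jc_deriv (τ : ℍ) : HasDerivAt jc (-(2 * Real.pi * Complex.I * (e4 τ ^ 2 * e6 τ / dl τ))) τ := by
  obtain ⟨P2, hD, h4, -, -⟩ := exists_P2
  obtain ⟨d4, E4⟩ := qser_deriv MF_e4.ev τ
  obtain ⟨dD, ED⟩ := qser_deriv MF_dl.ev τ
  have hjc : jc = fun z => (e4 ∘ ofComplex) z ^ 3 / (dl ∘ ofComplex) z := rfl
  have hd := (d4.pow 3).div dD (by simpa using dl_ne_zero τ)
  have eτ : ofComplex (τ : ℂ) = τ := ofComplex_apply τ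
  -- relation
  have hD' : Zc P4 * (C 3 * th ℂ (Zc P4) * Zc PD - th ℂ (Zc PD) * Zc P4) = - (Zc P4 * Zc P6 * Zc PD) := by
    have h1 : P4 * (C 3 * th ℤ P4 * PD - th ℤ PD * P4) = -(P4 * P6 * PD) := by
      rw [hD, show (C 3 : PowerSeries ℤ) = 3 from map_ofNat C 3, h4]; ring
    have h2 := congrArg Zc h1
    have e3 : Zc (C 3) = C 3 := by rw [Zc, map_C]; simp
    rw [map_mul, map_sub, map_mul, map_mul, map_mul, map_neg, map_mul, map_mul, ← Zc_th, ← Zc_th, e3] at h2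
    exact h2
  have hrel : e4 τ * (3 * Dg e4 τ * dl τ - Dg dl τ * e4 τ) = -(e4 τ * e6 τ * dl τ) := by
    have l1 := (MF_e4.ev τ).mul (((E4.smul 3).mul (MF_dl.ev τ)).sub (ED.mul (MF_e4.ev τ)))
    have l2 := (((MF_e4.ev τ).mul (MF_e6.ev τ)).mul (MF_dl.ev τ)).neg
    rw [hD'] at l1
    exact l1.unique l2
  rw [hjc]
  refine hd.congr_deriv ?_
  simp only [Function.comp, eτ, Pi.pow_apply]
  have := dl_ne_zero τ
  field_simp
  simp only [Nat.cast_ofNat]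
  linear_combination e4 τ * hrel

theorem jc_differentiableOn : DifferentiableOn ℂ jc {z | 0 < z.im} := fun z hz => by
  have := (jc_deriv ⟨z, hz⟩).differentiableAt
  exact this.differentiableWithinAt

theorem jc_analyticAt {z : ℂ} (hz : 0 < z.im) : AnalyticAt ℂ jc z :=
  jc_differentiableOn.analyticAt ((isOpen_lt continuous_const Complex.continuous_im).mem_nhds hz)

end EK

end

section
namespace EK
open Filter Topology

theorem locinj {t1 : ℂ} {j σ : ℂ → ℂ} (hj : AnalyticAt ℂ j t1) (hj' : deriv j t1 ≠ 0)
    (hσ : ContinuousAt σ t1) (hσ1 : σ t1 = t1) (h : j ∘ σ =ᶠ[𝓝 t1] j) :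
    ∀ᶠ t in 𝓝 t1, σ t = t := by
  have h1 := hj.hasStrictDerivAt.eventually_left_inverse hj'
  have h2 : Tendsto σ (𝓝 t1) (𝓝 t1) := by
    have := hσ.tendsto; rwa [hσ1] at this
  filter_upwards [h1, h2.eventually h1, h] with t e1 e2 e3
  rw [← e2]
  refine Eq.trans ?_ e1
  exact congrArg _ e3

theorem prod_eventually_zero {I : Type*} (s : Finset I) {t1 : ℂ} {F : I → ℂ → ℂ}
    (hF : ∀ i, AnalyticAt ℂ (F i) t1) (h : ∀ᶠ t in 𝓝 t1, ∏ i ∈ s, F i t = 0) :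
    ∃ i ∈ s, ∀ᶠ t in 𝓝 t1, F i t = 0 := by
  by_contra hc
  have h1 : ∀ i ∈ s, ∀ᶠ t in 𝓝[≠] t1, F i t ≠ 0 := fun i hi =>
    ((hF i).eventually_eq_zero_or_eventually_ne_zero).resolve_left (by
      intro h; exact hc ⟨i, hi, h⟩)
  have h2 : ∀ᶠ t in 𝓝[≠] t1, ∀ i ∈ s, F i t ≠ 0 := (s.eventually_all).2 h1
  have h3 := h2.and (h.filter_mono nhdsWithin_le_nhds)
  obtain ⟨t, a, b⟩ := h3.exists
  exact (Finset.prod_ne_zero_iff.2 a) b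

theorem no_flip {t1 : ℂ} {d ρ : ℂ → ℂ} (hd : AnalyticAt ℂ d t1) (hd0 : ¬ ∀ᶠ t in 𝓝 t1, d t = 0)
    (hρ : HasDerivAt ρ 1 t1) (hρ1 : ρ t1 = t1) (h : ∀ᶠ t in 𝓝 t1, d (ρ t) = - d t) : False := by
  obtain ⟨n, e, he, he0, hde⟩ := hd.exists_eventuallyEq_pow_smul_nonzero_iff.2 hd0
  have hρt : Tendsto ρ (𝓝 t1) (𝓝 t1) := by
    have := hρ.continuousAt.tendsto; rwa [hρ1] at this
  have hs := hasDerivAt_iff_tendsto_slope.1 hρ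
  have l1 : Tendsto (fun t => (slope ρ t1 t) ^ n * e (ρ t)) (𝓝[≠] t1) (𝓝 (1 ^ n * e t1)) :=
    (hs.pow n).mul ((he.continuousAt.tendsto.comp hρt).mono_left nhdsWithin_le_nhds)
  have l2 : Tendsto (fun t => - e t) (𝓝[≠] t1) (𝓝 (- e t1)) :=
    he.continuousAt.tendsto.neg.mono_left nhdsWithin_le_nhds
  have l3 : (fun t => (slope ρ t1 t) ^ n * e (ρ t)) =ᶠ[𝓝[≠] t1] (fun t => - e t) := by
    have a1 := (h.and (hde.and (hρt.eventually hde))).filter_mono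
      (nhdsWithin_le_nhds (s := {t1}ᶜ))
    filter_upwards [a1, self_mem_nhdsWithin] with t ht hne
    obtain ⟨b1, b2, b3⟩ := ht
    have hne' : t - t1 ≠ 0 := sub_ne_zero.2 hne
    rw [b2, b3] at b1
    simp only [slope_def_field, hρ1, smul_eq_mul] at b1 ⊢
    rw [div_pow]
    have := pow_ne_zero n hne'
    field_simp
    linear_combination b1
  have := tendsto_nhds_unique (l1.congr' l3) l2
  rw [one_pow, one_mul] at this
  exact he0 (by linear_combination this / 2)

theorem parity {I : Type*} [Fintype I] [DecidableEq I] {t1 : ℂ} {j : ℂ → ℂ} {φ : I → ℂ → ℂ}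
    (hj : AnalyticAt ℂ j t1) (hj' : deriv j t1 ≠ 0)
    (hφ : ∀ c, AnalyticAt ℂ (φ c) t1) (hφ' : ∀ c, φ c t1 = j t1 → deriv (φ c) t1 ≠ 0)
    (hdist : ∀ c c', φ c =ᶠ[𝓝 t1] φ c' → c = c')
    (hsym : ∀ c, ∀ ρ : ℂ → ℂ, AnalyticAt ℂ ρ t1 → ρ t1 = t1 → φ c ∘ ρ =ᶠ[𝓝 t1] j →
      ∀ᶠ t in 𝓝 t1, ∏ c', (j (ρ t) - φ c' t) = 0)
    (hne : ∀ c, ¬ φ c =ᶠ[𝓝 t1] j)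
    (hodd : Odd (∑ c, analyticOrderNatAt (fun t => j t - φ c t) t1)) :
    ∃ c, φ c t1 = j t1 ∧ deriv (φ c) t1 = - deriv j t1 := by
  have step1 : ∀ c, ∃ c', φ c t1 = j t1 → φ c' t1 = j t1 ∧ ∃ ρ : ℂ → ℂ, AnalyticAt ℂ ρ t1 ∧
      ρ t1 = t1 ∧ deriv ρ t1 ≠ 0 ∧ φ c ∘ ρ =ᶠ[𝓝 t1] j ∧ j ∘ ρ =ᶠ[𝓝 t1] φ c' := by
    intro c
    by_cases hc : φ c t1 = j t1
    swap
    · exact ⟨c, fun h => absurd h hc⟩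
    have hs := (hφ c).hasStrictDerivAt
    have hd := hφ' c hc
    set L := hs.localInverse (φ c) (deriv (φ c) t1) t1 hd with hL
    have hLa : AnalyticAt ℂ L (φ c t1) := (hφ c).analyticAt_localInverse hd
    have hLi : L (φ c t1) = t1 := HasStrictFDerivAt.localInverse_apply_image _
    have hr := hs.eventually_right_inverse hd
    have hρa : AnalyticAt ℂ (fun t => L (j t)) t1 := by
      refine AnalyticAt.comp' (g := L) ?_ hj
      rw [← hc]; exact hLa
    have hρ1 : L (j t1) = t1 := by rw [← hc]; exact hLi
    have hcomp : φ c ∘ (fun t => L (j t)) =ᶠ[𝓝 t1] j := by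
      rw [hc] at hr
      exact hj.continuousAt.tendsto.eventually hr
    obtain ⟨c', -, h'⟩ := prod_eventually_zero Finset.univ
      (F := fun c' t => j (L (j t)) - φ c' t)
      (fun c' => by
        refine AnalyticAt.sub (AnalyticAt.comp' (g := j) (f := fun t => L (j t)) ?_ hρa) (hφ c')
        rw [hρ1]; exact hj)
      (hsym c _ hρa hρ1 hcomp)
    have h'' : j ∘ (fun t => L (j t)) =ᶠ[𝓝 t1] φ c' := by
      filter_upwards [h'] with t ht
      exact sub_eq_zero.1 ht
    refine ⟨c', fun _ => ⟨?_, _, hρa, hρ1, ?_, hcomp, h''⟩⟩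
    · have := h''.eq_of_nhds
      simp only [Function.comp, hρ1] at this
      exact this.symm
    · intro h0
      have hder := hcomp.deriv_eq
      have h1 : HasDerivAt (φ c ∘ (fun t => L (j t)))
          (deriv (φ c) t1 * deriv (fun t => L (j t)) t1) t1 := by
        refine HasDerivAt.comp t1 ?_ hρa.differentiableAt.hasDerivAt
        rw [hρ1]; exact (hφ c).differentiableAt.hasDerivAt
      rw [h1.deriv, h0, mul_zero] at hder
      exact hj' hder.symm
  choose ι hι using step1
  by_contra hcon
  push Not at hcon
  have hord : ∀ c, φ c t1 = j t1 → analyticOrderNatAt (fun t => j t - φ (ι c) t) t1 =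
      analyticOrderNatAt (fun t => j t - φ c t) t1 := by
    intro c hc
    obtain ⟨-, ρ, ρa, ρ1, ρd, e1, e2⟩ := hι c hc
    have hE : (fun t => j t - φ (ι c) t) =ᶠ[𝓝 t1] -((fun t => j t - φ c t) ∘ ρ) := by
      filter_upwards [e1, e2] with t a b
      simp only [Function.comp, Pi.neg_apply] at a b ⊢
      rw [← a, ← b]; ring
    unfold analyticOrderNatAt
    rw [analyticOrderAt_congr hE, analyticOrderAt_neg,
      analyticOrderAt_comp_of_deriv_ne_zero ρa ρd, ρ1]
  have hinv : ∀ c, φ c t1 = j t1 → ι (ι c) = c := by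
    intro c hc
    obtain ⟨hc', ρ, ρa, ρ1, ρd, e1, e2⟩ := hι c hc
    obtain ⟨-, r, ra, r1, rd, f1, f2⟩ := hι _ hc'
    have hr : Tendsto r (𝓝 t1) (𝓝 t1) := by
      have := ra.continuousAt.tendsto; rwa [r1] at this
    have hid := locinj (σ := ρ ∘ r) hj hj' (by
        refine ContinuousAt.comp ?_ ra.continuousAt
        rw [r1]; exact ρa.continuousAt) (by simp [r1, ρ1]) (by
        filter_upwards [hr.eventually e2, f1] with t a b
        simp only [Function.comp] at a b ⊢
        rw [a, b])
    apply hdist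
    filter_upwards [f2, hr.eventually e1, hid] with t a b c'
    simp only [Function.comp] at a b c' ⊢
    rw [← a, ← b, c']
  have hfix : ∀ c, φ c t1 = j t1 → ι c ≠ c := by
    intro c hc hcc
    obtain ⟨-, ρ, ρa, ρ1, ρd, e1, e2⟩ := hι c hc
    rw [hcc] at e2
    have hρ : Tendsto ρ (𝓝 t1) (𝓝 t1) := by
      have := ρa.continuousAt.tendsto; rwa [ρ1] at this
    have hρd := ρa.differentiableAt.hasDerivAt
    have hid := locinj (σ := ρ ∘ ρ) hj hj' (by
        refine ContinuousAt.comp ?_ ρa.continuousAt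
        rw [ρ1]; exact ρa.continuousAt) (by simp [ρ1]) (by
        filter_upwards [hρ.eventually e2, e1] with t a b
        simp only [Function.comp] at a b ⊢
        rw [a, b])
    have h2 : HasDerivAt (ρ ∘ ρ) (deriv ρ t1 * deriv ρ t1) t1 := by
      refine HasDerivAt.comp t1 ?_ hρd
      rw [ρ1]; exact hρd
    have h3 : HasDerivAt (ρ ∘ ρ) 1 t1 := (hasDerivAt_id t1).congr_of_eventuallyEq hid
    have h4 := h2.unique h3
    have h5 : HasDerivAt (j ∘ ρ) (deriv j t1 * deriv ρ t1) t1 := by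
      refine HasDerivAt.comp t1 ?_ hρd
      rw [ρ1]; exact hj.differentiableAt.hasDerivAt
    have h6 := e2.deriv_eq
    rw [h5.deriv] at h6
    rcases mul_self_eq_one_iff.1 h4 with h | h
    · refine no_flip (d := fun t => j t - φ c t) (hj.sub (hφ c)) ?_ (h ▸ hρd) ρ1 ?_
      · intro h0
        refine hne c ?_
        filter_upwards [h0] with t ht
        exact (sub_eq_zero.1 ht).symm
      · filter_upwards [e1, e2] with t a b
        simp only [Function.comp] at a b ⊢
        rw [a, b]; ring
    · rw [h] at h6
      exact hcon c hc (by rw [← h6]; ring)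
  have hz : ((∑ c, analyticOrderNatAt (fun t => j t - φ c t) t1 : ℕ) : ZMod 2) = 0 := by
    classical
    rw [← Finset.sum_filter_add_sum_filter_not Finset.univ (fun c => φ c t1 = j t1)]
    push_cast
    have hA : ∑ c ∈ Finset.univ.filter (fun c => φ c t1 = j t1),
        ((analyticOrderNatAt (fun t => j t - φ c t) t1 : ℕ) : ZMod 2) = 0 := by
      refine Finset.sum_involution (fun c _ => ι c) ?_ ?_ ?_ ?_
      · intro c hc
        rw [hord c (Finset.mem_filter.1 hc).2]
        exact CharTwo.add_self_eq_zero _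
      · intro c hc _
        exact hfix c (Finset.mem_filter.1 hc).2
      · intro c hc
        exact Finset.mem_filter.2 ⟨Finset.mem_univ _, (hι c (Finset.mem_filter.1 hc).2).1⟩
      · intro c hc
        exact hinv c (Finset.mem_filter.1 hc).2
    rw [hA, zero_add]
    refine Finset.sum_eq_zero fun c hc => ?_
    have h0 : analyticOrderAt (fun t => j t - φ c t) t1 = 0 := by
      refine (hj.sub (hφ c)).analyticOrderAt_eq_zero.2 ?_
      exact sub_ne_zero.2 (fun h => (Finset.mem_filter.1 hc).2 h.symm)
    simp [analyticOrderNatAt, h0]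
  rw [ZMod.natCast_eq_zero_iff_even] at hz
  exact (Nat.not_odd_iff_even.2 hz) hodd
end EK

end

section
namespace EK
open PowerSeries UpperHalfPlane ModularForm MatrixGroups Filter Topology
open Polynomial (nthRootsFinset)

variable {l : ℕ}

/-- the points `l τ` and `(τ+i)/l`. -/
noncomputable def mv (l : ℕ) [hl : Fact l.Prime] : Option (ZMod l) → ℍ → ℍ
  | none, τ => ⟨(l : ℂ) * τ, by
      have : (0 : ℝ) < l := Nat.cast_pos.2 hl.out.pos
      simpa using mul_pos this τ.im_pos⟩
  | some i, τ => ⟨((τ : ℂ) + (i.val : ℂ)) / l, by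
      have : (0 : ℝ) < l := Nat.cast_pos.2 hl.out.pos
      rw [Complex.div_natCast_im, Complex.add_im, Complex.natCast_im, add_zero]
      exact div_pos τ.im_pos this⟩

theorem mv_none [hl : Fact l.Prime] (τ : ℍ) : ((mv l none τ : ℍ) : ℂ) = l * τ := rfl
theorem mv_some [hl : Fact l.Prime] (i : ZMod l) (τ : ℍ) :
    ((mv l (some i) τ : ℍ) : ℂ) = (τ + (i.val : ℂ)) / l := rfl

/-- the multiplier. -/
noncomputable def mu (l : ℕ) : Option (ZMod l) → ℂ
  | none => l
  | some _ => 1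

/-- action of `S` on the index set. -/
noncomputable def sg (l : ℕ) [hl : Fact l.Prime] : Option (ZMod l) → Option (ZMod l)
  | none => some 0
  | some i => if i = 0 then none else some (-i⁻¹)

theorem sg_sg [hl : Fact l.Prime] : Function.Involutive (sg l) := by
  intro c
  rcases c with _ | i
  · simp [sg]
  · by_cases h : i = 0
    · simp [sg, h]
    · have : -i⁻¹ ≠ 0 := by simpa using h
      simp only [sg, if_neg h]
      simp [h, inv_neg]

theorem S_coe (τ : ℍ) : ((ModularGroup.S • τ : ℍ) : ℂ) = -(τ : ℂ)⁻¹ := by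
  rw [UpperHalfPlane.modular_S_smul]
  simp [inv_neg]

/-- There is `γ` moving `mv (sg c) τ` to `mv c (S τ)`. -/
theorem mv_S [hl : Fact l.Prime] (c : Option (ZMod l)) (τ : ℍ) :
    ∃ γ : SL(2, ℤ), mv l c (ModularGroup.S • τ) = γ • mv l (sg l c) τ ∧
      mu l c * ((γ 1 0 : ℂ) * (mv l (sg l c) τ : ℂ) + γ 1 1) = τ * mu l (sg l c) := by
  have hl0 : (l : ℂ) ≠ 0 := Nat.cast_ne_zero.2 hl.out.ne_zero
  have hτ := τ.ne_zero
  rcases c with _ | i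
  · refine ⟨ModularGroup.S, ?_, ?_⟩
    · apply UpperHalfPlane.ext
      rw [mv_none, S_coe, S_coe]
      simp only [sg, mv_some, ZMod.val_zero]
      simp
      field_simp
    · simp only [sg, mv_some, ZMod.val_zero, mu]
      simp [ModularGroup.S]
      field_simp
  · by_cases h : i = 0
    · refine ⟨ModularGroup.S, ?_, ?_⟩
      · apply UpperHalfPlane.ext
        subst h
        rw [mv_some, S_coe, S_coe]
        simp only [sg, if_pos, mv_none, ZMod.val_zero]
        field_simp
        simp
      · subst h
        simp only [sg, if_pos, mv_none, mu]
        simp [ModularGroup.S]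
        ring
    · have hdvd : (l : ℤ) ∣ (-1 - (i.val : ℤ) * ((-i⁻¹).val : ℤ)) := by
        rw [← ZMod.intCast_zmod_eq_zero_iff_dvd]
        push_cast
        rw [ZMod.natCast_zmod_val, ZMod.natCast_zmod_val]
        field_simp
        ring
      obtain ⟨b, hb⟩ := hdvd
      set γ : SL(2, ℤ) := ⟨!![(i.val : ℤ), b; (l : ℤ), -((-i⁻¹).val : ℤ)], by
        rw [Matrix.det_fin_two_of]; linarith⟩ with hγ
      have hbC : (-1 - (i.val : ℂ) * ((-i⁻¹).val : ℂ)) = l * b := by exact_mod_cast hb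
      refine ⟨γ, ?_, ?_⟩
      · apply UpperHalfPlane.ext
        rw [mv_some, S_coe, UpperHalfPlane.specialLinearGroup_apply]
        simp only [sg, if_neg h, mv_some]
        have e00 : ((γ 0 0 : ℤ) : ℂ) = (i.val : ℂ) := by simp [hγ]
        have e01 : ((γ 0 1 : ℤ) : ℂ) = (b : ℂ) := by simp [hγ]
        have e10 : ((γ 1 0 : ℤ) : ℂ) = (l : ℂ) := by simp [hγ]
        have e11 : ((γ 1 1 : ℤ) : ℂ) = -((-i⁻¹).val : ℂ) := by simp [hγ]
        simp only [algebraMap_int_eq, eq_intCast, Complex.ofReal_intCast, e00, e01, e10, e11]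
        have e : (l : ℂ) * ((τ + ((-i⁻¹).val : ℂ)) / l) + -((-i⁻¹).val : ℂ) = τ := by
          field_simp; ring
        rw [e]
        generalize ((-i⁻¹).val : ℂ) = w at hbC
        field_simp
        linear_combination hbC
      · simp only [sg, if_neg h, mv_some, mu]
        have e10 : ((γ 1 0 : ℤ) : ℂ) = (l : ℂ) := by simp [hγ]
        have e11 : ((γ 1 1 : ℤ) : ℂ) = -((-i⁻¹).val : ℂ) := by simp [hγ]
        rw [e10, e11]
        field_simp
        ring

/-- A family of functions indexed by `P¹(F_l)`. -/
structure Fam (l : ℕ) [hl : Fact l.Prime] (k : ℕ) (F : Option (ZMod l) → ℍ → ℂ)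
    (B E : PowerSeries ℤ) : Prop where
  evs : ∀ i τ, Ev (Zc B) (qq (mv l (some i) τ)) (F (some i) τ)
  evn : ∀ τ, Ev (Zc E) (qq τ) (F none τ)
  inv : ∀ c (τ : ℍ), F c (ModularGroup.S • τ) = (τ : ℂ) ^ k * F (sg l c) τ

/-- the isogenous family of a modular form. -/
noncomputable def fm (l : ℕ) [hl : Fact l.Prime] (k : ℕ) (g : ℍ → ℂ) (c : Option (ZMod l)) (τ : ℍ) : ℂ :=
  mu l c ^ k * g (mv l c τ)

theorem qq_none [hl : Fact l.Prime] (τ : ℍ) : qq (mv l none τ) = qq τ ^ l := by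
  unfold qq Function.Periodic.qParam
  rw [mv_none, ← Complex.exp_nat_mul]
  congr 1; push_cast; ring

theorem qq_some_pow [hl : Fact l.Prime] (i : ZMod l) (τ : ℍ) : qq (mv l (some i) τ) ^ l = qq τ := by
  have hl0 : (l : ℂ) ≠ 0 := Nat.cast_ne_zero.2 hl.out.ne_zero
  unfold qq Function.Periodic.qParam
  rw [mv_some, ← Complex.exp_nat_mul, Complex.exp_eq_exp_iff_exists_int]
  exact ⟨i.val, by push_cast; field_simp⟩

theorem qq_some [hl : Fact l.Prime] (i : ZMod l) (τ : ℍ) : qq (mv l (some i) τ) =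
    Complex.exp (2 * Real.pi * Complex.I / l) ^ i.val * qq (mv l (some 0) τ) := by
  have hl0 : (l : ℂ) ≠ 0 := Nat.cast_ne_zero.2 hl.out.ne_zero
  unfold qq Function.Periodic.qParam
  rw [mv_some, mv_some, ← Complex.exp_nat_mul, ← Complex.exp_add]
  congr 1
  simp
  field_simp
  ring

theorem Zc_expand (hl : l ≠ 0) (P : PowerSeries ℤ) : Zc (expand l hl P) = expand l hl (Zc P) := by
  ext n
  unfold Zc
  simp only [coeff_map, coeff_expand]
  split_ifs <;> simp

theorem MF.fam [hl : Fact l.Prime] {k : ℕ} {g : ℍ → ℂ} {P : PowerSeries ℤ} (h : MF k g (Zc P)) :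
    Fam l k (fm l k g) P (C ((l : ℤ) ^ k) * expand l hl.out.ne_zero P) where
  evs i τ := by
    have := h.ev (mv l (some i) τ)
    simpa [fm, mu] using this
  evn τ := by
    have h1 := h.ev (mv l none τ)
    rw [qq_none] at h1
    have h2 := (h1.expand l hl.out.ne_zero).smul ((l : ℂ) ^ k)
    rw [← Zc_expand] at h2
    have e : Zc (C ((l : ℤ) ^ k) * expand l hl.out.ne_zero P) =
        C ((l : ℂ) ^ k) * Zc (expand l hl.out.ne_zero P) := by
      unfold Zc
      rw [map_mul, PowerSeries.map_C]; simp
    rw [e]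
    exact h2
  inv c τ := by
    obtain ⟨γ, h1, h2⟩ := mv_S c τ
    unfold fm
    rw [h1, h.slash γ, ← mul_assoc, ← mul_pow, h2, mul_pow, mul_assoc]

theorem MF.const [hl : Fact l.Prime] {k : ℕ} {g : ℍ → ℂ} {P : PowerSeries ℤ} (h : MF k g (Zc P)) :
    Fam l k (fun _ => g) (expand l hl.out.ne_zero P) P where
  evs i τ := by
    rw [Zc_expand, Ev.expand_iff, qq_some_pow]
    exact h.ev τ
  evn := h.ev
  inv c τ := h.inv τ

namespace Fam
variable [hl : Fact l.Prime] {k k' : ℕ} {F F' : Option (ZMod l) → ℍ → ℂ} {B E B' E' : PowerSeries ℤ}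

theorem mul (h : Fam l k F B E) (h' : Fam l k' F' B' E') :
    Fam l (k + k') (F * F') (B * B') (E * E') where
  evs i τ := by
    unfold Zc; rw [map_mul]; exact (h.evs i τ).mul (h'.evs i τ)
  evn τ := by
    unfold Zc; rw [map_mul]; exact (h.evn τ).mul (h'.evn τ)
  inv c τ := by
    simp only [Pi.mul_apply]; rw [h.inv, h'.inv]; ring

theorem sub (h : Fam l k F B E) (h' : Fam l k F' B' E') :
    Fam l k (F - F') (B - B') (E - E') where
  evs i τ := by
    unfold Zc; rw [map_sub]; exact (h.evs i τ).sub (h'.evs i τ)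
  evn τ := by
    unfold Zc; rw [map_sub]; exact (h.evn τ).sub (h'.evn τ)
  inv c τ := by
    simp only [Pi.sub_apply]; rw [h.inv, h'.inv]; ring

theorem smul (h : Fam l k F B E) (a : ℤ) :
    Fam l k (fun c τ => (a : ℂ) * F c τ) (C a * B) (C a * E) where
  evs i τ := by
    unfold Zc; rw [map_mul, PowerSeries.map_C]; exact (h.evs i τ).smul a
  evn τ := by
    unfold Zc; rw [map_mul, PowerSeries.map_C]; exact (h.evn τ).smul a
  inv c τ := by rw [h.inv]; ring

theorem pow (h : Fam l k F B E) (n : ℕ) : Fam l (k * n) (F ^ n) (B ^ n) (E ^ n) := by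
  induction n with
  | zero =>
    simp only [pow_zero, mul_zero]
    refine ⟨fun i τ => ?_, fun τ => ?_, fun c τ => ?_⟩
    · unfold Zc; rw [map_one]; exact Ev.one _
    · unfold Zc; rw [map_one]; exact Ev.one _
    · simp
  | succ n ih => rw [pow_succ, pow_succ, pow_succ, mul_add, mul_one]; exact ih.mul h

theorem prod (h : Fam l k F B E) {Cs : PowerSeries ℤ}
    (hC : nrm ℂ l B = expand l hl.out.ne_zero (PowerSeries.map (Int.castRingHom ℂ) Cs)) :
    MF (k * (l + 1)) (fun τ => ∏ c, F c τ) (Zc (E * Cs)) where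
  ev τ := by
    have hC' : nrm ℂ l B = expand l hl.out.ne_zero (Zc Cs) := hC
    unfold Zc
    rw [map_mul, Fintype.prod_option]
    refine (h.evn τ).mul ?_
    change Ev (Zc Cs) _ _
    rw [← qq_some_pow (0 : ZMod l) τ, ← Ev.expand_iff l hl.out.ne_zero, ← hC']
    unfold nrm
    have hl0 : l ≠ 0 := hl.out.ne_zero
    have : NeZero l := ⟨hl0⟩
    have hprim := Complex.isPrimitiveRoot_exp l hl0
    set ζ := Complex.exp (2 * Real.pi * Complex.I / l) with hζ
    have hinj : Function.Injective (fun i : ZMod l => ζ ^ i.val) := by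
      intro a b hab
      exact ZMod.val_injective l (hprim.pow_inj a.val_lt b.val_lt hab)
    have himg : nthRootsFinset l (1 : ℂ) = Finset.univ.image (fun i : ZMod l => ζ ^ i.val) := by
      symm
      apply Finset.eq_of_subset_of_card_le
      · intro z hz
        obtain ⟨i, -, rfl⟩ := Finset.mem_image.1 hz
        rw [Polynomial.mem_nthRootsFinset hl.out.pos]
        rw [← pow_mul, mul_comm, pow_mul, hprim.pow_eq_one, one_pow]
      · rw [hprim.card_nthRootsFinset, Finset.card_image_of_injective _ hinj, Finset.card_univ,
          ZMod.card]
    rw [himg, Finset.prod_image (fun a _ b _ hab => hinj hab)]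
    refine Ev.prod _ fun i _ => ?_
    apply Ev.rescale
    rw [← qq_some]
    exact h.evs i τ
  inv τ := by
    have : ∏ c, F c (ModularGroup.S • τ) = ∏ c, ((τ : ℂ) ^ k * F (sg l c) τ) :=
      Finset.prod_congr rfl fun c _ => h.inv c τ
    rw [this, Finset.prod_mul_distrib, Finset.prod_const, Finset.card_univ, Fintype.card_option,
      ZMod.card, ← pow_mul]
    congr 1
    exact Function.Bijective.prod_comp sg_sg.bijective (fun c => F c τ)
end Fam
end EK

end

section
namespace EK
open PowerSeries UpperHalfPlane ModularForm MatrixGroups Filter Topology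
open Polynomial (nthRootsFinset)

variable {l : ℕ}

theorem prod_nthRoots (hl : Odd l) : ∏ z ∈ nthRootsFinset l (1 : ℂ), z = 1 := by
  classical
  have hl0 : l ≠ 0 := by rintro rfl; simp at hl
  have : NeZero l := ⟨hl0⟩
  have hpos : 0 < l := Nat.pos_of_ne_zero hl0
  have hprim := Complex.isPrimitiveRoot_exp l hl0
  have h := Polynomial.X_pow_sub_one_eq_prod hpos hprim
  have h1 := congrArg (Polynomial.eval 0) h
  rw [Polynomial.eval_prod] at h1
  simp only [Polynomial.eval_sub, Polynomial.eval_pow, Polynomial.eval_X, Polynomial.eval_one,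
    Polynomial.eval_C, zero_sub, zero_pow hl0] at h1
  rw [Finset.prod_neg, hprim.card_nthRootsFinset, hl.neg_one_pow] at h1
  rw [neg_one_mul, neg_inj] at h1
  exact h1.symm

theorem nrm_low [hl : Fact l.Prime] (hodd : Odd l) {B Cs : PowerSeries ℤ} (h0 : coeff 0 B = 0)
    (hC : nrm ℂ l B = expand l hl.out.ne_zero (PowerSeries.map (Int.castRingHom ℂ) Cs)) :
    coeff 0 Cs = 0 ∧ coeff 1 Cs = (coeff 1 B) ^ l := by
  have hl0 : l ≠ 0 := hl.out.ne_zero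
  have : NeZero l := ⟨hl0⟩
  have hprim := Complex.isPrimitiveRoot_exp l hl0
  obtain ⟨u, hu⟩ := X_dvd_iff.2 (by simpa using h0 : constantCoeff B = 0)
  have hB1 : coeff 1 B = constantCoeff u := by
    rw [hu, ← zero_add 1, coeff_succ_X_mul]; simp
  have key : nrm ℂ l B = X ^ l * ∏ z ∈ nthRootsFinset l (1 : ℂ),
      PowerSeries.rescale z (PowerSeries.map (Int.castRingHom ℂ) u) := by
    unfold nrm
    have : ∀ z ∈ nthRootsFinset l (1 : ℂ), PowerSeries.rescale z (PowerSeries.map (Int.castRingHom ℂ) B)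
        = C z * (X * PowerSeries.rescale z (PowerSeries.map (Int.castRingHom ℂ) u)) := by
      intro z _
      rw [hu, map_mul, map_mul, PowerSeries.map_X, PowerSeries.rescale_X, mul_assoc]
    rw [Finset.prod_congr rfl this, Finset.prod_mul_distrib, Finset.prod_mul_distrib, ← map_prod,
      prod_nthRoots hodd, Finset.prod_const, hprim.card_nthRootsFinset, map_one, one_mul]
  rw [key] at hC
  constructor
  · have := congrArg (coeff 0) hC
    rw [coeff_X_pow_mul', if_neg (by have := hl.out.pos; omega), ← mul_zero l, coeff_expand_mul, coeff_map] at this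
    rw [eq_intCast] at this
    exact_mod_cast this.symm
  · have := congrArg (coeff l) hC
    rw [coeff_X_pow_mul', if_pos le_rfl, Nat.sub_self] at this
    have h2 := coeff_expand_mul (R := ℂ) l hl0 1 (φ := PowerSeries.map (Int.castRingHom ℂ) Cs)
    rw [mul_one] at h2
    rw [h2, coeff_map, coeff_zero_eq_constantCoeff_apply, map_prod] at this
    have h3 : ∀ z ∈ nthRootsFinset l (1 : ℂ), constantCoeff (PowerSeries.rescale z
        (PowerSeries.map (Int.castRingHom ℂ) u)) = ((coeff 1 B : ℤ) : ℂ) := by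
      intro z _
      rw [← coeff_zero_eq_constantCoeff_apply, coeff_rescale, coeff_map, hB1]; simp
    rw [Finset.prod_congr rfl h3, Finset.prod_const, hprim.card_nthRootsFinset, eq_intCast] at this
    exact_mod_cast this.symm

theorem fm_jj [hl : Fact l.Prime] (c : Option (ZMod l)) (τ : ℍ) :
    jj (mv l c τ) * fm l 12 dl c τ = fm l 4 e4 c τ ^ 3 := by
  unfold fm
  rw [mul_left_comm, jj_mul, mul_pow, ← pow_mul]

theorem mu_ne_zero [hl : Fact l.Prime] (c : Option (ZMod l)) : mu l c ≠ 0 := by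
  rcases c with _ | i
  · exact Nat.cast_ne_zero.2 hl.out.ne_zero
  · exact one_ne_zero

theorem fm_dl_ne_zero [hl : Fact l.Prime] (c : Option (ZMod l)) (τ : ℍ) : fm l 12 dl c τ ≠ 0 :=
  mul_ne_zero (pow_ne_zero _ (mu_ne_zero c)) (dl_ne_zero _)

theorem dl_prod [hl : Fact l.Prime] (hodd : Odd l) (τ : ℍ) :
    ∏ c, fm l 12 dl c τ = (l : ℂ) ^ 12 * dl τ ^ (l + 1) := by
  obtain ⟨Cs, hC, -, -⟩ := exists_nrm l hl.out PD
  have h := (MF_dl.fam (l := l)).prod hC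
  obtain ⟨h0, h1⟩ := nrm_low hodd coeff_zero_PD hC
  rw [coeff_one_PD, one_pow] at h1
  have hX1 : X ∣ Cs := X_dvd_iff.2 (by simpa using h0)
  obtain ⟨u, hu⟩ := hX1
  have hX2 : X ∣ PD := X_dvd_iff.2 (by simpa using coeff_zero_PD)
  obtain ⟨v, hv⟩ := hX2
  have hu1 : constantCoeff u = 1 := by
    rw [hu, ← zero_add 1, coeff_succ_X_mul] at h1; simpa using h1
  have hv1 : constantCoeff v = 1 := by
    have := coeff_one_PD
    rw [hv, ← zero_add 1, coeff_succ_X_mul] at this; simpa using this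
  have he : expand l hl.out.ne_zero PD = X ^ l * expand l hl.out.ne_zero v := by
    conv_lhs => rw [hv]
    rw [map_mul, PowerSeries.expand_X]
  have hP : C ((l : ℤ) ^ 12) * expand l hl.out.ne_zero PD * Cs =
      X ^ (l + 1) * (C ((l : ℤ) ^ 12) * expand l hl.out.ne_zero v * u) := by
    rw [he, hu]; ring
  rw [mul_comm 12] at h
  rw [mul_comm] at h
  rw [hP] at h
  obtain ⟨Q, q1, -, q3, q4⟩ := liou (l + 1) (l + 1) (by omega) _ _ h (by
    intro n hn
    rw [coeff_X_pow_mul', if_neg (by omega)])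
  have hq0 : Q = Polynomial.C ((l : ℤ) ^ 12) := by
    ext k
    rcases Nat.eq_zero_or_pos k with rfl | hk
    · have := q3 le_rfl
      rw [Nat.sub_self, coeff_X_pow_mul', if_pos le_rfl, Nat.sub_self] at this
      rw [this, Polynomial.coeff_C_zero, coeff_zero_eq_constantCoeff_apply, map_mul, map_mul,
        constantCoeff_C, hu1, constantCoeff_expand, hv1, mul_one, mul_one]
    · rw [q1 k (by omega), Polynomial.coeff_C, if_neg (by omega)]
  rw [q4 τ, hq0]
  simp [mul_comm]

theorem exists_D [hl : Fact l.Prime] (hodd : Odd l) :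
    ∃ D : Polynomial ℤ, D.Monic ∧ D.natDegree = 2 * l ∧
      D.map (Int.castRingHom (ZMod l)) = (Polynomial.X ^ l - Polynomial.X) ^ 2 ∧
      ∀ τ, Polynomial.aeval (jj τ) D = - ∏ c, (jj τ - jj (mv l c τ)) := by
  have hl0 := hl.out.ne_zero
  have hl2 := hl.out.two_le
  have hlC : (l : ℂ) ≠ 0 := Nat.cast_ne_zero.2 hl0
  set B : PowerSeries ℤ := expand l hl0 (P4 ^ 3) * PD - P4 ^ 3 * expand l hl0 PD with hB
  obtain ⟨Cs, hC, hCl, -⟩ := exists_nrm l hl.out B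
  have hz4 : Zc P4 ^ 3 = Zc (P4 ^ 3) := by unfold Zc; rw [map_pow]
  have hM4 : MF 12 (e4 ^ 3) (Zc (P4 ^ 3)) := hz4 ▸ MF_e4.pow 3
  have hF := ((hM4.const (l := l)).mul (MF_dl.fam (l := l))).sub
    (((MF_e4.fam (l := l)).pow 3).mul (MF_dl.const (l := l)))
  rw [← hB] at hF
  have hE : P4 ^ 3 * (C ((l : ℤ) ^ 12) * expand l hl0 PD) -
      (C ((l : ℤ) ^ 4) * expand l hl0 P4) ^ 3 * PD = C (-(l : ℤ) ^ 12) * B := by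
    rw [hB, map_pow (expand l hl0), mul_pow, ← map_pow C, ← pow_mul]
    simp only [map_neg]
    ring
  rw [hE] at hF
  have hM := (hF.prod hC).smul (-1 / (l : ℂ) ^ 12)
  have hs : C (-1 / (l : ℂ) ^ 12) * Zc (C (-(l : ℤ) ^ 12) * B * Cs) = Zc (B * Cs) := by
    unfold Zc
    rw [mul_assoc, map_mul, PowerSeries.map_C, ← mul_assoc, ← map_mul C]
    have : (-1 / (l : ℂ) ^ 12 * (Int.castRingHom ℂ) (-(l : ℤ) ^ 12)) = 1 := by
      push_cast
      simp
      try field_simp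
    rw [this, map_one, one_mul]
  rw [hs] at hM
  have hB0 : coeff 0 B = 0 := by
    simp [hB, coeff_zero_eq_constantCoeff_apply, (by simpa using coeff_zero_PD : constantCoeff PD = 0)]
  have hB1 : coeff 1 B = 1 := by
    obtain ⟨v, hv⟩ : X ∣ PD := X_dvd_iff.2 (by simpa using coeff_zero_PD)
    have hv1 : constantCoeff v = 1 := by
      have := coeff_one_PD
      rw [hv, ← zero_add 1, coeff_succ_X_mul] at this; simpa using this
    have h41 : constantCoeff P4 = 1 := by simpa using coeff_zero_P4
    have he : expand l hl0 PD = X * (X ^ (l - 1) * expand l hl0 v) := by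
      conv_lhs => rw [hv]
      rw [map_mul, PowerSeries.expand_X, ← mul_assoc, ← pow_succ', Nat.sub_add_cancel (by omega)]
    have : B = X * (expand l hl0 (P4 ^ 3) * v - P4 ^ 3 * (X ^ (l - 1) * expand l hl0 v)) := by
      rw [hB, he]; conv_lhs => rw [hv]
      ring
    rw [this, ← zero_add 1, coeff_succ_X_mul, coeff_zero_eq_constantCoeff_apply]
    simp [hv1, h41, show l - 1 ≠ 0 by omega]
  obtain ⟨c0, c1⟩ := nrm_low hodd hB0 hC
  rw [hB1, one_pow] at c1
  obtain ⟨u, hu⟩ : X ∣ B := X_dvd_iff.2 (by simpa using hB0)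
  obtain ⟨v, hv⟩ : X ∣ Cs := X_dvd_iff.2 (by simpa using c0)
  have hu1 : constantCoeff u = 1 := by
    rw [hu, ← zero_add 1, coeff_succ_X_mul] at hB1; simpa using hB1
  have hv1 : constantCoeff v = 1 := by
    rw [hv, ← zero_add 1, coeff_succ_X_mul] at c1; simpa using c1
  have hBC : B * Cs = X ^ 2 * (u * v) := by rw [hu, hv]; ring
  have e24 : (12 + 12) * (l + 1) = 12 * (2 * l + 2) := by ring
  rw [e24] at hM
  obtain ⟨D, d1, d2, d3, d4⟩ := liou (2 * l + 2) 2 (by omega) _ _ hM (by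
    intro n hn
    rw [hBC, coeff_X_pow_mul', if_neg (by omega)])
  have hd : D.coeff (2 * l) = 1 := by
    have := d3 (by omega)
    rw [hBC, coeff_X_pow_mul', if_pos le_rfl] at this
    simpa [hu1, hv1] using this
  have hdeg : D.natDegree ≤ 2 * l := Polynomial.natDegree_le_iff_coeff_eq_zero.2 fun k hk =>
    d1 k (by omega)
  have hdeg' : D.natDegree = 2 * l := le_antisymm hdeg
    (Polynomial.le_natDegree_of_ne_zero (by rw [hd]; exact one_ne_zero))
  refine ⟨D, ?_, hdeg', ?_, ?_⟩
  · rw [Polynomial.Monic, Polynomial.leadingCoeff, hdeg', hd]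
  · set f := PowerSeries.map (Int.castRingHom (ZMod l)) with hf
    have hx1 : coeff 0 (f (P4 ^ 3)) = 1 := by
      rw [hf, coeff_map, coeff_zero_eq_constantCoeff_apply, map_pow constantCoeff,
        (by simpa using coeff_zero_P4 : constantCoeff P4 = 1)]
      simp
    have hy0 : coeff 0 (f PD) = 0 := by
      rw [hf, coeff_map, coeff_zero_PD, map_zero]
    have hy1 : coeff 1 (f PD) = 1 := by
      rw [hf, coeff_map, coeff_one_PD, map_one]
    have hy : f PD ≠ 0 := by
      intro h; rw [h] at hy1; simp at hy1
    have hD2 : hom (2 * l + 2) (D.map (Int.castRingHom (ZMod l))) (f (P4 ^ 3)) (f PD) = f (B * Cs) := by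
      rw [d2, map_hom f (by intro a; simp [hf])]
      exact hom_mapPoly _ (by intro a; simp) _ _ _ _
    have hfe : ∀ P : PowerSeries ℤ, f (expand l hl0 P) = f P ^ l := by
      intro P
      rw [pow_char_eq_expand l, hf, PowerSeries.map_expand]
    have hfB : f B = hom (l + 1) (Polynomial.X ^ l - Polynomial.X : Polynomial (ZMod l)) (f (P4 ^ 3)) (f PD) := by
      rw [hom_sub]
      have m1 := hom_monomial (k := ZMod l) (l + 1) l (by omega) 1 (f (P4 ^ 3)) (f PD)
      have m2 := hom_monomial (k := ZMod l) (l + 1) 1 (by omega) 1 (f (P4 ^ 3)) (f PD)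
      rw [Polynomial.monomial_one_right_eq_X_pow] at m1 m2
      rw [pow_one] at m2
      rw [m1, m2, hB, map_sub, map_mul, map_mul, hfe, hfe]
      simp
    have hnd : (Polynomial.X ^ l - Polynomial.X : Polynomial (ZMod l)).natDegree ≤ l + 1 := by
      refine (Polynomial.natDegree_sub_le _ _).trans ?_
      simp
    have hsq := hom_pow (l + 1) 2 _ hnd (f (P4 ^ 3)) (f PD) hy
    have hfC : f Cs = f B := hCl
    have hz : hom (2 * l + 2) (D.map (Int.castRingHom (ZMod l)) -
        (Polynomial.X ^ l - Polynomial.X) ^ 2) (f (P4 ^ 3)) (f PD) = 0 := by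
      rw [hom_sub, hD2, map_mul, hfC, hfB, ← pow_two, hsq]
      rw [show (l + 1) * 2 = 2 * l + 2 by ring, sub_self]
    refine sub_eq_zero.1 (hom_eq_zero _ _ ?_ _ _ hx1 hy0 hy1 hz)
    refine (Polynomial.natDegree_sub_le _ _).trans (max_le ?_ ?_)
    · exact (Polynomial.natDegree_map_le).trans (by omega)
    · refine (Polynomial.natDegree_pow_le).trans ?_
      omega
  · intro τ
    have h1 := d4 τ
    have h2 : ∀ c, (e4 ^ 3) τ * fm l 12 dl c τ - fm l 4 e4 c τ ^ 3 * dl τ =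
        (dl τ * fm l 12 dl c τ) * (jj τ - jj (mv l c τ)) := by
      intro c
      rw [← fm_jj]
      simp only [Pi.pow_apply]
      rw [← jj_mul]; ring
    have h3 : (-1 / (l : ℂ) ^ 12) * ∏ c, ((dl τ * fm l 12 dl c τ) * (jj τ - jj (mv l c τ))) =
        dl τ ^ (2 * l + 2) * Polynomial.aeval (jj τ) D := by
      rw [← h1]
      congr 1
      refine Finset.prod_congr rfl fun c _ => ?_
      rw [← h2]; rfl
    rw [Finset.prod_mul_distrib, Finset.prod_mul_distrib, dl_prod hodd, Finset.prod_const,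
      Finset.card_univ, Fintype.card_option, ZMod.card] at h3
    have hdl := pow_ne_zero (2 * l + 2) (dl_ne_zero τ)
    apply mul_left_cancel₀ hdl
    rw [← h3]
    field_simp
    ring

theorem exists_Phi [hl : Fact l.Prime] (hodd : Odd l) (y : ℤ) :
    ∃ Q : Polynomial ℤ, ∀ τ, ∏ c, ((y : ℂ) - jj (mv l c τ)) = Polynomial.aeval (jj τ) Q * ((l : ℂ) ^ 12)⁻¹ := by
  have hlC : (l : ℂ) ≠ 0 := Nat.cast_ne_zero.2 hl.out.ne_zero
  have hF := ((MF_dl.fam (l := l)).smul y).sub ((MF_e4.fam (l := l)).pow 3)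
  obtain ⟨Cs, hC, -, -⟩ := exists_nrm l hl.out _
  have hM := hF.prod hC
  obtain ⟨Q, -, -, -, q4⟩ := liou (l + 1) 0 (by omega) _ _ hM (by simp)
  refine ⟨Q, fun τ => ?_⟩
  have h1 := q4 τ
  have h2 : ∀ c, (y : ℂ) * fm l 12 dl c τ - fm l 4 e4 c τ ^ 3 =
      fm l 12 dl c τ * ((y : ℂ) - jj (mv l c τ)) := by
    intro c
    rw [← fm_jj]; ring
  have h3 : ∏ c, (fm l 12 dl c τ * ((y : ℂ) - jj (mv l c τ))) =
      dl τ ^ (l + 1) * Polynomial.aeval (jj τ) Q := by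
    rw [← h1]
    refine Finset.prod_congr rfl fun c _ => ?_
    rw [← h2]; rfl
  rw [Finset.prod_mul_distrib, dl_prod hodd] at h3
  have hdl := pow_ne_zero (l + 1) (dl_ne_zero τ)
  apply mul_left_cancel₀ hdl
  rw [← mul_assoc, ← h3]
  field_simp

theorem phi_sym [hl : Fact l.Prime] (hodd : Odd l) {τ τ' : ℍ} (h : jj τ = jj τ') (y : ℂ) :
    ∏ c, (y - jj (mv l c τ)) = ∏ c, (y - jj (mv l c τ')) := by
  have key : (∏ c, (Polynomial.X - Polynomial.C (jj (mv l c τ)))) =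
      ∏ c, (Polynomial.X - Polynomial.C (jj (mv l c τ'))) := by
    refine Polynomial.eq_of_infinite_eval_eq _ _ ?_
    refine Set.Infinite.mono ?_ (Set.infinite_range_of_injective (f := fun n : ℤ => (n : ℂ))
      Int.cast_injective)
    rintro _ ⟨n, rfl⟩
    obtain ⟨Q, hQ⟩ := exists_Phi hodd n (l := l)
    simp only [Set.mem_setOf_eq, Polynomial.eval_prod, Polynomial.eval_sub, Polynomial.eval_X,
      Polynomial.eval_C]
    rw [hQ, hQ, h]
  have := congrArg (Polynomial.eval y) key
  simpa only [Polynomial.eval_prod, Polynomial.eval_sub, Polynomial.eval_X,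
      Polynomial.eval_C] using this

/-- the dual isogeny gives a zero factor -/
theorem phi_zero [hl : Fact l.Prime] (hodd : Odd l) {τ w : ℍ} (c : Option (ZMod l))
    (h : jj (mv l c w) = jj τ) : ∏ c', (jj w - jj (mv l c' τ)) = 0 := by
  have hlC : (l : ℂ) ≠ 0 := Nat.cast_ne_zero.2 hl.out.ne_zero
  rw [phi_sym hodd h.symm]
  rcases c with _ | i
  · refine Finset.prod_eq_zero (Finset.mem_univ (some (0 : ZMod l))) ?_
    have : mv l (some 0) (mv l none w) = w := by
      apply UpperHalfPlane.ext
      rw [mv_some, mv_none]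
      simp
      field_simp
    rw [this, sub_self]
  · refine Finset.prod_eq_zero (Finset.mem_univ none) ?_
    have : mv l none (mv l (some i) w) = (i.val : ℝ) +ᵥ w := by
      apply UpperHalfPlane.ext
      rw [mv_none, mv_some, UpperHalfPlane.coe_vadd]
      push_cast
      field_simp
      ring
    have hper : jj ((i.val : ℝ) +ᵥ w) = jj w := by
      have hq : qq ((i.val : ℝ) +ᵥ w) = qq w := by
        unfold qq Function.Periodic.qParam
        rw [UpperHalfPlane.coe_vadd, Complex.exp_eq_exp_iff_exists_int]
        exact ⟨i.val, by push_cast; ring⟩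
      unfold jj
      have h1 := MF_e4.ev ((i.val : ℝ) +ᵥ w)
      have h2 := MF_dl.ev ((i.val : ℝ) +ᵥ w)
      rw [hq] at h1 h2
      rw [h1.unique (MF_e4.ev w), h2.unique (MF_dl.ev w)]
    rw [this, hper, sub_self]
end EK

end

section
namespace EK
open PowerSeries UpperHalfPlane ModularForm MatrixGroups Filter Topology

variable {l : ℕ}

/-- the affine maps underlying `mv`. -/
noncomputable def ac (l : ℕ) : Option (ZMod l) → ℂ → ℂ
  | none, z => l * z
  | some i, z => (z + (i.val : ℂ)) / l

theorem ac_im [hl : Fact l.Prime] (c : Option (ZMod l)) {z : ℂ} (hz : 0 < z.im) :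
    0 < (ac l c z).im := by
  have h : (mv l c ⟨z, hz⟩ : ℂ) = ac l c z := by rcases c with _ | i <;> rfl
  rw [← h]; exact (mv l c ⟨z, hz⟩).im_pos

theorem jc_coe (τ : ℍ) : jc τ = jj τ := by simp [jc]

theorem jc_ac [hl : Fact l.Prime] (c : Option (ZMod l)) (τ : ℍ) : jc (ac l c τ) = jj (mv l c τ) := by
  have h : ac l c τ = (mv l c τ : ℂ) := by rcases c with _ | i <;> rfl
  rw [h, jc_coe]

theorem jc_im {z : ℂ} (hz : 0 < z.im) : jc z = jj ⟨z, hz⟩ := jc_coe ⟨z, hz⟩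
theorem jc_ac_im [hl : Fact l.Prime] (c : Option (ZMod l)) {z : ℂ} (hz : 0 < z.im) :
    jc (ac l c z) = jj (mv l c ⟨z, hz⟩) := jc_ac c ⟨z, hz⟩

theorem ac_diff (l : ℕ) (c : Option (ZMod l)) : Differentiable ℂ (ac l c) := by
  rcases c with _ | i
  · unfold ac; fun_prop
  · unfold ac; fun_prop

theorem phi_analytic [hl : Fact l.Prime] (c : Option (ZMod l)) {z : ℂ} (hz : 0 < z.im) :
    AnalyticAt ℂ (fun z => jc (ac l c z)) z :=
  AnalyticAt.comp' (jc_analyticAt (ac_im c hz)) ((ac_diff l c).analyticAt z)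

theorem phi_deriv [hl : Fact l.Prime] (c : Option (ZMod l)) (τ : ℍ) :
    HasDerivAt (fun z => jc (ac l c z)) ((1 / l) * (-(2 * Real.pi * Complex.I *
      (fm l 4 e4 c τ ^ 2 * fm l 6 e6 c τ / fm l 12 dl c τ)))) τ := by
  have hlC : (l : ℂ) ≠ 0 := Nat.cast_ne_zero.2 hl.out.ne_zero
  have h : ac l c τ = (mv l c τ : ℂ) := by rcases c with _ | i <;> rfl
  have h1 := jc_deriv (mv l c τ)
  rw [← h] at h1
  have hd := dl_ne_zero (mv l c τ)
  rcases c with _ | i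
  · have h2 : HasDerivAt (ac l none) (l : ℂ) τ :=
      ((hasDerivAt_id (τ : ℂ)).const_mul (l : ℂ)).congr_deriv (mul_one _)
    refine (HasDerivAt.comp (τ : ℂ) h1 h2).congr_deriv ?_
    unfold fm mu
    field_simp
  · have h2 : HasDerivAt (ac l (some i)) (1 / l : ℂ) τ :=
      ((hasDerivAt_id (τ : ℂ)).add_const _).div_const _
    refine (HasDerivAt.comp (τ : ℂ) h1 h2).congr_deriv ?_
    unfold fm mu
    field_simp

theorem eq_of_germ {f g : ℂ → ℂ} (hf : ∀ z : ℂ, 0 < z.im → AnalyticAt ℂ f z)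
    (hg : ∀ z : ℂ, 0 < z.im → AnalyticAt ℂ g z) (τ : ℍ) (h : f =ᶠ[𝓝 (τ : ℂ)] g) (w : ℍ) :
    f w = g w := by
  have hpre : IsPreconnected {z : ℂ | 0 < z.im} := (convex_halfSpace_im_gt 0).isPreconnected
  exact AnalyticOnNhd.eqOn_of_preconnected_of_eventuallyEq (U := {z : ℂ | 0 < z.im})
    (fun z hz => hf z hz) (fun z hz => hg z hz) hpre τ.im_pos h w.im_pos

/-- coefficient used to distinguish the points of `P¹(F_l)`. -/
noncomputable def kp (l : ℕ) : Option (ZMod l) → ℂ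
  | none => 0
  | some i => Complex.exp (2 * Real.pi * Complex.I / l) ^ i.val

theorem kp_inj [hl : Fact l.Prime] : Function.Injective (kp l) := by
  have hprim := Complex.isPrimitiveRoot_exp l hl.out.ne_zero
  have h0 : ∀ i : ZMod l, Complex.exp (2 * Real.pi * Complex.I / l) ^ i.val ≠ 0 := fun i =>
    pow_ne_zero _ (Complex.exp_ne_zero _)
  intro a b hab
  rcases a with _ | a <;> rcases b with _ | b
  · rfl
  · exact absurd hab.symm (h0 b)
  · exact absurd hab (h0 a)
  · congr 1
    exact ZMod.val_injective l (hprim.pow_inj a.val_lt b.val_lt hab)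

theorem exists_Rs [hl : Fact l.Prime] {k : ℕ} {g : ℍ → ℂ} {P : PowerSeries ℂ} (h : MF k g P)
    (c : Option (ZMod l)) : ∃ R : PowerSeries ℂ, coeff 0 R = coeff 0 P ∧
      coeff 1 R = kp l c * coeff 1 P ∧ ∀ w, Ev R (qq w) (g (mv l c (mv l none w))) := by
  have hl0 := hl.out.ne_zero
  have hlC : (l : ℂ) ≠ 0 := Nat.cast_ne_zero.2 hl0
  rcases c with _ | i
  · have hl2 : l * l ≠ 0 := mul_ne_zero hl0 hl0
    refine ⟨expand (l * l) hl2 P, ?_, ?_, fun w => ?_⟩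
    · have := coeff_expand_mul (R := ℂ) (l * l) hl2 0 (φ := P)
      rwa [mul_zero] at this
    · rw [coeff_expand, if_neg]
      · simp [kp]
      · have := hl.out.two_le
        intro hd
        have := Nat.le_of_dvd one_pos hd
        nlinarith
    · rw [Ev.expand_iff, pow_mul, ← qq_none, ← qq_none]
      exact h.ev _
  · refine ⟨PowerSeries.rescale (kp l (some i)) P, ?_, ?_, fun w => ?_⟩
    · simp
    · rw [coeff_rescale, pow_one]
    · apply Ev.rescale
      have e : mv l (some 0) (mv l none w) = w := by
        apply UpperHalfPlane.ext
        rw [mv_some, mv_none]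
        simp
        field_simp
      have := qq_some i (mv l none w)
      rw [e] at this
      unfold kp
      rw [← this]
      exact h.ev _

theorem phi_dist [hl : Fact l.Prime] (c c' : Option (ZMod l))
    (h : ∀ τ, jj (mv l c τ) = jj (mv l c' τ)) : c = c' := by
  obtain ⟨R, r0, r1, r2⟩ := exists_Rs (l := l) (MF_e4.pow 3) c
  obtain ⟨D, d0, d1, d2⟩ := exists_Rs (l := l) MF_dl c
  obtain ⟨R', r0', r1', r2'⟩ := exists_Rs (l := l) (MF_e4.pow 3) c'
  obtain ⟨D', d0', d1', d2'⟩ := exists_Rs (l := l) MF_dl c'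
  have z4 : coeff 0 (Zc P4 ^ 3) = 1 := by
    rw [coeff_zero_eq_constantCoeff_apply, map_pow, ← coeff_zero_eq_constantCoeff_apply, Zc,
      coeff_map, coeff_zero_P4]; simp
  have zD : coeff 0 (Zc PD) = 0 := by rw [Zc, coeff_map, coeff_zero_PD]; simp
  have oD : coeff 1 (Zc PD) = 1 := by rw [Zc, coeff_map, coeff_one_PD]; simp
  have key : R * D' = R' * D := by
    refine qser_unique (g := fun w => (e4 ^ 3) (mv l c (mv l none w)) * dl (mv l c' (mv l none w)))
      (fun w => (r2 w).mul (d2' w)) (fun w => ?_)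
    have h1 := (r2' w).mul (d2 w)
    have h2 := h (mv l none w)
    unfold jj at h2
    rw [div_eq_div_iff (dl_ne_zero _) (dl_ne_zero _)] at h2
    simp only [Pi.pow_apply] at h1 ⊢
    rw [h2]; exact h1
  have k1 := congrArg (coeff 1) key
  rw [coeff_mul, coeff_mul, Finset.Nat.antidiagonal_succ] at k1
  simp only [Finset.sum_cons, Finset.Nat.antidiagonal_zero, Finset.map_singleton,
    Finset.sum_singleton] at k1
  simp [-coeff_zero_eq_constantCoeff, r0, d0', d1', r0', d0, d1, z4, zD, oD] at k1
  exact (kp_inj k1).symm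

theorem order_prod {I : Type*} (s : Finset I) {t1 : ℂ} {F : I → ℂ → ℂ}
    (hF : ∀ i, AnalyticAt ℂ (F i) t1) (hne : ∀ i, ¬ ∀ᶠ t in 𝓝 t1, F i t = 0) :
    analyticOrderAt (fun t => ∏ i ∈ s, F i t) t1 =
      ((∑ i ∈ s, analyticOrderNatAt (F i) t1 : ℕ) : ℕ∞) := by
  classical
  induction s using Finset.induction_on with
  | empty =>
    simp only [Finset.prod_empty, Finset.sum_empty, Nat.cast_zero]
    exact (analyticAt_const).analyticOrderAt_eq_zero.2 one_ne_zero
  | insert a s ha ih =>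
    simp only [Finset.prod_insert ha, Finset.sum_insert ha]
    have h1 : analyticOrderAt (fun t => F a t * ∏ i ∈ s, F i t) t1 = _ :=
      analyticOrderAt_mul (hF a) (Finset.analyticAt_fun_prod s fun i _ => hF i)
    rw [h1, ih]
    push_cast
    rw [Nat.cast_analyticOrderNatAt]
    rw [Ne, analyticOrderAt_eq_top]
    exact hne a

theorem order_poly {D : Polynomial ℂ} (hD : D ≠ 0) {t1 : ℂ} {j : ℂ → ℂ} (hj : AnalyticAt ℂ j t1)
    (hj' : deriv j t1 ≠ 0) : analyticOrderAt (fun t => D.eval (j t)) t1 =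
      ((D.rootMultiplicity (j t1) : ℕ) : ℕ∞) := by
  obtain ⟨E, hE, hnd⟩ := D.exists_eq_pow_rootMultiplicity_mul_and_not_dvd hD (j t1)
  set m := D.rootMultiplicity (j t1)
  have e : (fun t => D.eval (j t)) = ((fun t => j t - j t1) ^ m) * (fun t => E.eval (j t)) := by
    funext t
    rw [hE]; simp
  have a1 : AnalyticAt ℂ (fun t => j t - j t1) t1 := hj.sub analyticAt_const
  have a2 : AnalyticAt ℂ (fun t => E.eval (j t)) t1 := by
    refine AnalyticAt.comp' (g := fun z => E.eval z) ?_ hj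
    exact E.differentiable.analyticAt _
  rw [e, analyticOrderAt_mul (a1.pow m) a2, analyticOrderAt_pow a1,
    hj.analyticOrderAt_sub_eq_one_of_deriv_ne_zero hj',
    a2.analyticOrderAt_eq_zero.2 (by rwa [Polynomial.dvd_iff_isRoot] at hnd)]
  simp

theorem e4_ne {τ : ℍ} (h : jj τ ≠ 0) : e4 τ ≠ 0 := by
  intro h0; apply h; unfold jj; rw [h0]; simp
theorem e6_ne {τ : ℍ} (h : jj τ ≠ 1728) : e6 τ ≠ 0 := by
  intro h0; apply h
  have := jj_sub τ
  rw [h0] at this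
  have h2 := (mul_eq_zero.1 (this.trans (by simp))).resolve_right (dl_ne_zero τ)
  exact sub_eq_zero.1 h2

theorem odd_alg {l A B Δ' a b Δ : ℂ} (hlC : l ≠ 0) (g4 : A ≠ 0) (gD : Δ' ≠ 0) (n4 : a ≠ 0)
    (n6 : b ≠ 0) (nD : Δ ≠ 0) (q4 : A ^ 3 * Δ = a ^ 3 * Δ') (q6 : B ^ 2 * Δ = b ^ 2 * Δ')
    (hc3 : A ^ 2 * B * Δ = - l * (a ^ 2 * b * Δ')) :
    A = (-l) ^ 2 * a ∧ B = (-l) ^ 3 * b := by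
  have k1 : B * a = - l * (b * A) := by
    have : A ^ 2 * Δ * (a * (B * a - - l * (b * A))) = 0 := by
      linear_combination a ^ 2 * hc3 + l * b * a * q4
    rcases mul_eq_zero.1 this with h | h
    · exact absurd h (mul_ne_zero (pow_ne_zero _ g4) nD)
    · exact sub_eq_zero.1 ((mul_eq_zero.1 h).resolve_left n4)
  have k2 : A = (-l) ^ 2 * a := by
    have : Δ * Δ' * (B ^ 2 * a ^ 3 - b ^ 2 * A ^ 3) = 0 := by
      linear_combination Δ' * a ^ 3 * q6 - Δ' * b ^ 2 * q4
    have k3 := sub_eq_zero.1 ((mul_eq_zero.1 this).resolve_left (mul_ne_zero nD gD))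
    have k4 : b ^ 2 * A ^ 2 * (A - (-l) ^ 2 * a) = 0 := by
      linear_combination -k3 + a * (B * a - l * b * A) * k1
    exact sub_eq_zero.1 ((mul_eq_zero.1 k4).resolve_left (mul_ne_zero (pow_ne_zero _ n6) (pow_ne_zero _ g4)))
  refine ⟨k2, ?_⟩
  apply mul_right_cancel₀ n4
  rw [k1, k2]; ring

theorem order_sum [hl : Fact l.Prime] {D : Polynomial ℤ} (hDC : D.map (Int.castRingHom ℂ) ≠ 0)
    (hD : ∀ τ, Polynomial.aeval (jj τ) D = - ∏ c, (jj τ - jj (mv l c τ))) (τ : ℍ)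
    (hj' : deriv jc τ ≠ 0) (hne : ∀ c, ¬ (fun z => jc (ac l c z)) =ᶠ[𝓝 (τ : ℂ)] jc) :
    ∑ c, analyticOrderNatAt (fun t => jc t - jc (ac l c t)) (τ : ℂ) =
      (D.map (Int.castRingHom ℂ)).rootMultiplicity (jj τ) := by
  have hja := jc_analyticAt τ.im_pos
  have ho := order_prod Finset.univ (F := fun c t => jc t - jc (ac l c t)) (t1 := (τ : ℂ))
    (fun c => hja.sub (phi_analytic (l := l) c τ.im_pos)) (fun c h => hne c (by
      filter_upwards [h] with t ht
      exact (sub_eq_zero.1 ht).symm))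
  have hq := order_poly hDC hja hj'
  have hcong : (fun t => (D.map (Int.castRingHom ℂ)).eval (jc t)) =ᶠ[𝓝 (τ : ℂ)]
      - (fun t => ∏ c, (jc t - jc (ac l c t))) := by
    have hp1 : ∀ᶠ t in 𝓝 (τ : ℂ), 0 < t.im :=
      (isOpen_lt continuous_const Complex.continuous_im).mem_nhds τ.im_pos
    filter_upwards [hp1] with t ht
    have h1 := hD ⟨t, ht⟩
    have h2 : ∏ c, (jc t - jc (ac l c t)) = ∏ c, (jj ⟨t, ht⟩ - jj (mv l c ⟨t, ht⟩)) := by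
      refine Finset.prod_congr rfl fun c' _ => ?_
      rw [← jc_ac_im c' ht, ← jc_im ht]
    rw [Pi.neg_apply, h2, ← h1, jc_im ht, Polynomial.eval_map]
    rfl
  rw [analyticOrderAt_congr hcong, analyticOrderAt_neg, ho, jc_coe, Nat.cast_inj] at hq
  exact hq

set_option maxHeartbeats 400000 in
/-- odd multiplicity gives a trace zero endomorphism -/
theorem odd_mult [hl : Fact l.Prime] (hodd : Odd l) {D : Polynomial ℤ} (hD0 : D ≠ 0)
    (hD : ∀ τ, Polynomial.aeval (jj τ) D = - ∏ c, (jj τ - jj (mv l c τ))) (τ : ℍ)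
    (h0 : jj τ ≠ 0) (h1 : jj τ ≠ 1728)
    (hm : Odd ((D.map (Int.castRingHom ℂ)).rootMultiplicity (jj τ))) :
    ∃ c, fm l 4 e4 c τ = (-(l : ℂ)) ^ 2 * e4 τ ∧ fm l 6 e6 c τ = (-(l : ℂ)) ^ 3 * e6 τ := by
  have hlC : (l : ℂ) ≠ 0 := Nat.cast_ne_zero.2 hl.out.ne_zero
  have hpi : (2 * Real.pi * Complex.I : ℂ) ≠ 0 := Complex.two_pi_I_ne_zero
  have hDC : D.map (Int.castRingHom ℂ) ≠ 0 := by
    rwa [Polynomial.map_ne_zero_iff (RingHom.injective_int _)]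
  have hja := jc_analyticAt τ.im_pos
  have hjd := jc_deriv τ
  have hj' : deriv jc τ ≠ 0 := by
    rw [hjd.deriv, neg_ne_zero]
    exact mul_ne_zero hpi (div_ne_zero (mul_ne_zero (pow_ne_zero _ (e4_ne h0)) (e6_ne h1))
      (dl_ne_zero τ))
  have hφa := fun c => phi_analytic (l := l) c τ.im_pos
  have f4 : ∀ c, jj (mv l c τ) = jj τ → fm l 4 e4 c τ ≠ 0 := fun c h =>
    mul_ne_zero (pow_ne_zero _ (mu_ne_zero c)) (e4_ne (h ▸ h0))
  have f6 : ∀ c, jj (mv l c τ) = jj τ → fm l 6 e6 c τ ≠ 0 := fun c h =>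
    mul_ne_zero (pow_ne_zero _ (mu_ne_zero c)) (e6_ne (h ▸ h1))
  have hne : ∀ c, ¬ (fun z => jc (ac l c z)) =ᶠ[𝓝 (τ : ℂ)] jc := by
    intro c h
    have hall : ∀ w, jj (mv l c w) = jj w := fun w => by
      have := eq_of_germ (fun z hz => phi_analytic (l := l) c hz) (fun z hz => jc_analyticAt hz)
        τ h w
      simp only [jc_ac, jc_coe] at this
      exact this
    apply hDC
    refine Polynomial.eq_zero_of_infinite_isRoot _ (Set.infinite_univ.mono fun x _ => ?_)
    obtain ⟨w, hw⟩ := jj_surj x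
    have h2 := hD w
    rw [Finset.prod_eq_zero (Finset.mem_univ c) (by rw [hall, sub_self]), neg_zero, hw] at h2
    rw [Set.mem_setOf_eq, Polynomial.IsRoot, Polynomial.eval_map]
    exact h2
  obtain ⟨c, hc1, hc2⟩ := parity (t1 := (τ : ℂ)) (j := jc) (φ := fun c z => jc (ac l c z)) hja hj' hφa
    (fun c hc => by
      rw [jc_ac, jc_coe] at hc
      rw [(phi_deriv c τ).deriv]
      refine mul_ne_zero (one_div_ne_zero hlC) (neg_ne_zero.2 (mul_ne_zero hpi (div_ne_zero
        (mul_ne_zero (pow_ne_zero _ (f4 c hc)) (f6 c hc)) (fm_dl_ne_zero c τ)))))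
    (fun c c' h => phi_dist c c' fun w => by
      have := eq_of_germ (fun z hz => phi_analytic (l := l) c hz)
        (fun z hz => phi_analytic (l := l) c' hz) τ h w
      simpa only [jc_ac] using this)
    (fun c ρ ρa ρ1 h => by
      have hp1 : ∀ᶠ t in 𝓝 (τ : ℂ), 0 < t.im :=
        (isOpen_lt continuous_const Complex.continuous_im).mem_nhds τ.im_pos
      have hρ : Tendsto ρ (𝓝 (τ : ℂ)) (𝓝 (τ : ℂ)) := by
        have := ρa.continuousAt.tendsto; rwa [ρ1] at this
      filter_upwards [hp1, hρ.eventually hp1, h] with t a b e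
      have := phi_zero hodd (τ := ⟨t, a⟩) (w := ⟨ρ t, b⟩) c (by
        rw [← jc_ac_im c b, ← jc_im a]; exact e)
      rw [← this]
      refine Finset.prod_congr rfl fun c' _ => ?_
      rw [← jc_ac_im c' a, ← jc_im b])
    hne
    (by
      have hq := order_sum hDC hD τ hj' hne
      rw [hq]; exact hm)
  simp only [jc_ac, jc_coe] at hc1
  refine ⟨c, ?_⟩
  have g4 := f4 c hc1
  have g6 := f6 c hc1
  have gD := fm_dl_ne_zero (l := l) c τ
  rw [(phi_deriv c τ).deriv, hjd.deriv] at hc2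
  have n4 := e4_ne h0
  have n6 := e6_ne h1
  have nD := dl_ne_zero τ
  have q4 : fm l 4 e4 c τ ^ 3 * dl τ = e4 τ ^ 3 * fm l 12 dl c τ := by
    rw [← fm_jj, hc1, ← jj_mul]; ring
  have q6 : fm l 6 e6 c τ ^ 2 * dl τ = e6 τ ^ 2 * fm l 12 dl c τ := by
    have : fm l 6 e6 c τ ^ 2 = (jj (mv l c τ) - 1728) * fm l 12 dl c τ := by
      unfold fm
      rw [mul_left_comm, jj_sub, mul_pow, ← pow_mul]
    rw [this, hc1, ← jj_sub]; ring
  have e : ∀ x y : ℂ, 1 / (l : ℂ) * -(2 * Real.pi * Complex.I * x) =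
      - -(2 * Real.pi * Complex.I * y) → x = - l * y := by
    intro x y h
    apply mul_left_cancel₀ hpi
    field_simp at h
    linear_combination -(2 * Real.pi * Complex.I : ℂ) * h
  have h'' := e _ _ hc2
  rw [div_eq_iff gD, ← mul_div_assoc, div_mul_eq_mul_div, eq_div_iff nD] at h''
  exact odd_alg hlC g4 gD n4 n6 nD q4 q6 (by linear_combination h'')

theorem hf_isog [hl : Fact l.Prime] (n : ℕ) (c : Option (ZMod l)) (τ : ℍ)
    (h4 : fm l 4 e4 c τ = (-(l : ℂ)) ^ 2 * e4 τ) (h6 : fm l 6 e6 c τ = (-(l : ℂ)) ^ 3 * e6 τ) :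
    fm l (2 * n) (hf n) c τ = (-(l : ℂ)) ^ n * hf n τ := by
  obtain ⟨S, z, i, j, hij, h⟩ := hp_isob n
  unfold fm at *
  unfold hf
  rw [h, h, Finset.mul_sum, Finset.mul_sum]
  refine Finset.sum_congr rfl fun s hs => ?_
  have e1 : mu l c ^ (2 * n) * ((z s : ℂ) * (e4 (mv l c τ) ^ i s * e6 (mv l c τ) ^ j s)) =
      z s * ((mu l c ^ 4 * e4 (mv l c τ)) ^ i s * (mu l c ^ 6 * e6 (mv l c τ)) ^ j s) := by
    rw [← hij s hs]; ring
  rw [e1, h4, h6]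
  have e2 : (-(l : ℂ)) ^ n = ((-(l : ℂ)) ^ 2) ^ i s * ((-(l : ℂ)) ^ 3) ^ j s := by
    rw [← hij s hs, ← pow_mul, ← pow_mul, ← pow_add]
  rw [e2]; ring
end EK

end

section
namespace EK
open PowerSeries UpperHalfPlane ModularForm MatrixGroups Filter Topology

variable {l : ℕ}

theorem exists_e_core [hl : Fact l.Prime] (p : ℕ) [hpp : Fact p.Prime] (n : ℕ) (hpn : p = 2 * n + 1)
    (hp3 : 3 < p) (α β γ : ℕ) (hab : 2 * n + 4 * α + 6 * β = 12 * γ) (QF : Polynomial ℤ)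
    (hdeg : QF.natDegree ≤ γ) (hQF : HP n * (P4 ^ α * P6 ^ β) = hom γ QF (P4 ^ 3) PD)
    (r s u v : ℤ) (hs : s ≠ 0) (E' : PowerSeries ℤ)
    (hE : C ((l : ℤ) ^ (2 * n)) * expand l hl.out.ne_zero (HP n) - C r * HP n = C s * E')
    (hEp : PowerSeries.map (Int.castRingHom (ZMod p)) E' =
      C (u : ZMod p) * PowerSeries.map (Int.castRingHom (ZMod p)) (HP n))
    (hrv : ((1 - r : ℤ) : ZMod p) = v) :
    ∃ Q : Polynomial ℤ, Q.map (Int.castRingHom (ZMod p)) =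
        Polynomial.C ((u * v ^ l : ℤ) : ZMod p) * (QF.map (Int.castRingHom (ZMod p))) ^ (l + 1) ∧
      ∀ τ, (∃ c, fm l (2 * n) (hf n) c τ = r * hf n τ) → Polynomial.aeval (jj τ) Q = 0 := by
  have hl0 := hl.out.ne_zero
  set B : PowerSeries ℤ := HP n - C r * expand l hl0 (HP n) with hB
  obtain ⟨Cs, hC, -, hCp⟩ := exists_nrm l hl.out B
  have hF := ((MF_hf n).fam (l := l)).sub (((MF_hf n).const (l := l)).smul r)
  rw [hE] at hF
  have hM1 := (hF.prod hC).smul (1 / (s : ℂ))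
  have hsC : (s : ℂ) ≠ 0 := Int.cast_ne_zero.2 hs
  have hs1 : C (1 / (s : ℂ)) * Zc (C s * E' * Cs) = Zc (E' * Cs) := by
    unfold Zc
    rw [mul_assoc, map_mul, PowerSeries.map_C, ← mul_assoc, ← map_mul C, eq_intCast,
      one_div_mul_cancel hsC, map_one, one_mul]
  rw [hs1] at hM1
  have hM2 := (((MF_e4.pow α).mul (MF_e6.pow β)).pow (l + 1))
  have hM := hM1.mul hM2
  have hz : Zc (E' * Cs) * (Zc P4 ^ α * Zc P6 ^ β) ^ (l + 1) =
      Zc (E' * Cs * (P4 ^ α * P6 ^ β) ^ (l + 1)) := by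
    unfold Zc; simp only [map_mul, map_pow]
  rw [hz, show 2 * n * (l + 1) + (4 * α + 6 * β) * (l + 1) = 12 * (γ * (l + 1)) by
    rw [← add_mul, ← add_assoc, hab]; ring] at hM
  obtain ⟨Q, q1, q2, -, q4⟩ := liou (γ * (l + 1)) 0 (by omega) _ _ hM (by simp)
  refine ⟨Q, ?_, ?_⟩
  · set f := PowerSeries.map (Int.castRingHom (ZMod p)) with hf
    have hx1 : coeff 0 (f (P4 ^ 3)) = 1 := by
      rw [hf, coeff_map, coeff_zero_eq_constantCoeff_apply, map_pow constantCoeff,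
        (by simpa using coeff_zero_P4 : constantCoeff P4 = 1)]
      simp
    have hy0 : coeff 0 (f PD) = 0 := by
      rw [hf, coeff_map, coeff_zero_PD, map_zero]
    have hy1 : coeff 1 (f PD) = 1 := by
      rw [hf, coeff_map, coeff_one_PD, map_one]
    have hy : f PD ≠ 0 := by
      intro h; rw [h] at hy1; simp at hy1
    have hmap : ∀ (m : ℕ) (R : Polynomial ℤ),
        hom m (R.map (Int.castRingHom (ZMod p))) (f (P4 ^ 3)) (f PD) = f (hom m R (P4 ^ 3) PD) := by
      intro m R
      rw [map_hom f (by intro a; simp [hf])]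
      exact hom_mapPoly _ (by intro a; simp) _ _ _ _
    have hc := hp_const n p hpn hp3
    set c : ℤ := coeff 0 (HP n) with hcdef
    have hfH : f (HP n) = C (c : ZMod p) := hc
    have hfB : f B = C ((v * c : ℤ) : ZMod p) := by
      have e1 : f (expand l hl0 (HP n)) = C (c : ZMod p) := by
        rw [hf, PowerSeries.map_expand, ← hf, hfH]
        exact expand_C _ _ _
      rw [hB, map_sub, map_mul, e1, hfH, hf, PowerSeries.map_C, ← map_mul, ← map_sub]
      congr 1
      push_cast at hrv ⊢
      rw [eq_intCast, ← hrv]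
      ring
    have hfC : f Cs = C (((v * c : ℤ) : ZMod p) ^ l) := hCp p hpp.out (v * c) hfB
    have hz : hom (γ * (l + 1)) (Q.map (Int.castRingHom (ZMod p)) -
        Polynomial.C ((u * v ^ l : ℤ) : ZMod p) * (QF.map (Int.castRingHom (ZMod p))) ^ (l + 1))
        (f (P4 ^ 3)) (f PD) = 0 := by
      have hQd : (QF.map (Int.castRingHom (ZMod p))).natDegree ≤ γ :=
        (Polynomial.natDegree_map_le).trans hdeg
      have hsm : ∀ (m : ℕ) (a : ZMod p) (R : Polynomial (ZMod p)) (x y : PowerSeries (ZMod p)),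
          hom m (Polynomial.C a * R) x y = C a * hom m R x y := by
        intro m a R x y
        unfold hom
        rw [Finset.mul_sum]
        refine Finset.sum_congr rfl fun i _ => ?_
        rw [Polynomial.coeff_C_mul, map_mul, mul_assoc]; rfl
      rw [hom_sub, hmap, ← q2, hsm, ← hom_pow _ _ _ hQd _ _ hy, hmap, ← hQF]
      simp only [map_mul, hfC, hEp, hfH]
      push_cast
      simp only [map_mul, map_pow]
      ring
    refine sub_eq_zero.1 (hom_eq_zero _ _ ?_ _ _ hx1 hy0 hy1 hz)
    refine (Polynomial.natDegree_sub_le _ _).trans (max_le ?_ ?_)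
    · refine (Polynomial.natDegree_map_le).trans ?_
      exact Polynomial.natDegree_le_iff_coeff_eq_zero.2 fun k hk => q1 k (by omega)
    · refine (Polynomial.natDegree_C_mul_le _ _).trans ?_
      refine (Polynomial.natDegree_pow_le).trans ?_
      rw [mul_comm]
      exact Nat.mul_le_mul_right _ ((Polynomial.natDegree_map_le).trans hdeg)
  · rintro τ ⟨c, hc⟩
    have h := q4 τ
    have hz : ∏ c, (fm l (2 * n) (EK.hf n) - (fun _ τ => (r : ℂ) * EK.hf n τ : Option (ZMod l) → ℍ → ℂ)) c τ = 0 := by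
      refine Finset.prod_eq_zero (Finset.mem_univ c) ?_
      simp only [Pi.sub_apply]
      rw [hc, sub_self]
    simp only [Pi.mul_apply] at h
    rw [hz, mul_zero, zero_mul] at h
    exact (mul_eq_zero.1 h.symm).resolve_left (pow_ne_zero _ (dl_ne_zero τ))

theorem exists_e [hl : Fact l.Prime] (p : ℕ) [hpp : Fact p.Prime] (n : ℕ) (hpn : p = 2 * n + 1)
    (hp3 : 3 < p) (α β γ : ℕ) (hab : 2 * n + 4 * α + 6 * β = 12 * γ) (QF : Polynomial ℤ)
    (hdeg : QF.natDegree ≤ γ) (hQF : HP n * (P4 ^ α * P6 ^ β) = hom γ QF (P4 ^ 3) PD)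
    (hpl : p = l ∨ (-(l : ZMod p)) ^ n = -1) :
    ∃ Q : Polynomial ℤ, ∃ w : ZMod p, w ≠ 0 ∧ Q.map (Int.castRingHom (ZMod p)) =
        Polynomial.C w * (QF.map (Int.castRingHom (ZMod p))) ^ (l + 1) ∧
      ∀ τ, (∃ c, fm l (2 * n) (hf n) c τ = (-(l : ℂ)) ^ n * hf n τ) → Polynomial.aeval (jj τ) Q = 0 := by
  have hl0 := hl.out.ne_zero
  have hn : n ≠ 0 := by omega
  have hr : (((-(l : ℤ)) ^ n : ℤ) : ℂ) = (-(l : ℂ)) ^ n := by push_cast; ring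
  rcases hpl with h | h
  · subst h
    obtain ⟨Q, h1, h2⟩ := exists_e_core (l := p) p n hpn hp3 α β γ hab QF hdeg hQF ((-(p : ℤ)) ^ n)
      ((-(p : ℤ)) ^ n) (-1) 1 (pow_ne_zero _ (neg_ne_zero.2 (Int.natCast_ne_zero.2 hl0)))
      (C ((-(p : ℤ)) ^ n) * expand p hl0 (HP n) - HP n)
      (by
        have : ((p : ℤ) ^ (2 * n)) = (-(p : ℤ)) ^ n * (-(p : ℤ)) ^ n := by
          rw [← mul_pow, neg_mul_neg, ← pow_two, pow_mul]
        rw [this, map_mul]; ring)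
      (by
        rw [map_sub, map_mul, PowerSeries.map_C]
        simp [hn])
      (by push_cast; simp [hn])
    refine ⟨Q, _, ?_, h1, fun τ hτ => h2 τ (by rw [hr]; exact hτ)⟩
    simp
  · obtain ⟨Q, h1, h2⟩ := exists_e_core (l := l) p n hpn hp3 α β γ hab QF hdeg hQF ((-(l : ℤ)) ^ n)
      1 2 2 one_ne_zero
      (C ((l : ℤ) ^ (2 * n)) * expand l hl0 (HP n) - C ((-(l : ℤ)) ^ n) * HP n)
      (by rw [map_one, one_mul])
      (by
        have e2 : (l : ZMod p) ^ (2 * n) = 1 := by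
          have := congrArg (· ^ 2) h
          simp only [neg_sq, one_pow, ← pow_mul] at this
          rw [mul_comm n 2, pow_mul, neg_sq, ← pow_mul] at this
          exact this
        set f := PowerSeries.map (Int.castRingHom (ZMod p)) with hf
        have hfH := hp_const n p hpn hp3
        rw [← hf] at hfH
        have e1 : f (expand l hl0 (HP n)) = f (HP n) := by
          rw [hf, PowerSeries.map_expand, ← hf, hfH]
          exact expand_C _ _ _
        rw [map_sub, map_mul, map_mul, e1, hf, PowerSeries.map_C, PowerSeries.map_C]
        have e3 : (Int.castRingHom (ZMod p)) ((l : ℤ) ^ (2 * n)) = 1 := by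
          rw [← e2]; simp
        have e4 : (Int.castRingHom (ZMod p)) ((-(l : ℤ)) ^ n) = -1 := by
          rw [← h]; simp
        rw [e3, e4, map_neg, map_one]
        have : (C ((2 : ℤ) : ZMod p) : PowerSeries (ZMod p)) = 2 := by
          rw [Int.cast_ofNat]; exact map_ofNat C 2
        rw [this]; ring)
      (by push_cast; rw [h]; ring)
    refine ⟨Q, _, ?_, h1, fun τ hτ => h2 τ (by rw [hr]; exact hτ)⟩
    push_cast
    have : (2 : ZMod p) ≠ 0 := by
      intro h0
      have : ((2 : ℕ) : ZMod p) = 0 := by exact_mod_cast h0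
      rw [ZMod.natCast_eq_zero_iff] at this
      have := Nat.le_of_dvd (by norm_num) this
      omega
    exact mul_ne_zero this (pow_ne_zero _ this)
end EK

end

section
namespace EK
open PowerSeries UpperHalfPlane ModularForm MatrixGroups Filter Topology
open scoped ComplexConjugate

theorem jj_of_q {τ τ' : ℍ} (h : qq τ = qq τ') : jj τ = jj τ' := by
  have h4 := MF_e4.ev τ
  have hd := MF_dl.ev τ
  rw [h] at h4 hd
  unfold jj
  rw [h4.unique (MF_e4.ev τ'), hd.unique (MF_dl.ev τ')]

theorem jj_shift {τ τ' : ℍ} (n : ℤ) (h : (τ' : ℂ) = τ + n) : jj τ' = jj τ := by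
  refine jj_of_q ?_
  unfold qq Function.Periodic.qParam
  rw [h]
  have : 2 * (Real.pi : ℂ) * Complex.I * ((τ : ℂ) + n) / ((1 : ℝ) : ℂ) =
    2 * Real.pi * Complex.I * τ / ((1 : ℝ) : ℂ) + n * (2 * Real.pi * Complex.I) := by push_cast; ring
  rw [this, Complex.exp_add, Complex.exp_int_mul_two_pi_mul_I, mul_one]

theorem jj_inv {τ τ' : ℍ} (h : (τ' : ℂ) = -(τ : ℂ)⁻¹) : jj τ' = jj τ := by
  have : τ' = ModularGroup.S • τ := by
    apply UpperHalfPlane.ext; rw [h, S_coe]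
  rw [this]
  unfold jj
  rw [MF_e4.inv, MF_dl.inv, mul_pow, ← pow_mul, mul_div_mul_left _ _ (pow_ne_zero _ τ.ne_zero)]

theorem Ev_conj {P : PowerSeries ℤ} {z w : ℂ} (h : Ev (Zc P) z w) : Ev (Zc P) (conj z) (conj w) := by
  unfold Ev at h ⊢
  have := h.map (starRingEnd ℂ) Complex.continuous_conj
  have e : (⇑(starRingEnd ℂ) ∘ fun n => (coeff n) (Zc P) * z ^ n) =
      fun n => (coeff n) (Zc P) * (conj z) ^ n := by
    funext n
    simp only [Function.comp, map_mul, map_pow, coeff_map, eq_intCast]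
    rw [show conj ((coeff n P : ℤ) : ℂ) = ((coeff n P : ℤ) : ℂ) from map_intCast _ _]
  rw [e] at this
  exact this

theorem qq_conj {τ τ' : ℍ} (h : (τ' : ℂ) = -conj (τ : ℂ)) : qq τ' = conj (qq τ) := by
  unfold qq Function.Periodic.qParam
  rw [h, ← Complex.exp_conj]
  congr 1
  simp only [map_div₀, map_mul, Complex.conj_I, Complex.conj_ofReal]
  rw [show conj (2 : ℂ) = 2 from map_ofNat _ 2]
  ring

theorem jj_conj {τ τ' : ℍ} (h : (τ' : ℂ) = -conj (τ : ℂ)) : jj τ' = conj (jj τ) := by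
  have h4 := Ev_conj (MF_e4.ev τ)
  have hd := Ev_conj (MF_dl.ev τ)
  rw [← qq_conj h] at h4 hd
  unfold jj
  rw [map_div₀, map_pow, h4.unique (MF_e4.ev τ'), hd.unique (MF_dl.ev τ')]

theorem Ev_div {U : PowerSeries ℂ} {z w : ℂ} (hz : z ≠ 0) (h : Ev (X * U) z w) : Ev U z (w / z) := by
  unfold Ev at h ⊢
  have h1 := (hasSum_nat_add_iff' 1).2 h
  simp only [coeff_succ_X_mul, Finset.range_one, Finset.sum_singleton, coeff_zero_X_mul, zero_mul,
    sub_zero] at h1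
  have h2 := h1.div_const z
  have e : (fun n => coeff n U * z ^ n) = fun i => (coeff i) U * z ^ (i + 1) / z := by
    funext n
    rw [pow_succ]; field_simp
  rw [e]
  exact h2

theorem qj_tendsto : Tendsto (fun τ => qq τ * jj τ) atImInfty (𝓝 1) := by
  obtain ⟨U, hU⟩ := X_dvd_iff.2 (by simpa using coeff_zero_PD : constantCoeff PD = 0)
  have hU1 : coeff 0 U = 1 := by
    have := coeff_one_PD
    rw [hU, ← zero_add 1, coeff_succ_X_mul] at this
    exact this
  have h1 : ∀ τ, Ev (Zc U) (qq τ) (dl τ / qq τ) := fun τ => by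
    refine Ev_div (qq_ne_zero τ) ?_
    have := MF_dl.ev τ
    rw [hU, map_mul] at this
    simpa using this
  have h2 := tendsto_of_qser h1
  have h3 := tendsto_of_qser MF_e4.ev
  rw [coeff_map, hU1, map_one] at h2
  rw [coeff_map, coeff_zero_P4, map_one] at h3
  have h4 := (h3.pow 3).div h2 one_ne_zero
  rw [one_pow, div_one] at h4
  refine h4.congr fun τ => ?_
  show e4 τ ^ 3 / (dl τ / qq τ) = _
  unfold jj
  have := qq_ne_zero τ
  have := dl_ne_zero τ
  field_simp

/-- the point `s/2 + t i`. -/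
noncomputable def pt (s : ℤ) (t : ℝ) (ht : 0 < t) : ℍ := ⟨(s : ℂ) / 2 + t * Complex.I, by
  have : ((s : ℂ) / 2).im = 0 := by
    rw [show (s : ℂ) / 2 = (((s : ℝ) / 2 : ℝ) : ℂ) by push_cast; rfl, Complex.ofReal_im]
  simpa [this] using ht⟩

theorem pt_coe (s : ℤ) (t : ℝ) (ht : 0 < t) : ((pt s t ht : ℍ) : ℂ) = (s : ℂ) / 2 + t * Complex.I := rfl

theorem pt_im (s : ℤ) (t : ℝ) (ht : 0 < t) : (pt s t ht).im = t := by
  have : ((s : ℂ) / 2).im = 0 := by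
    rw [show (s : ℂ) / 2 = (((s : ℝ) / 2 : ℝ) : ℂ) by push_cast; rfl, Complex.ofReal_im]
  rw [← UpperHalfPlane.coe_im, pt_coe]
  simp [this]

theorem pt_conj (s : ℤ) (t : ℝ) (ht : 0 < t) :
    -conj ((pt s t ht : ℍ) : ℂ) = (pt s t ht : ℂ) + ((-s : ℤ) : ℂ) := by
  rw [pt_coe]
  simp only [map_add, map_mul, map_div₀, Complex.conj_I, Complex.conj_ofReal]
  rw [show conj (2 : ℂ) = 2 from map_ofNat _ 2]
  rw [show conj (s : ℂ) = (s : ℂ) from map_intCast _ s]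
  push_cast; ring

theorem jj_pt_real (s : ℤ) (t : ℝ) (ht : 0 < t) : (((jj (pt s t ht)).re : ℝ) : ℂ) = jj (pt s t ht) := by
  rw [← Complex.conj_eq_iff_re]
  let τ' : ℍ := ⟨-conj ((pt s t ht : ℍ) : ℂ), by
    have := (pt s t ht).im_pos
    simpa using this⟩
  rw [← jj_conj (τ' := τ') rfl]
  exact jj_shift (-s) (pt_conj s t ht)

theorem qq_pt (s : ℤ) (t : ℝ) (ht : 0 < t) :
    qq (pt s t ht) = (((-1 : ℝ) ^ s * Real.exp (-(2 * Real.pi * t)) : ℝ) : ℂ) := by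
  unfold qq Function.Periodic.qParam
  rw [pt_coe]
  have : 2 * (Real.pi : ℂ) * Complex.I * ((s : ℂ) / 2 + t * Complex.I) / ((1 : ℝ) : ℂ) =
    s * (Real.pi * Complex.I) + ((-(2 * Real.pi * t) : ℝ) : ℂ) := by
    push_cast
    linear_combination 2 * (Real.pi : ℂ) * t * Complex.I_sq
  rw [this, Complex.exp_add, Complex.exp_int_mul, Complex.exp_pi_mul_I]
  push_cast; rfl

theorem jj_large (B : ℝ) : ∃ T : ℝ, 1 ≤ T ∧ ∀ (s : ℤ) (t : ℝ) (ht : 0 < t), T ≤ t →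
    B ≤ (-1 : ℝ) ^ s * (jj (pt s t ht)).re := by
  have h1 : ∀ᶠ τ in atImInfty, ‖qq τ * jj τ - 1‖ < 1 / 2 := by
    have := (qj_tendsto.sub_const 1).norm
    simp only [sub_self, norm_zero] at this
    exact this.eventually (gt_mem_nhds (by norm_num))
  have h2 : ∀ᶠ τ in atImInfty, |B| * ‖qq τ‖ < 1 / 2 := by
    have h := (qParam_tendsto_atImInfty (h := 1) one_pos).norm
    have := h.const_mul |B|
    simp only [norm_zero, mul_zero] at this
    exact (this.eventually (gt_mem_nhds (by norm_num : (0 : ℝ) < 1 / 2)))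
  obtain ⟨T, hT⟩ := (UpperHalfPlane.atImInfty_mem _).1 (h1.and h2)
  refine ⟨max T 1, le_max_right _ _, fun s t ht htT => ?_⟩
  obtain ⟨a, b⟩ := hT (pt s t ht) (by rw [pt_im]; exact (le_max_left _ _).trans htT)
  have hr := jj_pt_real s t ht
  rw [qq_pt] at a b
  set r := Real.exp (-(2 * Real.pi * t)) with hr0
  have hrp : 0 < r := Real.exp_pos _
  set x := (jj (pt s t ht)).re with hx
  rw [← hr] at a
  have hs : |((-1 : ℝ) ^ s)| = 1 := by
    rcases Int.even_or_odd s with h | h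
    · simp [h.neg_one_zpow]
    · simp [h.neg_one_zpow]
  rw [← Complex.ofReal_mul, ← Complex.ofReal_one, ← Complex.ofReal_sub, Complex.norm_real,
    Real.norm_eq_abs, abs_lt] at a
  rw [Complex.norm_real, Real.norm_eq_abs, abs_mul, hs, one_mul, abs_of_pos hrp] at b
  have h3 : |B| * r < ((-1 : ℝ) ^ s * x) * r := by nlinarith [a.1]
  exact (le_abs_self B).trans (lt_of_mul_lt_mul_right h3 hrp.le).le

theorem jj_pt_cont (s : ℤ) (a b : ℝ) (ha : 0 < a) :
    ContinuousOn (fun t : ℝ => (jc ((s : ℂ) / 2 + t * Complex.I)).re) (Set.Icc a b) := by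
  refine Complex.continuous_re.comp_continuousOn ?_
  refine jc_differentiableOn.continuousOn.comp (by fun_prop) ?_
  intro t ht
  have := (pt s t (ha.trans_le ht.1)).im_pos
  exact this

theorem jc_pt (s : ℤ) (t : ℝ) (ht : 0 < t) : jc ((s : ℂ) / 2 + t * Complex.I) = jj (pt s t ht) := by
  exact jc_coe (pt s t ht)

theorem jj_pt_inv0 (t u : ℝ) (ht : 0 < t) (hu : 0 < u) (h : t * u = 1) :
    jj (pt 0 t ht) = jj (pt 0 u hu) := by
  refine jj_inv ?_
  rw [pt_coe, pt_coe]
  have : (t : ℂ) * u = 1 := by exact_mod_cast h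
  have hu' : (u : ℂ) ≠ 0 := by exact_mod_cast hu.ne'
  have ht' : (t : ℂ) = (u : ℂ)⁻¹ := by field_simp; exact this
  rw [ht']
  simp [mul_inv, mul_comm]

theorem jj_pt_inv1 (t u : ℝ) (ht : 0 < t) (hu : 0 < u) (h : 4 * t * u = 1) :
    jj (pt 1 t ht) = jj (pt 1 u hu) := by
  set τ := pt 1 t ht with hτ
  have hτ0 := τ.ne_zero
  set w := ModularGroup.S • τ with hw
  have hwc : (w : ℂ) = -(τ : ℂ)⁻¹ := S_coe τ
  let w2 : ℍ := ⟨(w : ℂ) + ((2 : ℤ) : ℂ), by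
    have := w.im_pos
    simpa using this⟩
  have hw2 : (w2 : ℂ) = (w : ℂ) + ((2 : ℤ) : ℂ) := rfl
  have h1 : jj w2 = jj τ := (jj_shift 2 rfl).trans (jj_inv hwc)
  set v := ModularGroup.S • w2 with hv
  have hvc : (v : ℂ) = -(w2 : ℂ)⁻¹ := S_coe w2
  rw [← h1, ← jj_inv hvc]
  symm
  refine jj_shift 1 ?_
  have hcast : 4 * (t : ℂ) * u = 1 := by exact_mod_cast h
  have hu' : (u : ℂ) ≠ 0 := by exact_mod_cast hu.ne'
  have ht' : (t : ℂ) ≠ 0 := by exact_mod_cast ht.ne'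
  have hw20 := w2.ne_zero
  have e1 : (w2 : ℂ) * τ = 2 * τ - 1 := by
    rw [hw2, hwc]; field_simp; push_cast; ring
  have e2 : 2 * (τ : ℂ) - 1 = 2 * t * Complex.I := by
    rw [hτ, pt_coe]; push_cast; ring
  have e3 : -(w2 : ℂ)⁻¹ = -(τ : ℂ) / (2 * t * Complex.I) := by
    rw [← e2, ← e1]; field_simp
  rw [hvc, e3, pt_coe, hτ, pt_coe]
  have hI := Complex.I_ne_zero
  field_simp
  push_cast
  linear_combination (-2 : ℂ) * Complex.I_sq + (Complex.I ^ 2) * hcast + 3 * Complex.I_sq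

theorem jj_I : jj (pt 1 (1 / 2) (by norm_num)) = jj (pt 0 1 one_pos) := by
  set τ := pt 1 (1 / 2) (by norm_num) with hτ
  have hτ0 := τ.ne_zero
  set w := ModularGroup.S • τ with hw
  have hwc : (w : ℂ) = -(τ : ℂ)⁻¹ := S_coe τ
  rw [← jj_inv hwc]
  refine jj_shift (-1) ?_
  rw [hwc, neg_eq_iff_eq_neg, inv_eq_iff_eq_inv, eq_comm, inv_eq_iff_eq_inv, eq_comm]
  refine (inv_eq_of_mul_eq_one_left ?_)
  rw [hτ, pt_coe, pt_coe]
  push_cast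
  linear_combination (-1/2 : ℂ) * Complex.I_sq

end EK

end

section
namespace EK
open PowerSeries UpperHalfPlane ModularForm MatrixGroups Filter Topology
open scoped ComplexConjugate

/-- products over conjugate pairs are nonnegative. -/
theorem prod_conj {ι : Type*} [Fintype ι] [DecidableEq ι] (σ : ι → ι) (hσ : Function.Involutive σ)
    (a b : ι) (hab : a ≠ b) (hfix : ∀ c, σ c = c ↔ c = a ∨ c = b) (v : ι → ℂ)
    (hv : ∀ c, v (σ c) = conj (v c)) (hnn : ∃ r : ℝ, 0 ≤ r ∧ v a * v b = r) :
    ∃ r : ℝ, 0 ≤ r ∧ ∏ c, v c = r := by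
  by_cases h0 : ∃ c, v c = 0
  · obtain ⟨c, hc⟩ := h0
    exact ⟨0, le_rfl, by rw [Finset.prod_eq_zero (Finset.mem_univ c) hc]; simp⟩
  push Not at h0
  obtain ⟨r, hr, hr'⟩ := hnn
  set S : Finset ι := (Finset.univ.erase a).erase b with hS
  have hmem : ∀ c, c ∈ S ↔ ¬ σ c = c := by
    intro c
    rw [hfix, hS]; simp [and_comm, not_or]
  have h1 : ∏ c ∈ S, v c / (‖v c‖ : ℂ) = 1 := by
    refine Finset.prod_involution (fun c _ => σ c) ?_ ?_ ?_ ?_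
    · intro c _
      have hn : (‖v c‖ : ℂ) ≠ 0 := by simpa using h0 c
      rw [hv, RCLike.norm_conj, div_mul_div_comm, Complex.mul_conj, Complex.normSq_eq_norm_sq]
      push_cast
      field_simp
    · intro c hc _
      exact (hmem c).1 hc
    · intro c hc
      rw [hmem] at hc ⊢
      intro h; exact hc (hσ.injective h)
    · intro c _; exact hσ c
  have h2 : ∏ c ∈ S, v c = ((∏ c ∈ S, ‖v c‖ : ℝ) : ℂ) := by
    rw [Finset.prod_div_distrib, div_eq_one_iff_eq] at h1
    · rw [h1]; push_cast; rfl
    · rw [Finset.prod_ne_zero_iff]; intro c _; simpa using h0 c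
  refine ⟨r * ∏ c ∈ S, ‖v c‖, mul_nonneg hr (Finset.prod_nonneg fun c _ => norm_nonneg _), ?_⟩
  rw [← Finset.mul_prod_erase Finset.univ v (Finset.mem_univ a),
    ← Finset.mul_prod_erase _ v (Finset.mem_erase.2 ⟨hab.symm, Finset.mem_univ b⟩), ← mul_assoc, hr', h2]
  push_cast; rfl

variable {l : ℕ}

/-- conjugation on the index set -/
noncomputable def cj (l : ℕ) (s : ℤ) : Option (ZMod l) → Option (ZMod l)
  | none => none
  | some i => some (-(s : ZMod l) - i)

theorem cj_cj (s : ℤ) : Function.Involutive (cj l s) := by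
  rintro (_ | i) <;> simp [cj]

theorem jj_cj [hl : Fact l.Prime] (s : ℤ) (t : ℝ) (ht : 0 < t) (c : Option (ZMod l)) :
    jj (mv l (cj l s c) (pt s t ht)) = conj (jj (mv l c (pt s t ht))) := by
  have hl0 : (l : ℂ) ≠ 0 := Nat.cast_ne_zero.2 hl.out.ne_zero
  let τ' : ℍ := ⟨-conj ((mv l c (pt s t ht) : ℍ) : ℂ), by
    have := (mv l c (pt s t ht)).im_pos
    simpa using this⟩
  rw [← jj_conj (τ' := τ') rfl]
  have hτ' : (τ' : ℂ) = -conj ((mv l c (pt s t ht) : ℍ) : ℂ) := rfl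
  have hpc := pt_conj s t ht
  rcases c with _ | i
  · refine jj_shift (l * s) ?_
    rw [hτ']
    simp only [cj, mv_none, map_mul]
    rw [show conj (l : ℂ) = l from map_natCast _ _, ← mul_neg, hpc]
    push_cast; ring
  · obtain ⟨k, hk⟩ : (l : ℤ) ∣ ((-(s : ZMod l) - i).val : ℤ) + s + i.val := by
      rw [← ZMod.intCast_zmod_eq_zero_iff_dvd]
      push_cast
      rw [ZMod.natCast_zmod_val, ZMod.natCast_zmod_val]; ring
    refine jj_shift k ?_
    rw [hτ']
    simp only [cj, mv_some, map_div₀, map_add]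
    rw [show conj (l : ℂ) = l from map_natCast _ _, show conj (i.val : ℂ) = i.val from map_natCast _ _]
    rw [eq_comm] at hk
    have hk' : (l : ℂ) * k = ((-(s : ZMod l) - i).val : ℂ) + s + i.val := by exact_mod_cast hk
    have hpc' : conj ((pt s t ht : ℍ) : ℂ) = -((pt s t ht : ℂ) + ((-s : ℤ) : ℂ)) := by rw [← hpc, neg_neg]
    rw [hpc']
    field_simp
    push_cast
    have hk2 := hk'
    linear_combination -hk2

/-- one direction of sign argument at a point -/
theorem sgn_pt [hl : Fact l.Prime] (hodd : Odd l) (s : ℤ) (hs : s = 0 ∨ s = 1) (B T : ℝ) (hT1 : 1 ≤ T)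
    (hT : ∀ (s : ℤ) (t : ℝ) (ht : 0 < t), T ≤ t → B ≤ (-1 : ℝ) ^ s * (jj (pt s t ht)).re)
    (hlT : 4 * T ^ 2 ≤ l) (y : ℝ) (hy0 : 0 < y) (hy : 1 / 2 ≤ y) (hyT : y ≤ T) (x : ℝ) (hx : |x| ≤ B)
    (hxy : jj (pt s y hy0) = x) :
    ∃ r : ℝ, 0 ≤ r ∧ ∏ c, (jj (pt s y hy0) - jj (mv l c (pt s y hy0))) = r := by
  classical
  have hlpos : (0 : ℝ) < l := Nat.cast_pos.2 hl.out.pos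
  have hl0 : (l : ℂ) ≠ 0 := Nat.cast_ne_zero.2 hl.out.ne_zero
  obtain ⟨m, hm⟩ := hodd
  have h2 : (2 : ZMod l) ≠ 0 := by
    intro h
    have : ((2 : ℕ) : ZMod l) = 0 := by exact_mod_cast h
    rw [ZMod.natCast_eq_zero_iff] at this
    have := Nat.le_of_dvd (by norm_num) this
    have := hl.out.two_le
    omega
  -- the fixed finite index
  obtain ⟨i0, hi0, hi0'⟩ : ∃ i0 : ZMod l, 2 * i0 = -(s : ZMod l) ∧ (2 * (i0.val : ℤ) + s = l * s) := by
    rcases hs with rfl | rfl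
    · exact ⟨0, by simp, by simp⟩
    · refine ⟨(m : ZMod l), ?_, ?_⟩
      · have : ((2 * m + 1 : ℕ) : ZMod l) = 0 := by rw [← hm]; simp
        push_cast at this ⊢
        linear_combination this
      · rw [ZMod.val_natCast, Nat.mod_eq_of_lt (by omega)]
        rw [hm]; push_cast; ring
  have hy1 : 0 < l * y := mul_pos hlpos hy0
  have hy2 : 0 < y / l := div_pos hy0 hlpos
  have p1 : mv l none (pt s y hy0) = pt (l * s) (l * y) hy1 := by
    apply UpperHalfPlane.ext
    rw [mv_none, pt_coe, pt_coe]; push_cast; ring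
  have p2 : mv l (some i0) (pt s y hy0) = pt s (y / l) hy2 := by
    apply UpperHalfPlane.ext
    rw [mv_some, pt_coe, pt_coe]
    have : 2 * (i0.val : ℂ) + s = l * s := by exact_mod_cast hi0'
    push_cast
    field_simp
    linear_combination this
  have hε : (-1 : ℝ) ^ ((l : ℤ) * s) = (-1 : ℝ) ^ s := by
    rw [zpow_mul, zpow_natCast, (show Odd l from ⟨m, hm⟩).neg_one_pow]
  have b1 : B ≤ (-1 : ℝ) ^ s * (jj (mv l none (pt s y hy0))).re := by
    rw [p1, ← hε]
    refine hT _ _ _ ?_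
    nlinarith
  have b2 : B ≤ (-1 : ℝ) ^ s * (jj (mv l (some i0) (pt s y hy0))).re := by
    rw [p2]
    rcases hs with rfl | rfl
    · have hu : 0 < l / y := div_pos hlpos hy0
      rw [jj_pt_inv0 (y / l) (l / y) hy2 hu (by field_simp)]
      refine hT _ _ _ ?_
      rw [le_div_iff₀ hy0]; nlinarith
    · have hu : 0 < l / (4 * y) := by positivity
      rw [jj_pt_inv1 (y / l) (l / (4 * y)) hy2 hu (by field_simp)]
      refine hT _ _ _ ?_
      rw [le_div_iff₀ (by positivity)]; nlinarith
  refine prod_conj (cj l s) (cj_cj s) none (some i0) (by simp) ?_ _ ?_ ?_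
  · rintro (_ | i)
    · simp [cj]
    · simp only [cj, Option.some_inj]
      constructor
      · intro h
        right
        refine mul_left_cancel₀ h2 ?_
        rw [hi0]; linear_combination -h
      · rintro (h | h)
        · cases h
        · rw [h]; linear_combination -hi0
  · intro c
    rw [jj_cj, map_sub, hxy, Complex.conj_ofReal]
  · have r1 := jj_pt_real (l * s) (l * y) hy1
    have r2 := jj_pt_real s (y / l) hy2
    rw [← p1] at r1
    rw [← p2] at r2
    refine ⟨(x - (jj (mv l none (pt s y hy0))).re) * (x - (jj (mv l (some i0) (pt s y hy0))).re), ?_, ?_⟩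
    · have hx' := abs_le.1 hx
      rcases hs with rfl | rfl
      · simp only [zpow_zero, one_mul] at b1 b2
        exact mul_nonneg_of_nonpos_of_nonpos (by linarith) (by linarith)
      · simp only [zpow_one, neg_one_mul] at b1 b2
        exact mul_nonneg (by linarith) (by linarith)
    · rw [hxy]
      push_cast
      rw [r1, r2]

theorem sgn (B : ℝ) : ∃ L : ℕ, ∀ (l : ℕ) [Fact l.Prime], Odd l → L ≤ l → ∀ x : ℝ, |x| ≤ B →
    ∃ τ, jj τ = x ∧ ∃ r : ℝ, 0 ≤ r ∧ ∏ c, (jj τ - jj (mv l c τ)) = r := by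
  obtain ⟨T, hT1, hT⟩ := jj_large B
  obtain ⟨L, hL⟩ := exists_nat_ge (4 * T ^ 2)
  refine ⟨L, fun l hl hodd hLl x hx => ?_⟩
  have hlT : 4 * T ^ 2 ≤ l := hL.trans (Nat.cast_le.2 hLl)
  have hTp : 0 < T := by linarith
  have hx' := abs_le.1 hx
  have key : ∃ s : ℤ, (s = 0 ∨ s = 1) ∧ ∃ y, ∃ hy0 : 0 < y, 1 / 2 ≤ y ∧ y ≤ T ∧ jj (pt s y hy0) = x := by
    rcases le_total (jj (pt 0 1 one_pos)).re x with h | h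
    · have := intermediate_value_Icc hT1 (jj_pt_cont 0 1 T one_pos)
      have hm : x ∈ Set.Icc (jc (((0 : ℤ) : ℂ) / 2 + (1 : ℝ) * Complex.I)).re
          (jc (((0 : ℤ) : ℂ) / 2 + T * Complex.I)).re := by
        rw [jc_pt 0 1 one_pos, jc_pt 0 T hTp]
        refine ⟨h, ?_⟩
        have := hT 0 T hTp le_rfl
        simp only [zpow_zero, one_mul] at this
        linarith
      obtain ⟨y, hy, hxy⟩ := this hm
      have hy0 : 0 < y := by linarith [hy.1]
      refine ⟨0, Or.inl rfl, y, hy0, by linarith [hy.1], hy.2, ?_⟩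
      simp only at hxy
      rw [jc_pt 0 y hy0] at hxy
      rw [← hxy, jj_pt_real]
    · rw [← jj_I] at h
      have := intermediate_value_Icc' (by linarith : (1 / 2 : ℝ) ≤ T) (jj_pt_cont 1 (1 / 2) T (by norm_num))
      have hm : x ∈ Set.Icc (jc (((1 : ℤ) : ℂ) / 2 + T * Complex.I)).re
          (jc (((1 : ℤ) : ℂ) / 2 + (1 / 2 : ℝ) * Complex.I)).re := by
        rw [jc_pt 1 (1 / 2) (by norm_num), jc_pt 1 T hTp]
        refine ⟨?_, h⟩
        have := hT 1 T hTp le_rfl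
        simp only [zpow_one, neg_one_mul] at this
        linarith
      obtain ⟨y, hy, hxy⟩ := this hm
      have hy0 : 0 < y := by linarith [hy.1]
      refine ⟨1, Or.inr rfl, y, hy0, hy.1, hy.2, ?_⟩
      simp only at hxy
      rw [jc_pt 1 y hy0] at hxy
      rw [← hxy, jj_pt_real]
  obtain ⟨s, hs, y, hy0, hy, hyT, hxy⟩ := key
  exact ⟨_, hxy, sgn_pt hodd s hs B T hT1 hT hlT y hy0 hy hyT x hx hxy⟩

end EK

end

section
namespace EK
open Polynomial UpperHalfPlane

theorem sqf_decomp (d : ℕ) : ∀ D : ℤ[X], D.Monic → D.natDegree = d → ∃ G R : ℤ[X], G.Monic ∧ R.Monic ∧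
    D = G * R ^ 2 ∧ ∀ z : ℂ, (G.map (Int.castRingHom ℂ)).rootMultiplicity z ≤ 1 := by
  induction d using Nat.strong_induction_on with
  | _ d ih =>
  intro D hD hd
  by_cases h : ∀ z : ℂ, (D.map (Int.castRingHom ℂ)).rootMultiplicity z ≤ 1
  · exact ⟨D, 1, hD, monic_one, by simp, h⟩
  push Not at h
  obtain ⟨z, hz⟩ := h
  have hDm : (D.map (Int.castRingHom ℂ)) ≠ 0 := (hD.map _).ne_zero
  have hroot : aeval z D = 0 := by
    have := (rootMultiplicity_pos hDm).1 (by omega : 0 < rootMultiplicity z (D.map (Int.castRingHom ℂ)))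
    rw [IsRoot, eval_map] at this
    exact this
  have hIntg : IsIntegral ℤ z := ⟨D, hD, hroot⟩
  obtain ⟨H, hH⟩ := minpoly.isIntegrallyClosed_dvd hIntg hroot
  have hPm : (minpoly ℤ z).Monic := minpoly.monic hIntg
  have hHm : H.Monic := hPm.of_mul_monic_left (hH ▸ hD)
  have hsep : ((minpoly ℤ z).map (Int.castRingHom ℂ)).Separable := by
    have h1 : (minpoly ℚ z).Separable := (minpoly.irreducible (hIntg.tower_top)).separable
    have h2 := h1.map (f := algebraMap ℚ ℂ)
    rw [minpoly.isIntegrallyClosed_eq_field_fractions' ℚ hIntg, Polynomial.map_map] at h2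
    rwa [show (algebraMap ℚ ℂ).comp (algebraMap ℤ ℚ) = Int.castRingHom ℂ from RingHom.ext_int _ _] at h2
  have h1 := rootMultiplicity_le_one_of_separable hsep z
  have hmul : D.map (Int.castRingHom ℂ) = (minpoly ℤ z).map (Int.castRingHom ℂ) * H.map (Int.castRingHom ℂ) := by
    rw [← Polynomial.map_mul, ← hH]
  have h2 : 0 < rootMultiplicity z (H.map (Int.castRingHom ℂ)) := by
    rw [hmul, rootMultiplicity_mul (hmul ▸ hDm)] at hz
    omega
  have hroot2 : aeval z H = 0 := by
    have := (rootMultiplicity_pos (hHm.map _).ne_zero).1 h2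
    rw [IsRoot, eval_map] at this
    exact this
  obtain ⟨H', hH'⟩ := minpoly.isIntegrallyClosed_dvd hIntg hroot2
  have hHm' : H'.Monic := hPm.of_mul_monic_left (hH' ▸ hHm)
  have hpos := minpoly.natDegree_pos hIntg
  have hdeg : H'.natDegree < d := by
    rw [← hd, hH, hH', hPm.natDegree_mul (hPm.mul hHm'), hPm.natDegree_mul hHm']
    omega
  obtain ⟨G, R, hG, hR, hGR, hs⟩ := ih _ hdeg H' hHm' rfl
  refine ⟨G, minpoly ℤ z * R, hG, hPm.mul hR, ?_, hs⟩
  rw [hH, hH', hGR]; ring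

variable {l : ℕ}

theorem exists_G (B : ℝ) : ∃ L : ℕ, ∀ (l : ℕ) [Fact l.Prime], Odd l → L ≤ l → ∃ (G : ℤ[X]) (k : ℕ)
    (T : (ZMod l)[X]), G.Monic ∧ G.natDegree = 2 * k ∧ T.natDegree = k ∧
      G.map (Int.castRingHom (ZMod l)) = T ^ 2 ∧ (∀ x : ℝ, |x| < B → aeval x G ≤ 0) ∧
      ∀ Q : ℤ[X], (∀ τ, (∃ c, fm l 4 e4 c τ = (-(l : ℂ)) ^ 2 * e4 τ ∧ fm l 6 e6 c τ = (-(l : ℂ)) ^ 3 * e6 τ) →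
        aeval (jj τ) Q = 0) → G ∣ Q * (X * (X - 1728)) := by
  obtain ⟨L, hL⟩ := sgn B
  refine ⟨L, fun l hl hodd hLl => ?_⟩
  obtain ⟨D, hDm, hDd, hDl, hDj⟩ := exists_D (l := l) hodd
  obtain ⟨G, R, hG, hR, hGR, hs⟩ := sqf_decomp _ D hDm rfl
  have hdeg : G.natDegree + 2 * R.natDegree = 2 * l := by
    rw [← hDd, hGR, hG.natDegree_mul (hR.pow 2), hR.natDegree_pow]
  have hRl : (R.map (Int.castRingHom (ZMod l))) ≠ 0 := (hR.map _).ne_zero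
  have hsq : ∃ T : (ZMod l)[X], G.map (Int.castRingHom (ZMod l)) = T ^ 2 := by
    have h1 : G.map (Int.castRingHom (ZMod l)) * (R.map (Int.castRingHom (ZMod l))) ^ 2 =
        (X ^ l - X) ^ 2 := by
      rw [← hDl, hGR]; simp
    have h2 : R.map (Int.castRingHom (ZMod l)) ∣ X ^ l - X := by
      refine (IsIntegrallyClosed.pow_dvd_pow_iff two_ne_zero).1 ?_
      exact ⟨_, by rw [← h1]; ring⟩
    obtain ⟨T, hT⟩ := h2
    refine ⟨T, mul_right_cancel₀ (pow_ne_zero 2 hRl) ?_⟩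
    rw [h1, hT]; ring
  obtain ⟨T, hT⟩ := hsq
  refine ⟨G, l - R.natDegree, T, hG, by omega, ?_, hT, ?_, ?_⟩
  · have := congrArg natDegree hT
    rw [hG.natDegree_map, natDegree_pow] at this
    omega
  · intro x hx
    by_contra hpos
    push Not at hpos
    have hR0 : R.map (Int.castRingHom ℝ) ≠ 0 := (hR.map _).ne_zero
    apply hR0
    have hop : IsOpen {x : ℝ | |x| < B ∧ 0 < aeval x G} :=
      (isOpen_lt continuous_abs continuous_const).inter
        (isOpen_lt continuous_const (Polynomial.continuous_aeval G))
    have hinf : {x : ℝ | |x| < B ∧ 0 < aeval x G}.Infinite := by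
      refine infinite_of_mem_nhds x (hop.mem_nhds ⟨hx, hpos⟩)
    refine eq_zero_of_infinite_isRoot _ (hinf.mono ?_)
    rintro y ⟨hy1, hy2⟩
    obtain ⟨τ, hτ, r, hr, hr'⟩ := hL l hodd hLl y hy1.le
    have h1 := hDj τ
    rw [hr', hτ] at h1
    have h2 : aeval y D = -r := by
      have : ((aeval y D : ℝ) : ℂ) = aeval (y : ℂ) D := by
        simp [aeval_def, eval₂_eq_sum, Polynomial.sum]
      rw [h1] at this
      exact_mod_cast this
    rw [hGR, map_mul, map_pow] at h2
    have h3 : aeval y R = 0 := by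
      by_contra h
      have : 0 < aeval y R ^ 2 := by positivity
      nlinarith [mul_pos hy2 this]
    show eval y (R.map _) = 0
    rw [eval_map]
    exact h3
  · intro Q hQ
    rw [← Polynomial.map_dvd_map (Int.castRingHom ℂ) Int.cast_injective hG]
    set G' := G.map (Int.castRingHom ℂ) with hG'
    have hG0 : G' ≠ 0 := (hG.map _).ne_zero
    set Q' := (Q * (X * (X - 1728))).map (Int.castRingHom ℂ) with hQ'
    by_cases hQ0 : Q' = 0
    · rw [hQ0]; exact dvd_zero _
    rw [(IsAlgClosed.splits G').dvd_iff_roots_le_roots hG0 hQ0, Multiset.le_iff_count]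
    intro z
    rw [count_roots, count_roots]
    rcases Nat.lt_or_ge 0 (rootMultiplicity z G') with hz | hz
    · have hz1 : rootMultiplicity z G' = 1 := le_antisymm (hs z) hz
      rw [hz1, Nat.succ_le_iff, rootMultiplicity_pos hQ0]
      obtain ⟨τ, rfl⟩ := jj_surj z
      rw [IsRoot, hQ', eval_map]
      show aeval (jj τ) (Q * (X * (X - 1728))) = 0
      by_cases h0 : jj τ = 0
      · simp [h0]
      by_cases h1 : jj τ = 1728
      · rw [map_mul, map_mul, map_sub, aeval_X, h1, map_ofNat, sub_self, mul_zero, mul_zero]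
      rw [map_mul, hQ τ, zero_mul]
      refine odd_mult hodd hDm.ne_zero hDj τ h0 h1 ?_
      have hprod : D.map (Int.castRingHom ℂ) = G' * (R.map (Int.castRingHom ℂ)) ^ 2 := by
        rw [hGR]; simp [hG']
      have hne : G' * (R.map (Int.castRingHom ℂ)) ^ 2 ≠ 0 := hprod ▸ (hDm.map _).ne_zero
      have hR0 : (R.map (Int.castRingHom ℂ)) ≠ 0 := (hR.map _).ne_zero
      rw [hprod, rootMultiplicity_mul hne, hz1, pow_two, rootMultiplicity_mul (mul_ne_zero hR0 hR0)]
      exact ⟨rootMultiplicity (jj τ) (R.map (Int.castRingHom ℂ)), by ring⟩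
    · omega

/-- choice of `l`. -/
theorem exists_l (M L : ℕ) : ∃ l : ℕ, l.Prime ∧ L ≤ l ∧ M < l ∧ l % 8 = 7 ∧
    ∀ p : ℕ, p.Prime → p ≤ M → (l : ZMod p) = -1 := by
  obtain ⟨l, h1, h2, h3⟩ := Nat.forall_exists_prime_gt_and_zmodEq (max L M) (q := 8 * M.factorial) (a := -1)
    (by positivity) (by rw [IsCoprime.neg_left_iff]; exact isCoprime_one_left)
  have hd : ((8 * M.factorial : ℕ) : ℤ) ∣ (-1) - l := h3.dvd
  refine ⟨l, h2, (le_max_left _ _).trans h1.le, (le_max_right _ _).trans_lt h1, ?_, ?_⟩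
  · have : (8 : ℤ) ∣ (-1) - l := (Dvd.intro _ (by push_cast; rfl)).trans hd
    omega
  · intro p hp hpM
    have h4 : (p : ℤ) ∣ (-1) - l :=
      (Int.natCast_dvd_natCast.2 (((Nat.dvd_factorial hp.pos hpM)).mul_left 8)).trans hd
    have := (ZMod.intCast_zmod_eq_zero_iff_dvd _ p).2 h4
    push_cast at this
    linear_combination -this

theorem leg_small {l : ℕ} [hl : Fact l.Prime] (hl8 : l % 8 = 7) (p : ℕ) [hp : Fact p.Prime]
    (h : (l : ZMod p) = -1) (hpl : p ≠ l) : legendreSym l p = 1 := by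
  have hl2 : l ≠ 2 := by omega
  by_cases hp2 : p = 2
  · subst hp2
    have h0 : ((2 : ℤ) : ZMod l) ≠ 0 := by
      intro h0
      have : ((2 : ℕ) : ZMod l) = 0 := by exact_mod_cast h0
      rw [ZMod.natCast_eq_zero_iff] at this
      have := Nat.le_of_dvd (by norm_num) this
      have := hl.out.two_le
      omega
    rw [show ((2 : ℕ) : ℤ) = 2 by rfl, legendreSym.eq_one_iff l h0]
    exact_mod_cast (ZMod.exists_sq_eq_two_iff hl2).2 (Or.inr hl8)
  have e1 : legendreSym p l = legendreSym p (-1) := by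
    unfold legendreSym
    congr 1
    push_cast; exact h
  have hodd := hp.out.eq_two_or_odd.resolve_left hp2
  rcases (by omega : p % 4 = 1 ∨ p % 4 = 3) with h4 | h4
  · rw [legendreSym.quadratic_reciprocity_one_mod_four h4 hl2, e1, legendreSym.at_neg_one hp2,
      ZMod.χ₄_nat_one_mod_four h4]
  · rw [legendreSym.quadratic_reciprocity_three_mod_four h4 (by omega), e1, legendreSym.at_neg_one hp2,
      ZMod.χ₄_nat_three_mod_four h4]
    norm_num

theorem leg_big {l : ℕ} [hl : Fact l.Prime] (hl8 : l % 8 = 7) (p : ℕ) [hp : Fact p.Prime]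
    (hp2 : p ≠ 2) (h : legendreSym l p = -1) : legendreSym p (-l) = -1 := by
  have hl2 : l ≠ 2 := by omega
  have hodd := hp.out.eq_two_or_odd.resolve_left hp2
  rw [legendreSym.at_neg hp2]
  rcases (by omega : p % 4 = 1 ∨ p % 4 = 3) with h4 | h4
  · rw [ZMod.χ₄_nat_one_mod_four h4, ← legendreSym.quadratic_reciprocity_one_mod_four h4 hl2, h]; norm_num
  · rw [ZMod.χ₄_nat_three_mod_four h4, 
      legendreSym.quadratic_reciprocity_three_mod_four (by omega : l % 4 = 3) h4, h]; norm_num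

/-- a natural number with all prime factors residues is a residue -/
theorem leg_nat {l : ℕ} [hl : Fact l.Prime] (N : ℕ) (hN : N ≠ 0) (h : ∀ p : ℕ, p.Prime → p ∣ N → legendreSym l p = 1) :
    legendreSym l N = 1 := by
  induction N using Nat.recOnMul with
  | zero => exact absurd rfl hN
  | one => simp
  | prime p hp => exact h p hp dvd_rfl
  | mul a b ha hb =>
    have ha0 : a ≠ 0 := left_ne_zero_of_mul hN
    have hb0 : b ≠ 0 := right_ne_zero_of_mul hN
    push_cast
    rw [legendreSym.mul, ha ha0 fun p hp hd => h p hp (hd.mul_right _),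
      hb hb0 fun p hp hd => h p hp (hd.mul_left _), one_mul]

end EK

end

section
namespace EK
open Polynomial UpperHalfPlane

theorem cast_ne {p : ℕ} {K : Type*} [Field K] [CharP K p] {M : ℕ} (hM : M < p) (z : ℤ) (hz : z ≠ 0)
    (hzM : z.natAbs ≤ M) : (z : K) ≠ 0 := by
  intro h
  rw [CharP.intCast_eq_zero_iff K p] at h
  have := Int.natAbs_dvd_natAbs.2 h
  have := Nat.le_of_dvd (Int.natAbs_pos.2 hz) this
  simp at this
  omega

theorem elkies_core {l : ℕ} [hl : Fact l.Prime] (n0 m0 : ℤ) (hm0 : m0 ≠ 0) (hn0 : n0 ≠ 0)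
    (hn1 : n0 - 1728 * m0 ≠ 0) (M : ℕ) (hM1 : m0.natAbs ≤ M) (hM2 : n0.natAbs ≤ M)
    (hM3 : (n0 - 1728 * m0).natAbs ≤ M) (hM4 : 1728 ≤ M) (G : ℤ[X]) (k : ℕ) (hGd : G.natDegree = 2 * k)
    (hG : ∀ Q : ℤ[X], (∀ τ, (∃ c, fm l 4 e4 c τ = (-(l : ℂ)) ^ 2 * e4 τ ∧ fm l 6 e6 c τ = (-(l : ℂ)) ^ 3 * e6 τ) →
        aeval (jj τ) Q = 0) → G ∣ Q * (X * (X - 1728)))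
    (p n : ℕ) (hp : p.Prime) (hMp : M < p) (hpn : p = 2 * n + 1)
    (hpl : p = l ∨ (-(l : ZMod p)) ^ n = -1) (hpN : (p : ℤ) ∣ hom (2 * k) G n0 m0)
    (K : Type) [Field K] [CharP K p] (a b : K) (hab : 4 * a ^ 3 + 27 * b ^ 2 ≠ 0)
    (hj : (m0 : K) * (1728 * (4 * a ^ 3)) = n0 * (4 * a ^ 3 + 27 * b ^ 2)) : EK.hp n a b = 0 := by
  have hpf : Fact p.Prime := ⟨hp⟩
  obtain ⟨α, β, γ, habc, -, -⟩ := exists_abc n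
  obtain ⟨QF, hdeg, hQF⟩ := exists_QF n α β γ habc
  have hPD : PD ≠ 0 := by
    intro h; have := coeff_one_PD; rw [h] at this; simp at this
  have hq := hQF (PowerSeries ℤ) P4 P6 PD hPD (by
      have := PD_eq
      rwa [show (PowerSeries.C (1728 : ℤ)) = (1728 : PowerSeries ℤ) from map_ofNat _ 1728] at this)
  rw [Subsingleton.elim (Ring.toIntAlgebra (PowerSeries ℤ)) MvPowerSeries.instAlgebra] at hq
  obtain ⟨Q, w, hw, hQw, hQ⟩ := exists_e (l := l) p n hpn (by omega) α β γ habc QF hdeg hq hpl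
  obtain ⟨H, hH⟩ := hG Q fun τ ⟨c, h4, h6⟩ => hQ τ ⟨c, hf_isog n c τ h4 h6⟩
  have hm0p : (m0 : ZMod p) ≠ 0 := cast_ne hMp m0 hm0 hM1
  have hn0p : (n0 : ZMod p) ≠ 0 := cast_ne hMp n0 hn0 hM2
  have hn1p : ((n0 - 1728 * m0 : ℤ) : ZMod p) ≠ 0 := cast_ne hMp _ hn1 hM3
  set j : ZMod p := n0 / m0 with hjdef
  have hGj : aeval j G = 0 := by
    have h1 := (ZMod.intCast_zmod_eq_zero_iff_dvd _ p).2 hpN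
    have h2 := map_hom (Int.castRingHom (ZMod p)) (fun a => by simp) (2 * k) G n0 m0
    rw [eq_intCast, h1, eq_intCast, eq_intCast, hom_field _ _ hGd.le _ _ hm0p] at h2
    exact (mul_eq_zero.1 h2.symm).resolve_left (pow_ne_zero _ hm0p)
  have hQj : aeval j Q = 0 := by
    have h1 := congrArg (aeval j) hH
    rw [map_mul, map_mul, map_mul, map_sub, aeval_X, hGj, zero_mul, map_ofNat] at h1
    refine (mul_eq_zero.1 h1).resolve_right (mul_ne_zero ?_ ?_)
    · exact div_ne_zero hn0p hm0p
    · intro h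
      apply hn1p
      push_cast
      rw [hjdef, sub_eq_zero, div_eq_iff hm0p] at h
      rw [h]; ring
  have hFj : aeval j QF = 0 := by
    have h1 := congrArg (eval j) hQw
    rw [eval_mul, eval_pow, eval_C, eval_map, eval_map] at h1
    have h2 : eval₂ (Int.castRingHom (ZMod p)) j Q = 0 := hQj
    rw [h2] at h1
    exact eq_zero_of_pow_eq_zero ((mul_eq_zero.1 h1.symm).resolve_left hw)
  have hc : ∀ z : ℤ, z ≠ 0 → z.natAbs ≤ M → (z : K) ≠ 0 := fun z h1 h2 => cast_ne hMp z h1 h2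
  have h27 : (27 : K) ≠ 0 := by exact_mod_cast hc 27 (by norm_num) (by omega)
  have h54 : (54 : K) ≠ 0 := by exact_mod_cast hc 54 (by norm_num) (by omega)
  have h1728 : (1728 : K) ≠ 0 := by exact_mod_cast hc 1728 (by norm_num) (by omega)
  have h4 : (4 : K) ≠ 0 := by exact_mod_cast hc 4 (by norm_num) (by omega)
  have hm0K := hc m0 hm0 hM1
  have hn0K := hc n0 hn0 hM2
  have hn1K := hc _ hn1 hM3
  obtain ⟨c4, rfl⟩ : ∃ c4, a = -27 * c4 := ⟨-a / 27, by field_simp⟩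
  obtain ⟨c6, rfl⟩ : ∃ c6, b = -54 * c6 := ⟨-b / 54, by field_simp⟩
  obtain ⟨Δ, hΔ⟩ : ∃ Δ, 1728 * Δ = c4 ^ 3 - c6 ^ 2 := ⟨(c4 ^ 3 - c6 ^ 2) / 1728, by field_simp⟩
  have hd : 4 * (-27 * c4) ^ 3 + 27 * (-54 * c6) ^ 2 = -(4 * 27 ^ 3 * 1728) * Δ := by
    linear_combination (4 * 27 ^ 3) * hΔ
  rw [hd] at hab hj
  have hΔ0 : Δ ≠ 0 := right_ne_zero_of_mul hab
  have hrel : m0 * c4 ^ 3 = n0 * Δ := by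
    refine mul_left_cancel₀ (mul_ne_zero (mul_ne_zero h4 (pow_ne_zero 3 h27)) h1728) ?_
    linear_combination -hj
  have h1 := hQF K c4 c6 Δ hΔ0 hΔ
  have hjK : c4 ^ 3 / Δ = ZMod.castHom (dvd_refl p) K j := by
    rw [hjdef, map_div₀, map_intCast, map_intCast, div_eq_div_iff hΔ0 hm0K]
    linear_combination hrel
  have hz : aeval (c4 ^ 3 / Δ) QF = 0 := by
    rw [hjK]
    have := congrArg (ZMod.castHom (dvd_refl p) K) hFj
    rw [map_zero, aeval_def, hom_eval₂] at this
    rw [aeval_def]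
    convert this using 2
    exact (RingHom.ext_int _ _)
  rw [hom_field _ _ hdeg _ _ hΔ0, hz, mul_zero] at h1
  have hc4 : c4 ≠ 0 := by
    rintro rfl
    exact mul_ne_zero hn0K hΔ0 (by rw [← hrel]; ring)
  have hc6 : c6 ≠ 0 := by
    rintro rfl
    refine mul_ne_zero hn1K hΔ0 ?_
    push_cast
    linear_combination -hrel - m0 * hΔ
  exact (mul_eq_zero.1 h1).resolve_right (mul_ne_zero (pow_ne_zero _ hc4) (pow_ne_zero _ hc6))

theorem elkies_gen (n0 m0 : ℤ) (hm0 : m0 ≠ 0) (hn0 : n0 ≠ 0) (hn1 : n0 - 1728 * m0 ≠ 0) (M0 : ℕ) :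
    ∃ p n : ℕ, p.Prime ∧ M0 < p ∧ p = 2 * n + 1 ∧ ∀ (K : Type) [Field K] [CharP K p] (a b : K),
      4 * a ^ 3 + 27 * b ^ 2 ≠ 0 →
      (m0 : K) * (1728 * (4 * a ^ 3)) = n0 * (4 * a ^ 3 + 27 * b ^ 2) → hp n a b = 0 := by
  obtain ⟨M, hM0, hM1, hM2, hM3, hM4⟩ : ∃ M, M0 ≤ M ∧ m0.natAbs ≤ M ∧ n0.natAbs ≤ M ∧
      (n0 - 1728 * m0).natAbs ≤ M ∧ 1728 ≤ M :=
    ⟨M0 + m0.natAbs + n0.natAbs + (n0 - 1728 * m0).natAbs + 1728, by omega, by omega, by omega, by omega,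
      by omega⟩
  obtain ⟨L, hL⟩ := exists_G (|(n0 : ℝ) / m0| + 1)
  obtain ⟨l, hlp, hLl, hMl, hl8, hlM⟩ := exists_l M L
  have hl : Fact l.Prime := ⟨hlp⟩
  have hodd : Odd l := Nat.odd_iff.2 (by omega)
  obtain ⟨G, k, T, hGm, hGd, hTd, hGT, hGx, hGQ⟩ := hL l hodd hLl
  set N : ℤ := hom (2 * k) G n0 m0 with hN
  have core := elkies_core (l := l) n0 m0 hm0 hn0 hn1 M hM1 hM2 hM3 hM4 G k hGd hGQ
  by_cases hlN : (l : ℤ) ∣ N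
  · exact ⟨l, (l - 1) / 2, hlp, by omega, by omega, fun K _ _ a b hab hj =>
      core l ((l - 1) / 2) hlp hMl (by omega) (Or.inl rfl) hlN K a b hab hj⟩
  have hNl : (N : ZMod l) ≠ 0 := by
    rwa [Ne, ZMod.intCast_zmod_eq_zero_iff_dvd]
  have hN0 : N ≠ 0 := by rintro h; simp [h] at hlN
  -- sign
  have hneg : N < 0 := by
    refine lt_of_le_of_ne ?_ hN0
    have hmR : (m0 : ℝ) ≠ 0 := Int.cast_ne_zero.2 hm0
    have h2 := map_hom (Int.castRingHom ℝ) (fun a => by simp) (2 * k) G n0 m0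
    rw [← hN, eq_intCast, eq_intCast, eq_intCast, hom_field _ _ hGd.le _ _ hmR] at h2
    have h3 := hGx ((n0 : ℝ) / m0) (by linarith)
    have h4 : (N : ℝ) ≤ 0 := by
      rw [h2]
      exact mul_nonpos_of_nonneg_of_nonpos (by rw [pow_mul]; positivity) h3
    exact_mod_cast h4
  -- square mod l
  have hsq : legendreSym l N = 1 := by
    rw [legendreSym.eq_one_iff l hNl]
    have hmp : (m0 : ZMod l) ≠ 0 := cast_ne hMl m0 hm0 hM1
    have h2 := map_hom (Int.castRingHom (ZMod l)) (fun a => by simp) (2 * k) G n0 m0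
    rw [← hN, eq_intCast, eq_intCast, eq_intCast, hom_field _ _ hGd.le _ _ hmp] at h2
    have h3 : aeval ((n0 : ZMod l) / m0) G = (eval ((n0 : ZMod l) / m0) T) ^ 2 := by
      rw [← eval_pow, ← hGT, eval_map]; rfl
    rw [h2, h3, mul_comm 2 k, pow_mul, ← mul_pow]
    exact ⟨_, pow_two _⟩
  have hl4 : legendreSym l (-1) = -1 := by
    rw [legendreSym.at_neg_one (by omega), ZMod.χ₄_nat_three_mod_four (by omega)]
  obtain ⟨p, hp, hpN, hpl⟩ : ∃ p : ℕ, p.Prime ∧ p ∣ N.natAbs ∧ legendreSym l p ≠ 1 := by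
    by_contra hcon
    push Not at hcon
    have h1 := leg_nat (l := l) N.natAbs (by simpa using hN0) hcon
    have h2 : N = -1 * (N.natAbs : ℤ) := by omega
    rw [h2, legendreSym.mul, h1, hl4] at hsq
    norm_num at hsq
  have hpf : Fact p.Prime := ⟨hp⟩
  have hpl' : p ≠ l := by
    rintro rfl
    exact hlN (Int.natCast_dvd.2 hpN)
  have hpM : M < p := by
    by_contra h
    exact hpl (leg_small hl8 p (hlM p hp (by omega)) hpl')
  have hp2 : p ≠ 2 := by omega
  have hodd' := hp.eq_two_or_odd.resolve_left hp2
  have hp0 : ((p : ℤ) : ZMod l) ≠ 0 := by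
    intro h
    rw [ZMod.intCast_zmod_eq_zero_iff_dvd, Int.natCast_dvd_natCast] at h
    exact hpl' ((Nat.prime_dvd_prime_iff_eq hlp hp).1 h).symm
  have hleg : legendreSym l p = -1 := (legendreSym.eq_one_or_neg_one l hp0).resolve_left hpl
  have h5 := legendreSym.eq_pow p (-l)
  rw [leg_big hl8 p hp2 hleg] at h5
  refine ⟨p, p / 2, hp, by omega, by omega, fun K _ _ a b hab hj =>
      core p (p / 2) hp hpM (by omega) (Or.inr ?_) (Int.natCast_dvd.2 hpN) K a b hab hj⟩
  push_cast at h5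
  exact h5.symm

theorem hp_b0 {R : Type*} [CommRing R] (n : ℕ) (hn : Odd n) (a : R) : hp n a 0 = 0 := by
  unfold hp
  have : (X ^ 3 + C a * X + C 0 : R[X]) ^ n = (expand R 2 (X + C a)) ^ n * X ^ n := by
    rw [← mul_pow]; simp; ring
  rw [this, two_mul, coeff_mul_X_pow, ← map_pow, coeff_expand (by norm_num), if_neg]
  rw [← even_iff_two_dvd]
  exact Nat.not_even_iff_odd.2 hn

theorem hp_a0 {R : Type*} [CommRing R] (n : ℕ) (hn : ¬ 3 ∣ n) (b : R) : hp n 0 b = 0 := by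
  unfold hp
  have : (X ^ 3 + C 0 * X + C b : R[X]) ^ n = expand R 3 ((X + C b) ^ n) := by
    simp
  rw [this, coeff_expand (by norm_num), if_neg]
  intro h
  exact hn ((Nat.Coprime.dvd_mul_left (by norm_num)).1 h)

/-- Supersingular primes exist beyond any bound. -/
theorem elkies (n0 m0 : ℤ) (hm0 : m0 ≠ 0) (M0 : ℕ) :
    ∃ p n : ℕ, p.Prime ∧ M0 < p ∧ p = 2 * n + 1 ∧ ∀ (K : Type) [Field K] [CharP K p] (a b : K),
      4 * a ^ 3 + 27 * b ^ 2 ≠ 0 →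
      (m0 : K) * (1728 * (4 * a ^ 3)) = n0 * (4 * a ^ 3 + 27 * b ^ 2) → hp n a b = 0 := by
  by_cases hn0 : n0 = 0
  · obtain ⟨p, h1, h2, h3⟩ := Nat.forall_exists_prime_gt_and_modEq (M0 + m0.natAbs + 1728) (q := 3) (a := 2)
      (by norm_num) (by norm_num)
    have hodd := h2.eq_two_or_odd.resolve_left (by omega)
    have h3' : p % 3 = 2 := h3
    refine ⟨p, p / 2, h2, by omega, by omega, fun K _ _ a b hab hj => ?_⟩
    have hc : ∀ z : ℤ, z ≠ 0 → z.natAbs ≤ M0 + m0.natAbs + 1728 → (z : K) ≠ 0 := fun z e1 e2 => cast_ne h1 z e1 e2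
    have e1 : (1728 : K) ≠ 0 := by exact_mod_cast hc 1728 (by norm_num) (by omega)
    have e2 : (4 : K) ≠ 0 := by exact_mod_cast hc 4 (by norm_num) (by omega)
    have e3 := hc m0 hm0 (by omega)
    have ha : a = 0 := by
      rw [hn0, Int.cast_zero, zero_mul] at hj
      simpa [e1, e2, e3] using hj
    rw [ha]
    exact hp_a0 _ (by omega) _
  by_cases hn1 : n0 - 1728 * m0 = 0
  · obtain ⟨p, h1, h2, h3⟩ := Nat.forall_exists_prime_gt_and_modEq (M0 + n0.natAbs + 1728) (q := 4) (a := 3)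
      (by norm_num) (by norm_num)
    have hodd := h2.eq_two_or_odd.resolve_left (by omega)
    have h3' : p % 4 = 3 := h3
    refine ⟨p, p / 2, h2, by omega, by omega, fun K _ _ a b hab hj => ?_⟩
    have hc : ∀ z : ℤ, z ≠ 0 → z.natAbs ≤ M0 + n0.natAbs + 1728 → (z : K) ≠ 0 := fun z e1 e2 => cast_ne h1 z e1 e2
    have e1 : (27 : K) ≠ 0 := by exact_mod_cast hc 27 (by norm_num) (by omega)
    have e3 := hc n0 hn0 (by omega)
    have hb : b = 0 := by
      have e4 : (n0 : K) = 1728 * m0 := by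
        have : n0 = 1728 * m0 := by omega
        rw [this]; push_cast; rfl
      have : (n0 : K) * 27 * b ^ 2 = 0 := by rw [e4] at hj ⊢; linear_combination -hj
      simpa [e1, e3] using this
    rw [hb]
    exact hp_b0 _ (Nat.odd_iff.2 (by omega)) _
  exact elkies_gen n0 m0 hm0 hn0 hn1 M0
end EK

end

section
namespace EK
open MvPolynomial

section Tr
variable (p : ℕ) [hpf : Fact p.Prime] (K : Type*) [Field K] [CharP K p] [PerfectRing K p]

/-- the top exponent `(p-1,p-1,p-1)`. -/
noncomputable def tope : Fin 3 →₀ ℕ := Finsupp.equivFunOnFinite.symm fun _ => p - 1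

@[simp] theorem tope_apply (i : Fin 3) : tope p i = p - 1 := rfl

theorem iota_inj : Function.Injective fun a : Fin 3 →₀ ℕ => p • a + tope p := by
  intro a b h
  have h1 : p • a = p • b := add_right_cancel h
  ext i
  have := DFunLike.congr_fun h1 i
  simpa [hpf.out.ne_zero] using this

/-- the trace map. -/
noncomputable def tr : MvPolynomial (Fin 3) K →+ MvPolynomial (Fin 3) K where
  toFun s := ⟨Finsupp.mapRange (frobeniusEquiv K p).symm (map_zero _)
    (Finsupp.comapDomain (fun a : Fin 3 →₀ ℕ => p • a + tope p) (AddMonoidAlgebra.coeff s)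
      ((iota_inj p).injOn))⟩
  map_zero' := by
    ext a
    show (frobeniusEquiv K p).symm (coeff (p • a + tope p) (0 : MvPolynomial (Fin 3) K)) =
      coeff a (0 : MvPolynomial (Fin 3) K)
    rw [coeff_zero, coeff_zero, map_zero]
  map_add' s t := by
    ext a
    rw [coeff_add]
    show (frobeniusEquiv K p).symm (coeff (p • a + tope p) (s + t)) =
      (frobeniusEquiv K p).symm (coeff (p • a + tope p) s) + (frobeniusEquiv K p).symm (coeff (p • a + tope p) t)
    simp

theorem coeff_tr (s : MvPolynomial (Fin 3) K) (a : Fin 3 →₀ ℕ) :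
    coeff a (tr p K s) = (frobeniusEquiv K p).symm (coeff (p • a + tope p) s) := rfl

theorem iota_le (u a : Fin 3 →₀ ℕ) : p • u ≤ p • a + tope p ↔ u ≤ a := by
  have hp := hpf.out.pos
  rw [Finsupp.le_def, Finsupp.le_def]
  refine forall_congr' fun i => ?_
  simp only [Finsupp.smul_apply, Finsupp.add_apply, tope_apply, smul_eq_mul]
  constructor
  · intro h
    have : p * u i < p * (a i + 1) := by rw [mul_add]; omega
    have := Nat.lt_of_mul_lt_mul_left this
    omega
  · intro h
    have := Nat.mul_le_mul_left p h
    omega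

theorem tr_pow_mul (r s : MvPolynomial (Fin 3) K) : tr p K (r ^ p * s) = r * tr p K s := by
  induction r using MvPolynomial.induction_on' with
  | add r1 r2 h1 h2 => rw [add_pow_char, add_mul, map_add, h1, h2, add_mul]
  | monomial u c =>
    ext a
    rw [coeff_tr, monomial_pow, coeff_monomial_mul', coeff_monomial_mul', coeff_tr]
    by_cases h : u ≤ a
    · rw [if_pos h, if_pos ((iota_le p u a).2 h), map_mul, frobeniusEquiv_symm_pow]
      congr 3
      obtain ⟨b, rfl⟩ := exists_add_of_le h
      rw [smul_add, add_assoc, add_tsub_cancel_left, add_tsub_cancel_left]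
    · rw [if_neg h, if_neg (fun h' => h ((iota_le p u a).1 h')), map_zero]

theorem mono_split (u : Fin 3 →₀ ℕ) (c : K) : ∃ v b : Fin 3 →₀ ℕ, (∀ i, b i < p) ∧
    monomial u c = (monomial v ((frobeniusEquiv K p).symm c)) ^ p * monomial b 1 := by
  refine ⟨u.mapRange (· / p) (Nat.zero_div p), u.mapRange (· % p) (Nat.zero_mod p), fun i => ?_, ?_⟩
  · rw [Finsupp.mapRange_apply]
    exact Nat.mod_lt _ hpf.out.pos
  · rw [monomial_pow, monomial_mul, frobeniusEquiv_symm_pow_p, mul_one]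
    congr 2
    ext i
    simp [Nat.div_add_mod]

/-- additive maps that are `p⁻¹`-linear and agree on small monomials agree. -/
theorem frob_ext {R : Type*} [CommRing R] (π : MvPolynomial (Fin 3) K →+* R)
    (A B : MvPolynomial (Fin 3) K → R) (hAa : ∀ r s, A (r + s) = A r + A s)
    (hBa : ∀ r s, B (r + s) = B r + B s) (hA : ∀ r s, A (r ^ p * s) = π r * A s)
    (hB : ∀ r s, B (r ^ p * s) = π r * B s)
    (h : ∀ b : Fin 3 →₀ ℕ, (∀ i, b i < p) → A (monomial b 1) = B (monomial b 1)) (s) : A s = B s := by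
  induction s using MvPolynomial.induction_on' with
  | add r1 r2 h1 h2 => rw [hAa, hBa, h1, h2]
  | monomial u c =>
    obtain ⟨v, b, hb, e⟩ := mono_split p K u c
    rw [e, hA, hB, h b hb]

/-- box of small exponents -/
noncomputable def box : Finset (Fin 3 →₀ ℕ) := Finset.Iic (tope p)

theorem mem_box (b : Fin 3 →₀ ℕ) : b ∈ box p ↔ ∀ i, b i < p := by
  have hp := hpf.out.pos
  unfold box
  rw [Finset.mem_Iic, Finsupp.le_def]
  refine forall_congr' fun i => ?_
  rw [tope_apply]; omega

theorem tr_delta (a b : Fin 3 →₀ ℕ) (ha : a ∈ box p) (hb : b ∈ box p) :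
    tr p K (monomial (tope p - a) 1 * monomial b 1) = if a = b then 1 else 0 := by
  have hp := hpf.out.pos
  rw [mem_box] at ha hb
  rw [monomial_mul, mul_one]
  ext e
  rw [coeff_tr, coeff_monomial]
  split_ifs with h1 h2 h2
  · have : e = 0 := by
      ext i
      have h3 := DFunLike.congr_fun h1 i
      simp [h2] at h3
      have := hb i
      rcases Nat.eq_zero_or_pos (e i) with h | h
      · simpa using h
      · have := Nat.le_mul_of_pos_right p h
        omega
    simp [this]
  · exfalso
    apply h2
    ext i
    have h3 := DFunLike.congr_fun h1 i
    simp at h3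
    have := ha i
    have := hb i
    rcases Nat.eq_zero_or_pos (e i) with h | h
    · rw [h] at h3; omega
    · have := Nat.le_mul_of_pos_right p h
      omega
  · have : e ≠ 0 := by
      rintro rfl
      apply h1
      ext i
      have := hb i
      simp [h2]
      omega
    rw [map_zero]
    simp [coeff_one, this.symm]
  · simp

theorem sum_tr (s : MvPolynomial (Fin 3) K) :
    s = ∑ b ∈ box p, (tr p K (s * monomial (tope p - b) 1)) ^ p * monomial b 1 := by
  induction s using MvPolynomial.induction_on' with
  | add r1 r2 h1 h2 =>
    conv_lhs => rw [h1, h2]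
    rw [← Finset.sum_add_distrib]
    refine Finset.sum_congr rfl fun b _ => ?_
    rw [add_mul, map_add, add_pow_char, add_mul]
  | monomial u c =>
    have hp := hpf.out.pos
    obtain ⟨v, b0, hb, e⟩ := mono_split p K u c
    have hb0 : b0 ∈ box p := (mem_box p b0).2 hb
    rw [e, Finset.sum_eq_single b0]
    · rw [mul_assoc, tr_pow_mul, mul_comm (monomial b0 1), tr_delta p K b0 b0 hb0 hb0, if_pos rfl, mul_one]
    · intro b hb hne
      rw [mul_assoc, tr_pow_mul, mul_comm (monomial b0 1), tr_delta p K b b0 hb hb0, if_neg hne, mul_zero,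
        zero_pow hpf.out.ne_zero, zero_mul]
    · intro h; exact absurd hb0 h

theorem exists_lift {R : Type*} [CommRing R] (π : MvPolynomial (Fin 3) K →+* R)
    (hsur : Function.Surjective π) (φ : R →+ R) (hφ : ∀ r s : R, φ (r ^ p * s) = r * φ s) :
    ∃ g, ∀ s, π (tr p K (g * s)) = φ (π s) := by
  choose u hu using fun b : Fin 3 →₀ ℕ => hsur (φ (π (monomial b 1)))
  set g := ∑ a ∈ box p, (u a) ^ p * monomial (tope p - a) 1 with hg
  refine ⟨g, frob_ext p K π (fun s => π (tr p K (g * s))) (fun s => φ (π s)) ?_ ?_ ?_ ?_ ?_⟩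
  · intro r s
    rw [mul_add, map_add, map_add]
  · intro r s
    rw [map_add, map_add]
  · intro r s
    rw [mul_left_comm, tr_pow_mul, map_mul]
  · intro r s
    rw [map_mul, map_pow, hφ]
  · intro b hb
    rw [← hu b]
    congr 1
    rw [hg, Finset.sum_mul, map_sum, Finset.sum_eq_single b]
    · rw [mul_assoc, tr_pow_mul, tr_delta p _ b b ((mem_box p b).2 hb) ((mem_box p b).2 hb), if_pos rfl, mul_one]
    · intro a ha hne
      rw [mul_assoc, tr_pow_mul, tr_delta p _ a b ha ((mem_box p b).2 hb), if_neg hne, mul_zero]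
    · intro h; exact absurd ((mem_box p b).2 hb) h

end Tr

/-- `F ∈ m^[p]` -/
def InFrob {K : Type*} [CommSemiring K] (p : ℕ) (F : MvPolynomial (Fin 3) K) : Prop :=
  ∀ e, (∀ i, e i < p) → coeff e F = 0

theorem not_split (p : ℕ) [hpf : Fact p.Prime] (f : MvPolynomial (Fin 3) (ZMod p)) (hf0 : f ≠ 0)
    (hfc : coeff 0 f = 0) (hfr : InFrob p (f ^ (p - 1))) :
    ¬ IsFSplit p (MvPolynomial (Fin 3) (ZMod p) ⧸ Ideal.span {f}) := by
  rintro ⟨φ, hφ, hφ1⟩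
  have hp := hpf.out.pos
  set π := Ideal.Quotient.mk (Ideal.span {f}) with hπ
  have hsur : Function.Surjective π := Ideal.Quotient.mk_surjective
  obtain ⟨g, key'⟩ := exists_lift p (ZMod p) π hsur φ hφ
  have hdiv : ∀ s, f ∣ tr p (ZMod p) (g * (f * s)) := by
    intro s
    rw [← Ideal.mem_span_singleton, ← Ideal.Quotient.eq_zero_iff_mem, ← hπ, key', map_mul]
    have : π f = 0 := Ideal.Quotient.eq_zero_iff_mem.2 (Ideal.mem_span_singleton_self f)
    rw [this, zero_mul, map_zero]
  have hgf : f ^ p ∣ g * f := by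
    rw [sum_tr p (ZMod p) (g * f)]
    refine Finset.dvd_sum fun b _ => Dvd.dvd.mul_right (pow_dvd_pow_of_dvd ?_ p) _
    rw [mul_assoc]
    exact hdiv _
  obtain ⟨h, hh⟩ := hgf
  have hgh : g = f ^ (p - 1) * h := by
    apply mul_right_cancel₀ hf0
    rw [hh, mul_right_comm, pow_sub_one_mul hpf.out.ne_zero]
  have h1 := key' 1
  rw [map_one, hφ1, mul_one, ← map_one π, ← sub_eq_zero, ← map_sub, hπ, Ideal.Quotient.eq_zero_iff_mem,
    Ideal.mem_span_singleton] at h1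
  obtain ⟨w, hw⟩ := h1
  have h2 := congrArg (coeff 0) hw
  have h3 : coeff 0 (f * w) = 0 := by
    simp only [← constantCoeff_eq, map_mul] at hfc ⊢
    rw [hfc, zero_mul]
  rw [h3, coeff_sub, coeff_tr, smul_zero, zero_add, hgh, coeff_mul, Finset.sum_eq_zero] at h2
  · simp at h2
  · intro x hx
    rw [Finset.HasAntidiagonal.mem_antidiagonal] at hx
    rw [hfr x.1, zero_mul]
    intro i
    have := DFunLike.congr_fun hx i
    simp at this
    omega
end EK

end

section
namespace EK
open MvPolynomial

section Lead
variable {K : Type*} [Field K] {lt : (Fin 3 →₀ ℕ) → (Fin 3 →₀ ℕ) → Prop}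

theorem lt_add2 (hlt : IsMonomialOrder lt) {a b c d : Fin 3 →₀ ℕ} (h1 : a = b ∨ lt a b) (h2 : c = d ∨ lt c d)
    (h3 : a ≠ b ∨ c ≠ d) : lt (a + c) (b + d) := by
  obtain ⟨h, -, hadd⟩ := hlt
  have htr : ∀ a b c, lt a b → lt b c → lt a c := fun a b c => h.trans a b c
  rcases h1 with rfl | h1
  · rcases h2 with rfl | h2
    · simp at h3
    · rw [add_comm a c, add_comm a d]; exact hadd _ _ _ h2
  · rcases h2 with rfl | h2
    · exact hadd _ _ _ h1
    · refine htr _ _ _ (hadd _ _ c h1) ?_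
      rw [add_comm b c, add_comm b d]; exact hadd _ _ _ h2

theorem lead_mul (hlt : IsMonomialOrder lt) {F G : MvPolynomial (Fin 3) K} {m n : Fin 3 →₀ ℕ}
    (hF : IsLeadingMonomial lt F m) (hG : IsLeadingMonomial lt G n) :
    IsLeadingMonomial lt (F * G) (m + n) := by
  have hirr : ∀ a, ¬ lt a a := fun a => hlt.1.irrefl a
  have h1 : ∀ e ∈ F.support, e = m ∨ lt e m := fun e he => or_iff_not_imp_left.2 (hF.2 e he)
  have h2 : ∀ e ∈ G.support, e = n ∨ lt e n := fun e he => or_iff_not_imp_left.2 (hG.2 e he)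
  constructor
  · rw [mem_support_iff, coeff_mul, Finset.sum_eq_single (m, n)]
    · exact mul_ne_zero (mem_support_iff.1 hF.1) (mem_support_iff.1 hG.1)
    · intro x hx hne
      rw [Finset.HasAntidiagonal.mem_antidiagonal] at hx
      by_contra hz
      have ha := h1 x.1 (mem_support_iff.2 (left_ne_zero_of_mul hz))
      have hb := h2 x.2 (mem_support_iff.2 (right_ne_zero_of_mul hz))
      have := lt_add2 hlt ha hb (by
        by_contra hcon
        push Not at hcon
        exact hne (Prod.ext hcon.1 hcon.2))
      rw [hx] at this
      exact hirr _ this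
    · intro h
      simp at h
  · intro e he hne
    rw [mem_support_iff, coeff_mul] at he
    obtain ⟨x, hx, hz⟩ := Finset.exists_ne_zero_of_sum_ne_zero he
    rw [Finset.HasAntidiagonal.mem_antidiagonal] at hx
    have ha := h1 x.1 (mem_support_iff.2 (left_ne_zero_of_mul hz))
    have hb := h2 x.2 (mem_support_iff.2 (right_ne_zero_of_mul hz))
    rw [← hx]
    refine lt_add2 hlt ha hb ?_
    by_contra hcon
    push Not at hcon
    exact hne (by rw [← hx, hcon.1, hcon.2])

theorem lead_mono (a : Fin 3 →₀ ℕ) : IsLeadingMonomial lt (monomial a (1 : K)) a := by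
  constructor
  · simp
  · intro e he hne
    rw [mem_support_iff, coeff_monomial] at he
    simp [hne.symm] at he

theorem lead_pow (hlt : IsMonomialOrder lt) {F : MvPolynomial (Fin 3) K} {m : Fin 3 →₀ ℕ}
    (hF : IsLeadingMonomial lt F m) (k : ℕ) : IsLeadingMonomial lt (F ^ k) (k • m) := by
  induction k with
  | zero => simpa using lead_mono (K := K) (lt := lt) 0
  | succ k ih => rw [pow_succ, succ_nsmul]; exact lead_mul hlt ih hF

theorem split_field (p : ℕ) [hpf : Fact p.Prime] [CharP K p] [PerfectRing K p] (hlt : IsMonomialOrder lt)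
    {F : MvPolynomial (Fin 3) K} {m : Fin 3 →₀ ℕ} (hF : IsLeadingMonomial lt F m) (hm : ∀ i, m i ≤ 1) :
    ∃ θ : MvPolynomial (Fin 3) K →+ MvPolynomial (Fin 3) K, (∀ r s, θ (r ^ p * s) = r * θ s) ∧ θ 1 = 1 ∧
      ∀ s, F ∣ θ (F * s) := by
  have hp := hpf.out.pos
  have hG := lead_mul hlt (lead_pow hlt hF (p - 1)) (lead_mono (K := K) (lt := lt) (tope p - (p - 1) • m))
  have hle : (p - 1) • m ≤ tope p := by
    intro i
    simp only [Finsupp.smul_apply, tope_apply, smul_eq_mul]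
    exact (Nat.mul_le_mul_left _ (hm i)).trans (by simp)
  rw [add_tsub_cancel_of_le hle] at hG
  set g := monomial (tope p - (p - 1) • m) (1 : K)
  set G := F ^ (p - 1) * g with hGdef
  have hc : (frobeniusEquiv K p).symm (coeff (tope p) G) ≠ 0 := by
    rw [Ne, EmbeddingLike.map_eq_zero_iff]
    exact mem_support_iff.1 hG.1
  set c := (frobeniusEquiv K p).symm (coeff (tope p) G) with hcdef
  have htr : tr p K G = C c := by
    ext a
    rw [coeff_tr, coeff_C]
    split_ifs with h
    · rw [← h, smul_zero, zero_add]
    · rw [EmbeddingLike.map_eq_zero_iff]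
      by_contra hne
      have h0 : lt 0 (p • a) := hlt.2.1 _ (by
        intro h2
        apply h
        ext i
        have := DFunLike.congr_fun h2 i
        simp [hp.ne'] at this
        simp [this])
      have h1 := hlt.2.2 _ _ (tope p) h0
      rw [zero_add] at h1
      have hirr : ∀ a, ¬ lt a a := fun a => hlt.1.irrefl a
      have h2 := hG.2 _ (mem_support_iff.2 hne) (by
        intro h3
        rw [h3] at h1
        exact hirr _ h1)
      exact hirr _ (hlt.1.trans _ _ _ h1 h2)
  refine ⟨⟨⟨fun s => C c⁻¹ * tr p K (G * s), ?_⟩, ?_⟩, ?_, ?_, ?_⟩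
  · rw [mul_zero, map_zero, mul_zero]
  · intro s t
    show C c⁻¹ * tr p K (G * (s + t)) = C c⁻¹ * tr p K (G * s) + C c⁻¹ * tr p K (G * t)
    rw [mul_add, map_add, mul_add]
  · intro r s
    show C c⁻¹ * tr p K (G * (r ^ p * s)) = r * (C c⁻¹ * tr p K (G * s))
    rw [mul_left_comm G, tr_pow_mul]; ring
  · show C c⁻¹ * tr p K (G * 1) = 1
    rw [mul_one, htr, ← C_mul, inv_mul_cancel₀ hc, C_1]
  · intro s
    show F ∣ C c⁻¹ * tr p K (G * (F * s))
    have : G * (F * s) = F ^ p * (g * s) := by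
      rw [hGdef, ← pow_sub_one_mul hpf.out.ne_zero]; ring
    rw [this, tr_pow_mul]
    exact Dvd.dvd.mul_left (Dvd.intro _ rfl) _
end Lead

theorem split_of_lift (p : ℕ) {S : Type*} [CommRing S] (f : S) (ϑ : S →+ S)
    (h1 : ∀ r s, ϑ (r ^ p * s) = r * ϑ s) (h2 : ϑ 1 = 1) (h3 : ∀ s, f ∣ ϑ (f * s)) :
    IsFSplit p (S ⧸ Ideal.span {f}) := by
  have hsur : Function.Surjective (Ideal.Quotient.mk (Ideal.span {f})) := Ideal.Quotient.mk_surjective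
  choose u hu using hsur
  have key : ∀ s t, Ideal.Quotient.mk (Ideal.span {f}) s = Ideal.Quotient.mk (Ideal.span {f}) t →
      Ideal.Quotient.mk (Ideal.span {f}) (ϑ s) = Ideal.Quotient.mk (Ideal.span {f}) (ϑ t) := by
    intro s t h
    rw [Ideal.Quotient.eq, Ideal.mem_span_singleton] at h ⊢
    obtain ⟨w, hw⟩ := h
    rw [← map_sub, hw]
    exact h3 w
  refine ⟨⟨⟨fun x => Ideal.Quotient.mk _ (ϑ (u x)), ?_⟩, ?_⟩, ?_, ?_⟩
  · rw [key (u 0) 0 (by rw [hu, map_zero]), map_zero, map_zero]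
  · intro x y
    show Ideal.Quotient.mk (Ideal.span {f}) _ = Ideal.Quotient.mk (Ideal.span {f}) _ + Ideal.Quotient.mk (Ideal.span {f}) _
    rw [key (u (x + y)) (u x + u y) (by rw [hu, map_add, hu, hu]), map_add, map_add]
  · intro r s
    show Ideal.Quotient.mk (Ideal.span {f}) (ϑ (u (r ^ p * s))) = r * Ideal.Quotient.mk (Ideal.span {f}) (ϑ (u s))
    rw [key (u (r ^ p * s)) (u r ^ p * u s) (by rw [hu, map_mul, map_pow, hu, hu]), h1, map_mul, hu]
  · show Ideal.Quotient.mk (Ideal.span {f}) (ϑ (u 1)) = 1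
    rw [key (u 1) 1 (by rw [hu, map_one]), h2, map_one]

theorem exists_proj (p : ℕ) [hpf : Fact p.Prime] (K : Type*) [Field K] [CharP K p] :
    ∃ P : MvPolynomial (Fin 3) K →+ MvPolynomial (Fin 3) (ZMod p), P 1 = 1 ∧
      ∀ r s, P (map (ZMod.castHom (dvd_refl p) K) r * s) = r * P s := by
  letI := ZMod.algebra K p
  obtain ⟨π, hπ⟩ := (Algebra.linearMap (ZMod p) K).exists_leftInverse_of_injective
    (LinearMap.ker_eq_bot.2 (algebraMap (ZMod p) K).injective)
  have hπ1 : π 1 = 1 := by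
    have := DFunLike.congr_fun hπ 1
    simpa using this
  have halg : ∀ x, ZMod.castHom (dvd_refl p) K x = algebraMap (ZMod p) K x := fun x => rfl
  let P : MvPolynomial (Fin 3) K →+ MvPolynomial (Fin 3) (ZMod p) :=
    { toFun := fun s => ⟨Finsupp.mapRange π (map_zero _) (AddMonoidAlgebra.coeff s)⟩
      map_zero' := by
        ext a
        show π (coeff a (0 : MvPolynomial (Fin 3) K)) = coeff a (0 : MvPolynomial (Fin 3) (ZMod p))
        rw [coeff_zero, coeff_zero, map_zero]
      map_add' := fun s t => by
        ext a
        rw [coeff_add]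
        show π (coeff a (s + t)) = π (coeff a s) + π (coeff a t)
        rw [coeff_add, map_add] }
  have hP : ∀ s a, coeff a (P s) = π (coeff a s) := fun s a => rfl
  refine ⟨P, ?_, ?_⟩
  · ext a
    rw [hP, coeff_one, coeff_one]
    split_ifs
    · exact hπ1
    · exact map_zero _
  · intro r s
    ext a
    rw [hP, coeff_mul, coeff_mul, map_sum]
    refine Finset.sum_congr rfl fun x _ => ?_
    rw [hP, coeff_map, halg, ← Algebra.smul_def, map_smul, smul_eq_mul]

theorem split_descend (p : ℕ) [hpf : Fact p.Prime] (K : Type*) [Field K] [CharP K p]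
    (f : MvPolynomial (Fin 3) (ZMod p)) (θ : MvPolynomial (Fin 3) K →+ MvPolynomial (Fin 3) K)
    (h1 : ∀ r s, θ (r ^ p * s) = r * θ s) (h2 : θ 1 = 1)
    (h3 : ∀ s, map (ZMod.castHom (dvd_refl p) K) f ∣ θ (map (ZMod.castHom (dvd_refl p) K) f * s)) :
    IsFSplit p (MvPolynomial (Fin 3) (ZMod p) ⧸ Ideal.span {f}) := by
  obtain ⟨P, hP1, hP⟩ := exists_proj p K
  set j := map (σ := Fin 3) (ZMod.castHom (dvd_refl p) K)
  refine split_of_lift p f (P.comp (θ.comp j.toAddMonoidHom)) ?_ ?_ ?_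
  · intro r s
    show P (θ (j (r ^ p * s))) = r * P (θ (j s))
    rw [map_mul, map_pow, h1, hP]
  · show P (θ (j 1)) = 1
    rw [map_one, h2, hP1]
  · intro s
    show f ∣ P (θ (j (f * s)))
    rw [map_mul]
    obtain ⟨w, hw⟩ := h3 (j s)
    rw [hw, hP]
    exact Dvd.intro _ rfl
end EK

end

section
namespace EK
open PrimeSpectrum in
theorem spread (s : Set ℂ) (hs : s.Finite) : ∃ N : ℕ, ∀ p : ℕ, p.Prime → N ≤ p →
    ∃ (K : Type) (_ : Field K) (_ : IsAlgClosed K) (_ : CharP K p), Nonempty (Algebra.adjoin ℤ s →+* K) := by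
  set A := Algebra.adjoin ℤ s with hA
  have hft : Algebra.FiniteType ℤ A := by
    exact .adjoin_of_finite hs
  have hfp : (algebraMap ℤ A).FinitePresentation := by
    rw [RingHom.finitePresentation_algebraMap]
    exact Algebra.FinitePresentation.of_finiteType.1 hft
  have hinj : Function.Injective (algebraMap ℤ A) := FaithfulSMul.algebraMap_injective ℤ A
  obtain ⟨T, hT⟩ := exists_constructibleSetData_iff.2 (isConstructible_range_comap hfp)
  have h0 : (⊥ : PrimeSpectrum ℤ) ∈ T.toSet := by
    rw [hT]
    refine ⟨⊥, ?_⟩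
    ext x
    simp
  rw [ConstructibleSetData.toSet] at h0
  simp only [Set.mem_iUnion] at h0
  obtain ⟨B, hB, h0⟩ := h0
  have hg : ∀ i, B.g i = 0 := by
    intro i
    have := h0.1 ⟨i, rfl⟩
    simpa using this
  have hf : B.f ≠ 0 := by
    intro h
    apply h0.2
    rw [h]
    intro x hx
    rw [Set.mem_singleton_iff.1 hx]
    exact Ideal.zero_mem _
  refine ⟨B.f.natAbs + 1, fun p hp hN => ?_⟩
  have hpr : (Ideal.span {(p : ℤ)}).IsPrime := by
    rw [Ideal.span_singleton_prime (by exact_mod_cast hp.ne_zero)]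
    exact Nat.prime_iff_prime_int.1 hp
  have hmem : (⟨Ideal.span {(p : ℤ)}, hpr⟩ : PrimeSpectrum ℤ) ∈ T.toSet := by
    rw [ConstructibleSetData.toSet]
    simp only [Set.mem_iUnion]
    refine ⟨B, hB, ?_, ?_⟩
    · rintro x ⟨i, rfl⟩
      rw [hg i]; exact Ideal.zero_mem _
    · intro h
      have h2 : B.f ∈ Ideal.span {(p : ℤ)} := h rfl
      rw [Ideal.mem_span_singleton] at h2
      have h3 := Int.natAbs_dvd_natAbs.2 h2
      have := Nat.le_of_dvd (Int.natAbs_pos.2 hf) h3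
      simp at this
      omega
  rw [hT] at hmem
  obtain ⟨q, hq⟩ := hmem
  have hqp := q.2
  have hpK : (p : A ⧸ q.asIdeal) = 0 := by
    have h1 : (p : ℤ) ∈ (PrimeSpectrum.comap (algebraMap ℤ A) q).asIdeal := by
      rw [hq]; exact Ideal.mem_span_singleton_self _
    have h2 : algebraMap ℤ A p ∈ q.asIdeal := h1
    have h3 := Ideal.Quotient.eq_zero_iff_mem.2 h2
    simpa using h3
  let K := AlgebraicClosure (FractionRing (A ⧸ q.asIdeal))
  let χ : A →+* K := ((algebraMap (FractionRing (A ⧸ q.asIdeal)) K).comp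
    (algebraMap (A ⧸ q.asIdeal) (FractionRing (A ⧸ q.asIdeal)))).comp (Ideal.Quotient.mk q.asIdeal)
  have hpK2 : (p : K) = 0 := by
    have h1 := congrArg ((algebraMap (FractionRing (A ⧸ q.asIdeal)) K).comp
      (algebraMap (A ⧸ q.asIdeal) (FractionRing (A ⧸ q.asIdeal)))) hpK
    rwa [map_natCast, map_zero] at h1
  have : Fact p.Prime := ⟨hp⟩
  refine ⟨K, inferInstance, inferInstance, ?_, ⟨χ⟩⟩
  exact (CharP.charP_iff_prime_eq_zero hp).2 hpK2
open MvPolynomial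

theorem map_aeval' {A B : Type*} [CommRing A] [CommRing B] (χ : A →+* B)
    (P : Fin 3 → MvPolynomial (Fin 3) A) (F : MvPolynomial (Fin 3) A) :
    map χ (aeval P F) = aeval (fun i => map χ (P i)) (map χ F) := by
  induction F using MvPolynomial.induction_on with
  | C a => simp [algebraMap_eq]
  | add p q hp hq => simp only [map_add, hp, hq]
  | mul_X p i hp => simp only [map_mul, hp, aeval_X, map_X]

theorem exists_map_eq (s : Set ℂ) (P : MvPolynomial (Fin 3) ℂ) (h : ∀ e, e ∈ P.support → coeff e P ∈ s) :
    ∃ P' : MvPolynomial (Fin 3) (Algebra.adjoin ℤ s), map (Algebra.adjoin ℤ s).val.toRingHom P' = P := by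
  have : P ∈ Set.range (map (σ := Fin 3) (Algebra.adjoin ℤ s).val.toRingHom) := by
    rw [mem_range_map_iff_coeffs_subset]
    intro x hx
    obtain ⟨e, he, rfl⟩ := mem_coeffs_iff.1 hx
    exact ⟨⟨_, Algebra.subset_adjoin (h e he)⟩, rfl⟩
  exact this

theorem dir21 (f : MvPolynomial (Fin 3) ℤ) (φ : MvPolynomial (Fin 3) ℂ ≃ₐ[ℂ] MvPolynomial (Fin 3) ℂ)
    (lt : (Fin 3 →₀ ℕ) → (Fin 3 →₀ ℕ) → Prop) (hlt : IsMonomialOrder lt) (m : Fin 3 →₀ ℕ)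
    (hl : IsLeadingMonomial lt (φ (MvPolynomial.map (Int.castRingHom ℂ) f)) m) (hm : ∀ i, m i ≤ 1) :
    ∃ N : ℕ, ∀ p : ℕ, p.Prime → N ≤ p →
        IsFSplit p (MvPolynomial (Fin 3) (ZMod p) ⧸
          Ideal.span {MvPolynomial.map (Int.castRingHom (ZMod p)) f}) := by
  set F := φ (MvPolynomial.map (Int.castRingHom ℂ) f) with hF
  let s : Set ℂ := ((⋃ i, ((φ (X i)).coeffs : Set ℂ)) ∪ ⋃ i, ((φ.symm (X i)).coeffs : Set ℂ)) ∪ {(coeff m F)⁻¹}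
  have hs : s.Finite := by
    refine Set.Finite.union (Set.Finite.union ?_ ?_) (Set.finite_singleton _) <;>
    exact Set.finite_iUnion fun i => Finset.finite_toSet _
  obtain ⟨N, hN⟩ := spread s hs
  refine ⟨N, fun p hp hNp => ?_⟩
  obtain ⟨K, _, _, _, ⟨χ⟩⟩ := hN p hp hNp
  have hpf : Fact p.Prime := ⟨hp⟩
  set A := Algebra.adjoin ℤ s
  set ι : A →+* ℂ := A.val.toRingHom with hι
  have hιinj : Function.Injective ι := Subtype.val_injective
  have hminj : Function.Injective (map (σ := Fin 3) ι) := map_injective _ hιinj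
  have hP : ∀ i, ∃ P', map ι P' = φ (X i) := fun i => exists_map_eq s _ fun e he =>
    Or.inl (Or.inl (Set.mem_iUnion.2 ⟨i, coeff_mem_coeffs e (mem_support_iff.1 he)⟩))
  have hQ : ∀ i, ∃ P', map ι P' = φ.symm (X i) := fun i => exists_map_eq s _ fun e he =>
    Or.inl (Or.inr (Set.mem_iUnion.2 ⟨i, coeff_mem_coeffs e (mem_support_iff.1 he)⟩))
  choose P hP using hP
  choose Q hQ using hQ
  have hφ : ∀ G, φ G = aeval (fun i => φ (X i)) G := by
    intro G
    have : (φ : MvPolynomial (Fin 3) ℂ →ₐ[ℂ] MvPolynomial (Fin 3) ℂ) = aeval (fun i => φ (X i)) := by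
      ext i : 1; simp
    exact DFunLike.congr_fun this G
  have hψ : ∀ G, φ.symm G = aeval (fun i => φ.symm (X i)) G := by
    intro G
    have : (φ.symm : MvPolynomial (Fin 3) ℂ →ₐ[ℂ] MvPolynomial (Fin 3) ℂ) = aeval (fun i => φ.symm (X i)) := by
      ext i : 1; simp
    exact DFunLike.congr_fun this G
  have hPι : ∀ G, map ι (aeval P G) = φ (map ι G) := by
    intro G; rw [map_aeval', hφ]; simp only [hP]
  have hQι : ∀ G, map ι (aeval Q G) = φ.symm (map ι G) := by
    intro G; rw [map_aeval', hψ]; simp only [hQ]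
  have hPQ : ∀ i, aeval P (Q i) = X i := fun i => hminj (by rw [hPι, hQ, φ.apply_symm_apply, map_X])
  have hQP : ∀ i, aeval Q (P i) = X i := fun i => hminj (by rw [hQι, hP, φ.symm_apply_apply, map_X])
  set Φ : MvPolynomial (Fin 3) K →ₐ[K] MvPolynomial (Fin 3) K := aeval fun i => map χ (P i) with hΦ
  set Ψ : MvPolynomial (Fin 3) K →ₐ[K] MvPolynomial (Fin 3) K := aeval fun i => map χ (Q i) with hΨ
  have hΦΨ : ∀ G, Φ (Ψ G) = G := by
    have : Φ.comp Ψ = AlgHom.id K _ := by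
      ext i : 1
      rw [AlgHom.comp_apply, hΨ, aeval_X, hΦ, ← map_aeval', hPQ, map_X]; rfl
    exact fun G => DFunLike.congr_fun this G
  have hΨΦ : ∀ G, Ψ (Φ G) = G := by
    have : Ψ.comp Φ = AlgHom.id K _ := by
      ext i : 1
      rw [AlgHom.comp_apply, hΦ, aeval_X, hΨ, ← map_aeval', hQP, map_X]; rfl
    exact fun G => DFunLike.congr_fun this G
  set F' := aeval P (map (Int.castRingHom A) f) with hF'
  have hF'F : map ι F' = F := by
    rw [hF', hPι, hF, map_map]
    congr 2
  have hcoef : ∀ e, ι (coeff e F') = coeff e F := fun e => by rw [← hF'F, coeff_map]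
  set fK := map (Int.castRingHom K) f with hfK
  have hFK : Φ fK = map χ F' := by
    rw [hF', map_aeval', map_map, hfK, RingHom.ext_int (χ.comp (Int.castRingHom A)) (Int.castRingHom K)]
  have hlead : IsLeadingMonomial lt (Φ fK) m := by
    rw [hFK]
    constructor
    · rw [mem_support_iff, coeff_map]
      have hd : (coeff m F)⁻¹ ∈ A := Algebra.subset_adjoin (Or.inr rfl)
      have h1 : coeff m F' * ⟨_, hd⟩ = 1 := hιinj (by
        rw [map_mul, hcoef, map_one]
        exact mul_inv_cancel₀ (mem_support_iff.1 hl.1))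
      have h2 := congrArg χ h1
      rw [map_mul, map_one] at h2
      exact left_ne_zero_of_mul_eq_one h2
    · intro e he hne
      refine hl.2 e ?_ hne
      rw [mem_support_iff, coeff_map] at he
      rw [mem_support_iff, ← hcoef]
      intro h
      apply he
      rw [hιinj (h.trans (map_zero ι).symm), map_zero]
  obtain ⟨θ, h1, h2, h3⟩ := split_field p hlt hlead hm
  have hfp : map (ZMod.castHom (dvd_refl p) K) (map (Int.castRingHom (ZMod p)) f) = fK := by
    rw [map_map, hfK, RingHom.ext_int ((ZMod.castHom (dvd_refl p) K).comp (Int.castRingHom (ZMod p))) (Int.castRingHom K)]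
  refine split_descend p K _ (Ψ.toRingHom.toAddMonoidHom.comp (θ.comp Φ.toRingHom.toAddMonoidHom)) ?_ ?_ ?_
  · intro r s
    show Ψ (θ (Φ (r ^ p * s))) = r * Ψ (θ (Φ s))
    rw [map_mul, map_pow, h1, map_mul, hΨΦ]
  · show Ψ (θ (Φ 1)) = 1
    rw [map_one, h2, map_one]
  · intro s
    rw [hfp]
    show fK ∣ Ψ (θ (Φ (fK * s)))
    rw [map_mul]
    have := map_dvd Ψ (h3 (Φ s))
    rwa [hΨΦ] at this
end EK

end

section
namespace EK
open MvPolynomial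

section Lin
variable {R : Type*} [CommRing R]

/-- linear substitution `X i ↦ ∑ j, G i j X j` -/
noncomputable def lin (G : Matrix (Fin 3) (Fin 3) R) : MvPolynomial (Fin 3) R →ₐ[R] MvPolynomial (Fin 3) R :=
  aeval fun i => ∑ j, C (G i j) * X j

theorem lin_X (G : Matrix (Fin 3) (Fin 3) R) (i : Fin 3) : lin G (X i) = ∑ j, C (G i j) * X j := by
  simp [lin]

theorem lin_C (G : Matrix (Fin 3) (Fin 3) R) (a : R) : lin G (C a) = C a := by
  simp [lin, algebraMap_eq]

theorem lin_lin (G H : Matrix (Fin 3) (Fin 3) R) (f : MvPolynomial (Fin 3) R) :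
    lin G (lin H f) = lin (H * G) f := by
  have : (lin G).comp (lin H) = lin (H * G) := by
    ext i : 1
    rw [AlgHom.comp_apply, lin_X, lin_X, map_sum]
    simp only [map_mul, lin_C, lin_X, Finset.mul_sum, Matrix.mul_apply, map_sum, Finset.sum_mul]
    rw [Finset.sum_comm]
    simp only [mul_assoc]
  exact DFunLike.congr_fun this f

theorem lin_one (f : MvPolynomial (Fin 3) R) : lin (1 : Matrix (Fin 3) (Fin 3) R) f = f := by
  have : lin (1 : Matrix (Fin 3) (Fin 3) R) = AlgHom.id R _ := by
    ext i : 1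
    rw [lin_X, Finset.sum_eq_single i]
    · simp
    · intro j _ h
      simp [Matrix.one_apply_ne h.symm]
    · simp
  rw [this]; rfl

theorem lin_hom (G : Matrix (Fin 3) (Fin 3) R) {f : MvPolynomial (Fin 3) R} {d : ℕ} (hf : f.IsHomogeneous d) :
    (lin G f).IsHomogeneous d := by
  have := hf.aeval (fun i => ∑ j, C (G i j) * X j) (n := 1) (fun i => ?_)
  · rw [one_mul] at this
    exact this
  · refine IsHomogeneous.sum _ _ _ fun j _ => ?_
    simpa using (isHomogeneous_C _ (G i j)).mul (isHomogeneous_X R j)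

theorem eval_lin (G : Matrix (Fin 3) (Fin 3) R) (v : Fin 3 → R) (f : MvPolynomial (Fin 3) R) :
    eval v (lin G f) = eval (G.mulVec v) f := by
  have : (eval v).comp (lin G).toRingHom = eval (G.mulVec v) := by
    apply MvPolynomial.ringHom_ext
    · intro r; simp [lin_C]
    · intro i
      simp [lin_X, Matrix.mulVec, dotProduct]
  exact DFunLike.congr_fun this f

theorem map_lin {S : Type*} [CommRing S] (χ : R →+* S) (G : Matrix (Fin 3) (Fin 3) R)
    (f : MvPolynomial (Fin 3) R) : map χ (lin G f) = lin (G.map χ) (map χ f) := by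
  unfold lin
  rw [map_aeval']
  congr 2
  ext i : 1
  simp

theorem pderiv_lin (G : Matrix (Fin 3) (Fin 3) R) (i : Fin 3) (f : MvPolynomial (Fin 3) R) :
    pderiv i (lin G f) = ∑ j, C (G j i) * lin G (pderiv j f) := by
  induction f using MvPolynomial.induction_on with
  | C a => simp [lin_C]
  | add p q hp hq => simp only [map_add, hp, hq, mul_add, Finset.sum_add_distrib]
  | mul_X p k hp =>
    have h1 : pderiv i (lin G (X k)) = C (G k i) := by
      rw [lin_X, map_sum, Finset.sum_eq_single i]
      · simp
      · intro j _ hj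
        simp [pderiv_X_of_ne hj]
      · simp
    have h2 : ∀ j, C (G j i) * lin G (pderiv j (p * X k)) =
        (C (G j i) * lin G (pderiv j p)) * lin G (X k) + if j = k then lin G p * C (G k i) else 0 := by
      intro j
      rw [pderiv_mul, map_add, map_mul, map_mul, mul_add, ← mul_assoc]
      split_ifs with h
      · subst h; simp; ring
      · rw [pderiv_X_of_ne (Ne.symm h)]; simp
    rw [map_mul, pderiv_mul, hp, h1]
    simp only [h2]
    rw [Finset.sum_add_distrib, Finset.sum_mul]
    simp

end Lin

theorem inFrob_iff {K : Type*} [CommRing K] (p : ℕ) (F : MvPolynomial (Fin 3) K) :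
    InFrob p F ↔ F ∈ Ideal.span (Set.range fun i : Fin 3 => (X i : MvPolynomial (Fin 3) K) ^ p) := by
  have : (Set.range fun i : Fin 3 => (X i : MvPolynomial (Fin 3) K) ^ p) =
      (fun s => monomial s (1 : K)) '' Set.range fun i : Fin 3 => Finsupp.single i p := by
    rw [← Set.range_comp]
    congr 1
    ext i : 1
    simp [X_pow_eq_monomial]
  rw [this, mem_ideal_span_monomial_image]
  unfold InFrob
  refine forall_congr' fun e => ?_
  rw [mem_support_iff, not_imp_comm]
  simp [Finsupp.single_le_iff]

theorem inFrob_lin {K : Type*} [Field K] (p : ℕ) [hpf : Fact p.Prime] [CharP K p]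
    (G : Matrix (Fin 3) (Fin 3) K) (F : MvPolynomial (Fin 3) K) (hF : InFrob p F) : InFrob p (lin G F) := by
  rw [inFrob_iff] at hF ⊢
  have h1 := Ideal.mem_map_of_mem (lin G) hF
  refine (Ideal.map_le_iff_le_comap.2 ?_) h1
  rw [Ideal.span_le]
  rintro _ ⟨i, rfl⟩
  show lin G (X i ^ p) ∈ Ideal.span (Set.range fun i : Fin 3 => (X i : MvPolynomial (Fin 3) K) ^ p)
  rw [map_pow, lin_X, sum_pow_char]
  refine Ideal.sum_mem _ fun j _ => ?_
  rw [mul_pow]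
  exact Ideal.mul_mem_left _ _ (Ideal.subset_span ⟨j, rfl⟩)

theorem inFrob_weight {K : Type*} [Field K] (p : ℕ) (hp : 2 ≤ p) (w : Fin 3 → ℕ) (F : MvPolynomial (Fin 3) K)
    (hF : ∀ e, coeff e F ≠ 0 → ∑ i, w i < ∑ i, w i * e i) : InFrob p (F ^ (p - 1)) := by
  have key : ∀ k e, coeff e (F ^ k) ≠ 0 → k * (∑ i, w i + 1) ≤ ∑ i, w i * e i := by
    intro k
    induction k with
    | zero => intro e _; simp
    | succ k ih =>
      intro e he
      rw [pow_succ, coeff_mul] at he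
      obtain ⟨x, hx, hz⟩ := Finset.exists_ne_zero_of_sum_ne_zero he
      rw [Finset.HasAntidiagonal.mem_antidiagonal] at hx
      have h1 := ih _ (left_ne_zero_of_mul hz)
      have h2 := hF _ (right_ne_zero_of_mul hz)
      rw [← hx]
      simp only [Finsupp.add_apply, mul_add, Finset.sum_add_distrib] at h1 h2 ⊢
      rw [add_mul, add_mul]
      omega
  intro e he
  by_contra hne
  have h1 := key _ _ hne
  have h2 : ∑ i, w i * e i ≤ (p - 1) * ∑ i, w i := by
    rw [Finset.mul_sum]
    refine Finset.sum_le_sum fun i _ => ?_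
    rw [mul_comm]
    exact Nat.mul_le_mul_right _ (by have := he i; omega)
  rw [mul_add] at h1
  omega

/-- Weierstrass cubic, with `z = X 0`, `x = X 1`, `y = X 2`. -/
noncomputable def wei {R : Type*} [CommRing R] (a b : R) : MvPolynomial (Fin 3) R :=
  X 2 ^ 2 * X 0 - X 1 ^ 3 - C a * X 1 * X 0 ^ 2 - C b * X 0 ^ 3

theorem wei_hom {R : Type*} [CommRing R] (a b : R) : (wei a b).IsHomogeneous 3 := by
  unfold wei
  refine IsHomogeneous.sub (IsHomogeneous.sub (IsHomogeneous.sub ?_ ?_) ?_) ?_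
  · exact ((isHomogeneous_X R 2).pow 2).mul (isHomogeneous_X R 0)
  · exact (isHomogeneous_X R 1).pow 3
  · exact (((isHomogeneous_C _ a).mul (isHomogeneous_X R 1)).mul ((isHomogeneous_X R 0).pow 2))
  · exact (isHomogeneous_C _ b).mul ((isHomogeneous_X R 0).pow 3)

theorem map_wei {R S : Type*} [CommRing R] [CommRing S] (χ : R →+* S) (a b : R) :
    map χ (wei a b) = wei (χ a) (χ b) := by
  simp [wei]

/-- dehomogenization -/
noncomputable def deh (R : Type*) [CommRing R] : MvPolynomial (Fin 3) R →ₐ[R] Polynomial (Polynomial R) :=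
  aeval ![1, Polynomial.C Polynomial.X, Polynomial.X]

theorem deh_mono {R : Type*} [CommRing R] (e : Fin 3 →₀ ℕ) (c : R) (i j : ℕ) :
    ((deh R (monomial e c)).coeff j).coeff i = if e 1 = i ∧ e 2 = j then c else 0 := by
  have : deh R (monomial e c) = Polynomial.C (Polynomial.C c * Polynomial.X ^ (e 1)) * Polynomial.X ^ (e 2) := by
    unfold deh
    rw [aeval_monomial, Finsupp.prod_fintype _ _ (by simp), Fin.prod_univ_three]
    simp
    ring_nf
  rw [this, Polynomial.coeff_C_mul_X_pow]
  split_ifs with h1 h2 h2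
  · rw [Polynomial.coeff_C_mul_X_pow, if_pos h2.1.symm]
  · rw [Polynomial.coeff_C_mul_X_pow, if_neg (fun h => h2 ⟨h.symm, h1.symm⟩)]
  · exact absurd h2.2.symm h1
  · simp

theorem deh_coeff {R : Type*} [CommRing R] {F : MvPolynomial (Fin 3) R} {d : ℕ} (hF : F.IsHomogeneous d)
    (e : Fin 3 →₀ ℕ) (he : e 0 + e 1 + e 2 = d) : ((deh R F).coeff (e 2)).coeff (e 1) = coeff e F := by
  conv_lhs => rw [F.as_sum, map_sum, Polynomial.finset_sum_coeff, Polynomial.finset_sum_coeff]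
  simp only [deh_mono]
  have hd : ∀ x ∈ F.support, x 0 + x 1 + x 2 = d := by
    intro x hx
    have := hF (mem_support_iff.1 hx)
    rw [Finsupp.weight_apply, Finsupp.sum_fintype _ _ (by simp), Fin.sum_univ_three] at this
    simpa using this
  rw [Finset.sum_eq_single e]
  · simp
  · intro x hx hne
    rw [if_neg]
    rintro ⟨h1, h2⟩
    have := hd x hx
    apply hne
    ext i
    fin_cases i
    · simp; omega
    · exact h1
    · exact h2
  · intro h
    simpa using h

theorem inFrob_wei {K : Type*} [Field K] (p n : ℕ) (hpn : p = 2 * n + 1) (a b : K) (hab : hp n a b = 0) :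
    InFrob p (wei a b ^ (p - 1)) := by
  intro e he
  have hh := (wei_hom a b).pow (p - 1)
  by_contra hne
  have hs : e 0 + e 1 + e 2 = 3 * (p - 1) := by
    have := hh hne
    rw [Finsupp.weight_apply, Finsupp.sum_fintype _ _ (by simp), Fin.sum_univ_three] at this
    simpa using this
  have h0 := he 0
  have h1 := he 1
  have h2 := he 2
  have h1' : e 1 = 2 * n := by omega
  have h2' : e 2 = n * 2 := by omega
  apply hne
  rw [← deh_coeff hh e hs, h1', h2']
  have hw : deh K (wei a b) = Polynomial.expand _ 2
      (Polynomial.X - Polynomial.C (Polynomial.X ^ 3 + Polynomial.C a * Polynomial.X + Polynomial.C b)) := by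
    unfold deh wei
    simp
    ring_nf
  rw [map_pow, hw, ← map_pow, Polynomial.coeff_expand_mul (by norm_num), show p - 1 = n + n by omega,
    sub_eq_add_neg, ← Polynomial.C_neg, Polynomial.coeff_X_add_C_pow, Nat.add_sub_cancel, neg_pow, ← Polynomial.C_eq_natCast,
    ← Polynomial.C_1, ← Polynomial.C_neg, ← Polynomial.C_pow]
  rw [Polynomial.coeff_mul_C, Polynomial.coeff_C_mul]
  have : ((Polynomial.X ^ 3 + Polynomial.C a * Polynomial.X + Polynomial.C b) ^ n).coeff (2 * n) = 0 := hab
  rw [this]; simp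
end EK

end

section
namespace EK
open MvPolynomial

theorem nonsplit (f : MvPolynomial (Fin 3) ℤ) (d : ℕ) (hf0 : f ≠ 0) (hhom : f.IsHomogeneous d) (hd : 1 ≤ d)
    (G G' : Matrix (Fin 3) (Fin 3) ℂ) (hG : G * G' = 1) (E : Set ℂ) (hE : E.Finite) :
    ∃ (s : Set ℂ) (_ : E ⊆ s) (F' : MvPolynomial (Fin 3) (Algebra.adjoin ℤ s)),
      map (Algebra.adjoin ℤ s).val.toRingHom F' = lin G (map (Int.castRingHom ℂ) f) ∧
      ∃ N : ℕ, ∀ p : ℕ, p.Prime → N ≤ p → ∃ (K : Type) (_ : Field K) (_ : CharP K p)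
        (χ : Algebra.adjoin ℤ s →+* K), InFrob p ((map χ F') ^ (p - 1)) →
        ¬ IsFSplit p (MvPolynomial (Fin 3) (ZMod p) ⧸
          Ideal.span {MvPolynomial.map (Int.castRingHom (ZMod p)) f}) := by
  let s : Set ℂ := E ∪ ((Set.range fun ij : Fin 3 × Fin 3 => G ij.1 ij.2) ∪
    (Set.range fun ij : Fin 3 × Fin 3 => G' ij.1 ij.2))
  have hs : s.Finite := hE.union ((Set.finite_range _).union (Set.finite_range _))
  have m1 : ∀ i j, G i j ∈ Algebra.adjoin ℤ s := fun i j =>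
    Algebra.subset_adjoin (Or.inr (Or.inl ⟨(i, j), rfl⟩))
  have m2 : ∀ i j, G' i j ∈ Algebra.adjoin ℤ s := fun i j =>
    Algebra.subset_adjoin (Or.inr (Or.inr ⟨(i, j), rfl⟩))
  let GA : Matrix (Fin 3) (Fin 3) (Algebra.adjoin ℤ s) := fun i j => ⟨G i j, m1 i j⟩
  let GA' : Matrix (Fin 3) (Fin 3) (Algebra.adjoin ℤ s) := fun i j => ⟨G' i j, m2 i j⟩
  let ι : Algebra.adjoin ℤ s →+* ℂ := (Algebra.adjoin ℤ s).val.toRingHom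
  have hι : Function.Injective ι := Subtype.val_injective
  have h1 : GA.map ι = G := rfl
  have h2 : GA'.map ι = G' := rfl
  have h3 : GA * GA' = 1 := by
    have : (GA * GA').map ι = (1 : Matrix (Fin 3) (Fin 3) (Algebra.adjoin ℤ s)).map ι := by
      rw [Matrix.map_mul, h1, h2, hG, Matrix.map_one _ (map_zero ι) (map_one ι)]
    exact Matrix.map_injective hι this
  refine ⟨s, Set.subset_union_left, lin GA (map (Int.castRingHom _) f), ?_, ?_⟩
  · change map ι _ = _
    rw [map_lin, h1, map_map, RingHom.ext_int (ι.comp (Int.castRingHom _)) (Int.castRingHom ℂ)]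
  obtain ⟨N, hN⟩ := spread s hs
  obtain ⟨e, he⟩ := ne_zero_iff.1 hf0
  refine ⟨max N ((coeff e f).natAbs + 1), fun p hp hpN => ?_⟩
  obtain ⟨K, _, _, _, ⟨χ⟩⟩ := hN p hp (le_trans (le_max_left _ _) hpN)
  haveI : Fact p.Prime := ⟨hp⟩
  refine ⟨K, inferInstance, inferInstance, χ, fun hF => ?_⟩
  apply not_split
  · rw [ne_zero_iff]
    refine ⟨e, ?_⟩
    rw [coeff_map]
    intro h0
    rw [eq_intCast, ZMod.intCast_zmod_eq_zero_iff_dvd] at h0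
    have := Int.natAbs_dvd_natAbs.2 h0
    have h4 := Nat.le_of_dvd (Int.natAbs_pos.2 he) this
    have h5 := le_trans (le_max_right _ _) hpN
    simp at h4
    omega
  · rw [coeff_map]
    have : coeff 0 f = 0 := by
      by_contra h
      have := hhom h
      simp at this
      omega
    rw [this]; simp
  · have h6 := inFrob_lin p (GA'.map χ) _ hF
    rw [map_pow, map_lin, lin_lin, ← Matrix.map_mul, h3, Matrix.map_one _ (map_zero χ) (map_one χ), lin_one,
      map_map, RingHom.ext_int (χ.comp (Int.castRingHom _))
        ((ZMod.castHom (dvd_refl p) K).comp (Int.castRingHom (ZMod p))), ← map_map, ← map_pow] at h6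
    intro e he
    have := h6 e he
    rw [coeff_map] at this
    exact (map_eq_zero _).1 this

theorem bad_weight (f : MvPolynomial (Fin 3) ℤ) (d : ℕ) (hf0 : f ≠ 0) (hhom : f.IsHomogeneous d) (hd : 1 ≤ d)
    (hsp : ∃ N : ℕ, ∀ p : ℕ, p.Prime → N ≤ p →
        IsFSplit p (MvPolynomial (Fin 3) (ZMod p) ⧸
          Ideal.span {MvPolynomial.map (Int.castRingHom (ZMod p)) f}))
    (G G' : Matrix (Fin 3) (Fin 3) ℂ) (hG : G * G' = 1) (w : Fin 3 → ℕ)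
    (hw : ∀ e, coeff e (lin G (map (Int.castRingHom ℂ) f)) ≠ 0 → ∑ i, w i < ∑ i, w i * e i) : False := by
  obtain ⟨N0, h0⟩ := hsp
  obtain ⟨s, -, F', hF', N, hN⟩ := nonsplit f d hf0 hhom hd G G' hG ∅ Set.finite_empty
  obtain ⟨p, hp1, hp⟩ := Nat.exists_infinite_primes (max N N0)
  obtain ⟨K, _, _, χ, h⟩ := hN p hp (le_trans (le_max_left _ _) hp1)
  refine h ?_ (h0 p hp (le_trans (le_max_right _ _) hp1))
  refine inFrob_weight p hp.two_le w _ fun e he => hw e ?_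
  rw [← hF', coeff_map]
  rw [coeff_map] at he
  intro h
  have : coeff e F' = 0 := Subtype.val_injective h
  rw [this] at he
  simp at he

theorem bad_wei (f : MvPolynomial (Fin 3) ℤ) (d : ℕ) (hf0 : f ≠ 0) (hhom : f.IsHomogeneous d) (hd : 1 ≤ d)
    (hsp : ∃ N : ℕ, ∀ p : ℕ, p.Prime → N ≤ p →
        IsFSplit p (MvPolynomial (Fin 3) (ZMod p) ⧸
          Ideal.span {MvPolynomial.map (Int.castRingHom (ZMod p)) f}))
    (G G' : Matrix (Fin 3) (Fin 3) ℂ) (hG : G * G' = 1) (a b : ℂ)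
    (hw : lin G (map (Int.castRingHom ℂ) f) = wei a b)
    (hab : 4 * a ^ 3 + 27 * b ^ 2 ≠ 0) (n0 m0 : ℤ) (hm0 : m0 ≠ 0)
    (hj : (m0 : ℂ) * (1728 * (4 * a ^ 3)) = n0 * (4 * a ^ 3 + 27 * b ^ 2)) : False := by
  obtain ⟨N0, h0⟩ := hsp
  obtain ⟨s, hs, F', hF', N, hN⟩ := nonsplit f d hf0 hhom hd G G' hG {a, b, (4 * a ^ 3 + 27 * b ^ 2)⁻¹}
    (by simp)
  obtain ⟨p, n, hp, hp1, hpn, hel⟩ := elkies n0 m0 hm0 (max N N0)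
  obtain ⟨K, _, _, χ, h⟩ := hN p hp (le_trans (le_max_left _ _) hp1.le)
  refine h ?_ (h0 p hp (le_trans (le_max_right _ _) hp1.le))
  have ma : a ∈ Algebra.adjoin ℤ s := Algebra.subset_adjoin (hs (by simp))
  have mb : b ∈ Algebra.adjoin ℤ s := Algebra.subset_adjoin (hs (by simp))
  have mu : (4 * a ^ 3 + 27 * b ^ 2)⁻¹ ∈ Algebra.adjoin ℤ s := Algebra.subset_adjoin (hs (by simp))
  obtain ⟨a', ha⟩ : ∃ a' : Algebra.adjoin ℤ s, (a' : ℂ) = a := ⟨⟨a, ma⟩, rfl⟩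
  obtain ⟨b', hb⟩ : ∃ a' : Algebra.adjoin ℤ s, (a' : ℂ) = b := ⟨⟨b, mb⟩, rfl⟩
  obtain ⟨u', hu⟩ : ∃ a' : Algebra.adjoin ℤ s, (a' : ℂ) = (4 * a ^ 3 + 27 * b ^ 2)⁻¹ := ⟨⟨_, mu⟩, rfl⟩
  have hF2 : F' = wei a' b' := by
    apply map_injective (Algebra.adjoin ℤ s).val.toRingHom Subtype.val_injective
    rw [hF', hw, map_wei]
    change _ = wei (a' : ℂ) (b' : ℂ)
    rw [ha, hb]
  have e1 : (4 * a' ^ 3 + 27 * b' ^ 2) * u' = 1 := by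
    apply Subtype.val_injective
    push_cast
    rw [ha, hb, hu]
    exact mul_inv_cancel₀ hab
  have e2 : (m0 : Algebra.adjoin ℤ s) * (1728 * (4 * a' ^ 3)) = n0 * (4 * a' ^ 3 + 27 * b' ^ 2) := by
    apply Subtype.val_injective
    push_cast
    rw [ha, hb]
    exact hj
  rw [hF2, map_wei]
  apply inFrob_wei p n hpn
  have e3 := congrArg χ e1
  have e4' := congrArg χ e2
  simp only [map_mul, map_add, map_pow, map_one, map_ofNat, map_intCast] at e3 e4'
  exact hel K (χ a') (χ b') (left_ne_zero_of_mul_eq_one e3) e4'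
end EK

end

section
namespace EK
open MvPolynomial

/-- set the first `k` variables to zero -/
noncomputable def zk (k : ℕ) : MvPolynomial (Fin 3) ℂ →ₐ[ℂ] MvPolynomial (Fin 3) ℂ :=
  aeval fun i => if i.val < k then 0 else X i

theorem zk_X (k : ℕ) (i : Fin 3) : zk k (X i) = if i.val < k then 0 else X i := by simp [zk]

theorem zk_lt (k : ℕ) (hk : k < 3) : RingHom.ker (zk k) < RingHom.ker (zk (k + 1)) := by
  rw [SetLike.lt_iff_le_and_exists]
  constructor
  · intro p h
    have : (zk (k + 1)).comp (zk k) = zk (k + 1) := by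
      ext i : 1
      rw [AlgHom.comp_apply, zk_X]
      split_ifs with h
      · rw [zk_X, if_pos (by omega), map_zero]
      · rfl
    rw [RingHom.mem_ker] at h ⊢
    rw [← this, AlgHom.comp_apply, h, map_zero]
  · refine ⟨X ⟨k, hk⟩, ?_, ?_⟩
    · rw [RingHom.mem_ker, zk_X, if_pos (by simp)]
    · rw [RingHom.mem_ker, zk_X, if_neg (by simp)]
      exact X_ne_zero _

theorem height_m : (3 : ℕ∞) ≤ (vanishingIdeal ℂ {(0 : Fin 3 → ℂ)} : Ideal (MvPolynomial (Fin 3) ℂ)).height := by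
  have hle : RingHom.ker (zk 3) ≤ vanishingIdeal ℂ {(0 : Fin 3 → ℂ)} := by
    intro p hp
    rw [mem_vanishingIdeal_singleton_iff]
    rw [RingHom.mem_ker] at hp
    have : (aeval (0 : Fin 3 → ℂ)).comp (zk 3) = aeval (R := ℂ) (0 : Fin 3 → ℂ) := by
      ext i : 1
      rw [AlgHom.comp_apply, zk_X]
      split_ifs <;> simp
    rw [← this, AlgHom.comp_apply, hp, map_zero]
  haveI h : ∀ k, (RingHom.ker (zk k)).IsPrime := fun k => RingHom.ker_isPrime _
  have h1 := Ideal.height_strict_mono_of_isPrime (zk_lt 0 (by norm_num))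
  have h2 := Ideal.height_strict_mono_of_isPrime (zk_lt 1 (by norm_num))
  have h3 := Ideal.height_strict_mono_of_isPrime (zk_lt 2 (by norm_num))
  refine le_trans ?_ (Ideal.height_mono hle)
  have a1 := Order.add_one_le_of_lt h1
  have a2 := Order.add_one_le_of_lt h2
  have a3 := Order.add_one_le_of_lt h3
  calc (3 : ℕ∞) = 0 + 1 + 1 + 1 := by norm_num
    _ ≤ (RingHom.ker (zk 0)).height + 1 + 1 + 1 := by gcongr; exact zero_le
    _ ≤ (RingHom.ker (zk 1)).height + 1 + 1 := by gcongr
    _ ≤ (RingHom.ker (zk 2)).height + 1 := by gcongr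
    _ ≤ _ := a3

theorem common_zero (F H : MvPolynomial (Fin 3) ℂ) {m n : ℕ} (hF : F.IsHomogeneous m) (hH : H.IsHomogeneous n)
    (hm : 1 ≤ m) (hn : 1 ≤ n) : ∃ v : Fin 3 → ℂ, v ≠ 0 ∧ eval v F = 0 ∧ eval v H = 0 := by
  by_contra hc
  push Not at hc
  have z : ∀ {P : MvPolynomial (Fin 3) ℂ} {k : ℕ}, P.IsHomogeneous k → 1 ≤ k → eval (0 : Fin 3 → ℂ) P = 0 := by
    intro P k hP hk
    rw [eval_zero, constantCoeff_eq]
    by_contra h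
    have := hP h
    simp at this
    omega
  have hz : zeroLocus ℂ (Ideal.span ({F, H} : Set (MvPolynomial (Fin 3) ℂ))) = {(0 : Fin 3 → ℂ)} := by
    rw [zeroLocus_span]
    ext v
    simp only [Set.mem_setOf_eq, Set.mem_insert_iff, Set.mem_singleton_iff, forall_eq_or_imp, forall_eq]
    constructor
    · rintro ⟨h1, h2⟩
      by_contra hv
      exact hc v hv (by simpa [aeval_eq_eval] using h1) (by simpa [aeval_eq_eval] using h2)
    · rintro rfl
      exact ⟨by simpa [aeval_eq_eval] using z hF hm, by simpa [aeval_eq_eval] using z hH hn⟩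
  have hr := vanishingIdeal_zeroLocus_eq_radical (K := ℂ) (Ideal.span ({F, H} : Set (MvPolynomial (Fin 3) ℂ)))
  rw [hz] at hr
  have hmin : vanishingIdeal ℂ {(0 : Fin 3 → ℂ)} ∈ (Ideal.span ({F, H} : Set (MvPolynomial (Fin 3) ℂ))).minimalPrimes := by
    refine ⟨⟨inferInstance, ?_⟩, fun Q hQ _ => ?_⟩
    · rw [hr]; exact Ideal.le_radical
    · rw [hr]
      exact hQ.1.radical_le_iff.2 hQ.2
  have h1 := Ideal.height_le_card_of_mem_minimalPrimes_span (Set.toFinite _) hmin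
  have h2 := le_trans height_m h1
  have h3 : ({F, H} : Set (MvPolynomial (Fin 3) ℂ)).ncard ≤ 2 := by
    have := Set.ncard_insert_le F {H}
    rw [Set.ncard_singleton] at this
    exact this
  have h4 : (3 : ℕ) ≤ ({F, H} : Set (MvPolynomial (Fin 3) ℂ)).ncard := by exact_mod_cast h2
  omega

/-- any nonzero vector is a column of an invertible matrix -/
theorem exists_col (v : Fin 3 → ℂ) (hv : v ≠ 0) (i : Fin 3) :
    ∃ G G' : Matrix (Fin 3) (Fin 3) ℂ, G * G' = 1 ∧ G.mulVec (Pi.single i 1) = v := by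
  obtain ⟨k, hk⟩ := Function.ne_iff.1 hv
  let e : Equiv.Perm (Fin 3) := Equiv.swap i k
  -- identity with column k replaced, then swap
  let A : Matrix (Fin 3) (Fin 3) ℂ := (1 : Matrix (Fin 3) (Fin 3) ℂ).updateCol k v
  have hA : A.det = v k := by
    have := Matrix.cramer_apply (1 : Matrix (Fin 3) (Fin 3) ℂ) v k
    rw [Matrix.cramer_one] at this
    exact this.symm
  have hu : IsUnit A.det := by rw [hA]; exact (Ne.isUnit hk)
  have hu2 : IsUnit (A.submatrix id e).det := by
    rw [Matrix.det_permute']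
    refine IsUnit.mul ?_ hu
    exact (Units.isUnit _).map (Int.castRingHom ℂ)
  refine ⟨A.submatrix id e, (A.submatrix id e)⁻¹, Matrix.mul_nonsing_inv _ hu2, ?_⟩
  rw [Matrix.mulVec_single_one]
  ext j
  simp [A, e]

end EK

end

section
namespace EK
open MvPolynomial

theorem finsupp3_ext {u v : Fin 3 →₀ ℕ} (h0 : u 0 = v 0) (h1 : u 1 = v 1) (h2 : u 2 = v 2) : u = v := by
  ext i
  fin_cases i
  · exact h0
  · exact h1
  · exact h2

/-- lexicographic order with `X 0 > X 1 > X 2` -/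
def lexlt (u v : Fin 3 →₀ ℕ) : Prop :=
  u 0 < v 0 ∨ (u 0 = v 0 ∧ (u 1 < v 1 ∨ (u 1 = v 1 ∧ u 2 < v 2)))

theorem lexlt_order : IsMonomialOrder lexlt := by
  refine ⟨?_, ?_, ?_⟩
  · have h1 : Std.Trichotomous lexlt := ⟨by
      intro u v h1 h2
      unfold lexlt at h1 h2
      apply finsupp3_ext <;> omega⟩
    have h2 : Std.Irrefl lexlt := ⟨by
      intro u h
      unfold lexlt at h
      omega⟩
    have h3 : IsTrans _ lexlt := ⟨by
      intro u v w h1 h2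
      unfold lexlt at h1 h2 ⊢
      omega⟩
    exact {}
  · intro u hu
    unfold lexlt
    simp only [Finsupp.coe_zero, Pi.zero_apply]
    by_contra h
    apply hu
    apply finsupp3_ext <;> simp <;> omega
  · intro u v w h
    unfold lexlt at h ⊢
    simp only [Finsupp.add_apply]
    omega

/-- the exponent vector `(a, b, c)` -/
noncomputable def ex (a b c : ℕ) : Fin 3 →₀ ℕ := Finsupp.equivFunOnFinite.symm ![a, b, c]

@[simp] theorem ex_0 (a b c : ℕ) : ex a b c 0 = a := rfl
@[simp] theorem ex_1 (a b c : ℕ) : ex a b c 1 = b := rfl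
@[simp] theorem ex_2 (a b c : ℕ) : ex a b c 2 = c := rfl
@[simp] theorem ex_inj (a b c a' b' c' : ℕ) : ex a b c = ex a' b' c' ↔ a = a' ∧ b = b' ∧ c = c' := by
  constructor
  · intro h
    exact ⟨DFunLike.congr_fun h 0, DFunLike.congr_fun h 1, DFunLike.congr_fun h 2⟩
  · rintro ⟨rfl, rfl, rfl⟩; rfl

theorem ex_surj (e : Fin 3 →₀ ℕ) : ∃ a b c, e = ex a b c :=
  ⟨e 0, e 1, e 2, finsupp3_ext rfl rfl rfl⟩

theorem mono_ex {R : Type*} [CommRing R] (a b c : ℕ) (r : R) :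
    monomial (ex a b c) r = C r * X 0 ^ a * X 1 ^ b * X 2 ^ c := by
  rw [monomial_eq, Finsupp.prod_fintype _ _ (by simp), Fin.prod_univ_three]
  simp [mul_assoc]

theorem hom_sum {R : Type*} [CommRing R] {F : MvPolynomial (Fin 3) R} {d : ℕ} (hF : F.IsHomogeneous d) {a b c : ℕ}
    (h : coeff (ex a b c) F ≠ 0) : a + b + c = d := by
  have := hF h
  rw [Finsupp.weight_apply, Finsupp.sum_fintype _ _ (by simp), Fin.sum_univ_three] at this
  simpa using this

def Good (F : MvPolynomial (Fin 3) ℂ) : Prop :=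
  ∃ φ : MvPolynomial (Fin 3) ℂ ≃ₐ[ℂ] MvPolynomial (Fin 3) ℂ,
    ∃ lt : (Fin 3 →₀ ℕ) → (Fin 3 →₀ ℕ) → Prop, IsMonomialOrder lt ∧
      ∃ m : Fin 3 →₀ ℕ, IsLeadingMonomial lt (φ F) m ∧ ∀ i, m i ≤ 1

def Bad (F : MvPolynomial (Fin 3) ℂ) : Prop :=
  ∃ (G G' : Matrix (Fin 3) (Fin 3) ℂ) (w : Fin 3 → ℕ), G * G' = 1 ∧
    ∀ e, coeff e (lin G F) ≠ 0 → ∑ i, w i < ∑ i, w i * e i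

def Ell (F : MvPolynomial (Fin 3) ℂ) : Prop :=
  ∃ (G G' : Matrix (Fin 3) (Fin 3) ℂ) (a b : ℂ), G * G' = 1 ∧ 4 * a ^ 3 + 27 * b ^ 2 ≠ 0 ∧ lin G F = wei a b

def Cls (F : MvPolynomial (Fin 3) ℂ) : Prop := Good F ∨ Bad F ∨ Ell F

/-- linear automorphism -/
noncomputable def linEquiv (G G' : Matrix (Fin 3) (Fin 3) ℂ) (h : G * G' = 1) :
    MvPolynomial (Fin 3) ℂ ≃ₐ[ℂ] MvPolynomial (Fin 3) ℂ :=
  AlgEquiv.ofAlgHom (lin G) (lin G')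
    (by ext i : 1
        rw [AlgHom.comp_apply, lin_lin, mul_eq_one_comm.1 h, lin_one]; rfl)
    (by ext i : 1
        rw [AlgHom.comp_apply, lin_lin, h, lin_one]; rfl)

theorem inv_mul4 {G G' H H' : Matrix (Fin 3) (Fin 3) ℂ} (h : G * G' = 1) (h' : H * H' = 1) :
    G * H * (H' * G') = 1 := by
  rw [Matrix.mul_assoc, ← Matrix.mul_assoc H, h', Matrix.one_mul, h]

theorem cls_lin {F : MvPolynomial (Fin 3) ℂ} (G G' : Matrix (Fin 3) (Fin 3) ℂ) (h : G * G' = 1)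
    (hc : Cls (lin G F)) : Cls F := by
  rcases hc with ⟨φ, lt, ho, m, hl, hm⟩ | ⟨H, H', w, hH, hw⟩ | ⟨H, H', a, b, hH, hab, he⟩
  · exact Or.inl ⟨(linEquiv G G' h).trans φ, lt, ho, m, hl, hm⟩
  · refine Or.inr (Or.inl ⟨G * H, H' * G', w, inv_mul4 h hH, ?_⟩)
    rwa [lin_lin] at hw
  · refine Or.inr (Or.inr ⟨G * H, H' * G', a, b, inv_mul4 h hH, hab, ?_⟩)
    rwa [lin_lin] at he

theorem cls_lex {F : MvPolynomial (Fin 3) ℂ} (a b c : ℕ) (ha : a ≤ 1) (hb : b ≤ 1) (hc : c ≤ 1)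
    (h0 : coeff (ex a b c) F ≠ 0)
    (h : ∀ a' b' c', coeff (ex a' b' c') F ≠ 0 → a' < a ∨ a' = a ∧ (b' < b ∨ b' = b ∧ c' ≤ c)) : Cls F := by
  refine Or.inl ⟨AlgEquiv.refl, lexlt, lexlt_order, ex a b c, ⟨?_, ?_⟩, ?_⟩
  · simpa using h0
  · intro e he hne
    obtain ⟨a', b', c', rfl⟩ := ex_surj e
    have := h a' b' c' (by simpa using he)
    rw [Ne, ex_inj] at hne
    unfold lexlt
    simp only [ex_0, ex_1, ex_2]
    omega
  · intro i
    fin_cases i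
    · exact ha
    · exact hb
    · exact hc

theorem cls_weight {F : MvPolynomial (Fin 3) ℂ} (u v w : ℕ)
    (h : ∀ a b c, coeff (ex a b c) F ≠ 0 → u + v + w < u * a + v * b + w * c) : Cls F := by
  refine Or.inr (Or.inl ⟨1, 1, ![u, v, w], Matrix.one_mul _, ?_⟩)
  rw [lin_one]
  intro e he
  obtain ⟨a, b, c, rfl⟩ := ex_surj e
  have := h a b c he
  simpa [Fin.sum_univ_three] using this

theorem cls_one {F : MvPolynomial (Fin 3) ℂ} (hF : F.IsHomogeneous 1) (h0 : F ≠ 0) : Cls F := by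
  by_cases h1 : coeff (ex 1 0 0) F ≠ 0
  · refine cls_lex 1 0 0 (by simp) (by simp) (by simp) h1 fun a b c h => ?_
    have := hom_sum hF h
    omega
  by_cases h2 : coeff (ex 0 1 0) F ≠ 0
  · refine cls_lex 0 1 0 (by simp) (by simp) (by simp) h2 fun a b c h => ?_
    have := hom_sum hF h
    by_cases ha : a = 1
    · obtain rfl : b = 0 := by omega
      obtain rfl : c = 0 := by omega
      subst ha
      exact absurd h h1
    · omega
  by_cases h3 : coeff (ex 0 0 1) F ≠ 0
  · refine cls_lex 0 0 1 (by simp) (by simp) (by simp) h3 fun a b c h => ?_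
    have := hom_sum hF h
    by_cases ha : a = 1
    · obtain rfl : b = 0 := by omega
      obtain rfl : c = 0 := by omega
      subst ha
      exact absurd h h1
    by_cases hb : b = 1
    · obtain rfl : a = 0 := by omega
      obtain rfl : c = 0 := by omega
      subst hb
      exact absurd h h2
    · omega
  exfalso
  apply h0
  ext e
  rw [coeff_zero]
  by_contra h
  obtain ⟨a, b, c, rfl⟩ := ex_surj e
  have := hom_sum hF h
  have : (a = 1 ∧ b = 0 ∧ c = 0) ∨ (a = 0 ∧ b = 1 ∧ c = 0) ∨ (a = 0 ∧ b = 0 ∧ c = 1) := by omega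
  rcases this with ⟨rfl, rfl, rfl⟩ | ⟨rfl, rfl, rfl⟩ | ⟨rfl, rfl, rfl⟩ <;> contradiction

/-- general conic -/
noncomputable def qua {R : Type*} [CommRing R] (a b c d e f : R) : MvPolynomial (Fin 3) R :=
  C a * X 0 ^ 2 + C b * X 0 * X 1 + C c * X 0 * X 2 + C d * X 1 ^ 2 + C e * X 1 * X 2 + C f * X 2 ^ 2

/-- general cubic -/
noncomputable def cub {R : Type*} [CommRing R] (a b c d e f g h i j : R) : MvPolynomial (Fin 3) R :=
  C a * X 0 ^ 3 + C b * X 0 ^ 2 * X 1 + C c * X 0 ^ 2 * X 2 + C d * X 0 * X 1 ^ 2 + C e * X 0 * X 1 * X 2 +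
   C f * X 0 * X 2 ^ 2 + C g * X 1 ^ 3 + C h * X 1 ^ 2 * X 2 + C i * X 1 * X 2 ^ 2 + C j * X 2 ^ 3

theorem qua_mono {R : Type*} [CommRing R] (a b c d e f : R) : qua a b c d e f =
    monomial (ex 2 0 0) a + monomial (ex 1 1 0) b + monomial (ex 1 0 1) c + monomial (ex 0 2 0) d +
     monomial (ex 0 1 1) e + monomial (ex 0 0 2) f := by
  simp only [mono_ex, qua, pow_zero, pow_one, mul_one]

theorem cub_mono {R : Type*} [CommRing R] (a b c d e f g h i j : R) : cub a b c d e f g h i j =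
    monomial (ex 3 0 0) a + monomial (ex 2 1 0) b + monomial (ex 2 0 1) c + monomial (ex 1 2 0) d +
     monomial (ex 1 1 1) e + monomial (ex 1 0 2) f + monomial (ex 0 3 0) g + monomial (ex 0 2 1) h +
     monomial (ex 0 1 2) i + monomial (ex 0 0 3) j := by
  simp only [mono_ex, cub, pow_zero, pow_one, mul_one]

theorem qua_eq {R : Type*} [CommRing R] {F : MvPolynomial (Fin 3) R} (hF : F.IsHomogeneous 2) :
    F = qua (coeff (ex 2 0 0) F) (coeff (ex 1 1 0) F) (coeff (ex 1 0 1) F) (coeff (ex 0 2 0) F)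
      (coeff (ex 0 1 1) F) (coeff (ex 0 0 2) F) := by
  rw [qua_mono]
  ext e
  obtain ⟨a, b, c, rfl⟩ := ex_surj e
  simp only [coeff_add, coeff_monomial, ex_inj]
  by_cases h : a + b + c = 2
  · have ha : a ≤ 2 := by omega
    have hb : b ≤ 2 := by omega
    obtain rfl : c = 2 - a - b := by omega
    interval_cases a <;> interval_cases b <;> simp at h ⊢
  · have h0 : coeff (ex a b c) F = 0 := by
      by_contra h0
      exact h (hom_sum hF h0)
    rw [h0]
    repeat rw [if_neg (by omega)]
    simp

theorem cub_eq {R : Type*} [CommRing R] {F : MvPolynomial (Fin 3) R} (hF : F.IsHomogeneous 3) :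
    F = cub (coeff (ex 3 0 0) F) (coeff (ex 2 1 0) F) (coeff (ex 2 0 1) F) (coeff (ex 1 2 0) F)
      (coeff (ex 1 1 1) F) (coeff (ex 1 0 2) F) (coeff (ex 0 3 0) F) (coeff (ex 0 2 1) F)
      (coeff (ex 0 1 2) F) (coeff (ex 0 0 3) F) := by
  rw [cub_mono]
  ext e
  obtain ⟨a, b, c, rfl⟩ := ex_surj e
  simp only [coeff_add, coeff_monomial, ex_inj]
  by_cases h : a + b + c = 3
  · have ha : a ≤ 3 := by omega
    have hb : b ≤ 3 := by omega
    obtain rfl : c = 3 - a - b := by omega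
    interval_cases a <;> interval_cases b <;> simp at h ⊢
  · have h0 : coeff (ex a b c) F = 0 := by
      by_contra h0
      exact h (hom_sum hF h0)
    rw [h0]
    repeat rw [if_neg (by omega)]
    simp

end EK

end

section
namespace EK
open MvPolynomial

theorem quad_root (d e f : ℂ) (hd : d ≠ 0) : ∃ r, d * r ^ 2 + e * r + f = 0 := by
  obtain ⟨s, hs⟩ := IsAlgClosed.exists_pow_nat_eq (discrim d e f) (n := 2) (by norm_num)
  obtain ⟨r, hr⟩ := exists_quadratic_eq_zero hd ⟨s, by rw [← hs]; ring⟩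
  exact ⟨r, by rw [← hr]; ring⟩

/-- the change of variables `x = r x' + y'`, `y = x'` -/
theorem bin_inv (r : ℂ) : (!![1, 0, 0; 0, r, 1; 0, 1, 0] : Matrix (Fin 3) (Fin 3) ℂ) *
    !![1, 0, 0; 0, 0, 1; 0, 1, -r] = 1 := by
  ext i j
  fin_cases i <;> fin_cases j <;> simp [Matrix.mul_apply, Fin.sum_univ_three]

theorem cls_qua0 (d e f : ℂ) : Cls (qua 0 0 0 d e f) := by
  have key : ∀ e f : ℂ, Cls (qua 0 0 0 0 e f) := by
    intro e f
    by_cases he : e = 0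
    · apply cls_weight 0 0 1
      intro a b c h
      rw [qua_mono] at h
      simp only [coeff_add, coeff_monomial, ex_inj, he] at h
      by_contra hc
      apply h
      simp only [ite_self, zero_add]
      repeat rw [if_neg (by omega)]
    · apply cls_lex 0 1 1 (by simp) (by simp) (by simp)
      · rw [qua_mono]
        simpa [coeff_monomial] using he
      · intro a b c h
        rw [qua_mono] at h
        simp only [coeff_add, coeff_monomial, ex_inj] at h
        by_contra hc
        apply h
        simp only [ite_self, zero_add]
        repeat rw [if_neg (by omega)]
        simp
  by_cases hd : d = 0
  · rw [hd]; exact key e f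
  obtain ⟨r, hr⟩ := quad_root d e f hd
  apply cls_lin _ _ (bin_inv r)
  convert key (2 * d * r + e) d using 1
  simp only [qua, map_add, map_mul, map_pow, lin_X, lin_C, Fin.sum_univ_three]
  simp
  rw [← sub_eq_zero]
  transitivity C (d * r ^ 2 + e * r + f) * X 1 ^ 2
  · simp only [map_add, map_mul, map_pow, map_ofNat]
    ring
  · rw [hr]; simp

theorem cls_qua1 (b c d e f : ℂ) : Cls (qua 0 b c d e f) := by
  have key : ∀ b c d e f : ℂ, b ≠ 0 → Cls (qua 0 b c d e f) := by
    intro b c d e f hb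
    apply cls_lex 1 1 0 (by simp) (by simp) (by simp)
    · rw [qua_mono]
      simpa [coeff_monomial] using hb
    · intro a b c h
      rw [qua_mono] at h
      simp only [coeff_add, coeff_monomial, ex_inj] at h
      by_contra hc
      apply h
      simp only [ite_self, zero_add]
      repeat rw [if_neg (by omega)]
      simp
  by_cases hb : b ≠ 0
  · exact key _ _ _ _ _ hb
  by_cases hc : c ≠ 0
  · apply cls_lin _ _ (bin_inv 0)
    convert key c b f e d hc using 1
    simp only [qua, map_add, map_mul, map_pow, lin_X, lin_C, Fin.sum_univ_three]
    simp
    ring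
  push Not at hb hc
  rw [hb, hc]
  exact cls_qua0 _ _ _

theorem single_lin {F : MvPolynomial (Fin 3) ℂ} {G : Matrix (Fin 3) (Fin 3) ℂ} {v : Fin 3 → ℂ} {i : Fin 3}
    (h : G.mulVec (Pi.single i 1) = v) : eval (Pi.single i 1) (lin G F) = eval v F := by
  rw [eval_lin, h]

theorem cls_two {F : MvPolynomial (Fin 3) ℂ} (hF : F.IsHomogeneous 2) : Cls F := by
  obtain ⟨v, hv, h1, -⟩ := common_zero F F hF hF (by norm_num) (by norm_num)
  obtain ⟨G, G', hG, hGv⟩ := exists_col v hv 0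
  apply cls_lin G G' hG
  have h2 := single_lin (F := F) hGv
  rw [h1, qua_eq (lin_hom G hF)] at h2
  rw [qua_eq (lin_hom G hF)]
  have h3 : coeff (ex 2 0 0) (lin G F) = 0 := by
    simpa [qua] using h2
  rw [h3]
  exact cls_qua1 _ _ _ _ _

def Sing (F : MvPolynomial (Fin 3) ℂ) : Prop := ∃ v : Fin 3 → ℂ, v ≠ 0 ∧ ∀ i, eval v (pderiv i F) = 0

theorem eval_pderiv_lin (G : Matrix (Fin 3) (Fin 3) ℂ) (i : Fin 3) (F : MvPolynomial (Fin 3) ℂ) (v : Fin 3 → ℂ) :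
    eval v (pderiv i (lin G F)) = (G.transpose.mulVec fun j => eval (G.mulVec v) (pderiv j F)) i := by
  rw [pderiv_lin, map_sum]
  simp [Matrix.mulVec, dotProduct, eval_lin]

theorem sing_lin {F : MvPolynomial (Fin 3) ℂ} (G G' : Matrix (Fin 3) (Fin 3) ℂ) (h : G * G' = 1)
    (hs : Sing (lin G F)) : Sing F := by
  obtain ⟨v, hv, h1⟩ := hs
  have h2 : (fun j => eval (G.mulVec v) (pderiv j F)) = 0 := by
    have h3 : G.transpose.mulVec (fun j => eval (G.mulVec v) (pderiv j F)) = 0 := by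
      ext i
      rw [← eval_pderiv_lin, h1]; rfl
    have h4 : G'.transpose * G.transpose = 1 := by
      rw [← Matrix.transpose_mul, h, Matrix.transpose_one]
    have h5 := congrArg (G'.transpose.mulVec) h3
    rwa [Matrix.mulVec_mulVec, h4, Matrix.one_mulVec, Matrix.mulVec_zero] at h5
  refine ⟨G.mulVec v, fun h0 => hv ?_, fun i => congrFun h2 i⟩
  have h5 := congrArg (G'.mulVec) h0
  rwa [Matrix.mulVec_mulVec, mul_eq_one_comm.1 h, Matrix.one_mulVec, Matrix.mulVec_zero] at h5

theorem cls_cub0 (d e f g h i j : ℂ) : Cls (cub 0 0 0 d e f g h i j) := by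
  have key : ∀ e f g h i j : ℂ, Cls (cub 0 0 0 0 e f g h i j) := by
    intro e f g h i j
    by_cases he : e = 0
    · apply cls_weight 0 2 3
      intro a b c h
      rw [cub_mono] at h
      simp only [coeff_add, coeff_monomial, ex_inj, he] at h
      by_contra hc
      apply h
      simp only [ite_self, zero_add]
      repeat rw [if_neg (by omega)]
      simp
    · apply cls_lex 1 1 1 (by simp) (by simp) (by simp)
      · rw [cub_mono]
        simpa [coeff_monomial] using he
      · intro a b c h
        rw [cub_mono] at h
        simp only [coeff_add, coeff_monomial, ex_inj] at h
        by_contra hc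
        apply h
        simp only [ite_self, zero_add]
        repeat rw [if_neg (by omega)]
        simp
  by_cases hd : d = 0
  · rw [hd]; exact key _ _ _ _ _ _
  obtain ⟨r, hr⟩ := quad_root d e f hd
  apply cls_lin _ _ (bin_inv r)
  convert key (2 * d * r + e) d (g * r ^ 3 + h * r ^ 2 + i * r + j) (3 * g * r ^ 2 + 2 * h * r + i)
    (3 * g * r + h) g using 1
  simp only [cub, map_add, map_mul, map_pow, lin_X, lin_C, Fin.sum_univ_three]
  simp
  rw [← sub_eq_zero]
  transitivity C (d * r ^ 2 + e * r + f) * X 0 * X 1 ^ 2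
  · simp only [map_add, map_mul, map_pow, map_ofNat]
    ring
  · rw [hr]; simp

theorem cls_sing {F : MvPolynomial (Fin 3) ℂ} (hF : F.IsHomogeneous 3) (hs : Sing F) : Cls F := by
  obtain ⟨v, hv, h1⟩ := hs
  obtain ⟨G, G', hG, hGv⟩ := exists_col v hv 0
  apply cls_lin G G' hG
  have h2 : ∀ i, eval (Pi.single 0 1) (pderiv i (lin G F)) = 0 := by
    intro i
    rw [eval_pderiv_lin, hGv]
    simp [h1, Matrix.mulVec, dotProduct]
  rw [cub_eq (lin_hom G hF)] at h2 ⊢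
  have e0 := h2 0
  have e1 := h2 1
  have e2 := h2 2
  simp [cub, pderiv_X, Pi.single_apply] at e0 e1 e2
  rw [e0, e1, e2]
  exact cls_cub0 _ _ _ _ _ _ _

end EK

end

section
namespace EK
open MvPolynomial

section Hess
variable {R : Type*} [CommRing R]

/-- Hessian matrix -/
noncomputable def Hmat (F : MvPolynomial (Fin 3) R) : Matrix (Fin 3) (Fin 3) (MvPolynomial (Fin 3) R) :=
  Matrix.of fun i j => pderiv i (pderiv j F)

/-- Hessian determinant -/
noncomputable def He (F : MvPolynomial (Fin 3) R) : MvPolynomial (Fin 3) R := (Hmat F).det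

/-- the covariant of degree 5 -/
noncomputable def Tc (F : MvPolynomial (Fin 3) R) : MvPolynomial (Fin 3) R :=
  ((Hmat F).adjugate * Hmat (He F)).trace

theorem Hmat_map {S : Type*} [CommRing S] (χ : R →+* S) (F : MvPolynomial (Fin 3) R) :
    Hmat (map χ F) = (Hmat F).map (map χ) := by
  ext1 i j
  simp [Hmat, pderiv_map]

theorem He_map {S : Type*} [CommRing S] (χ : R →+* S) (F : MvPolynomial (Fin 3) R) :
    He (map χ F) = map χ (He F) := by
  unfold He
  rw [Hmat_map, RingHom.map_det]; rfl

theorem Tc_map {S : Type*} [CommRing S] (χ : R →+* S) (F : MvPolynomial (Fin 3) R) :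
    Tc (map χ F) = map χ (Tc F) := by
  unfold Tc
  rw [He_map, Hmat_map, Hmat_map]
  have h := RingHom.map_adjugate (map χ) (Hmat F)
  rw [RingHom.mapMatrix_apply, RingHom.mapMatrix_apply] at h
  rw [← h]
  simp [Matrix.trace, Matrix.mul_apply]

theorem Hmat_lin (G : Matrix (Fin 3) (Fin 3) R) (F : MvPolynomial (Fin 3) R) :
    Hmat (lin G F) = (G.map C).transpose * (Hmat F).map (lin G) * G.map C := by
  ext1 i j
  simp only [Hmat, Matrix.mul_apply, Matrix.of_apply, Matrix.map_apply, Matrix.transpose_apply]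
  rw [pderiv_lin, map_sum]
  refine Finset.sum_congr rfl fun k _ => ?_
  rw [pderiv_C_mul, pderiv_lin, mul_comm]

theorem Hmat_C_mul (c : R) (F : MvPolynomial (Fin 3) R) : Hmat (C c * F) = (C c : MvPolynomial (Fin 3) R) • Hmat F := by
  ext1 i j
  simp [Hmat, pderiv_C_mul, smul_eq_C_mul]

theorem He_C_mul (c : R) (F : MvPolynomial (Fin 3) R) : He (C c * F) = C (c ^ 3) * He F := by
  unfold He
  rw [Hmat_C_mul, Matrix.det_smul]
  simp

theorem det_C (G : Matrix (Fin 3) (Fin 3) R) :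
    (G.map (C : R →+* MvPolynomial (Fin 3) R)).det = C G.det := by
  rw [RingHom.map_det]; rfl

theorem He_lin (G : Matrix (Fin 3) (Fin 3) R) (F : MvPolynomial (Fin 3) R) :
    He (lin G F) = C (G.det ^ 2) * lin G (He F) := by
  unfold He
  have h := RingHom.map_det (lin G).toRingHom (Hmat F)
  change lin G (Hmat F).det = ((Hmat F).map (lin G)).det at h
  rw [Hmat_lin, Matrix.det_mul, Matrix.det_mul, Matrix.det_transpose, det_C, h, C_pow]
  ring

theorem Tc_lin (G : Matrix (Fin 3) (Fin 3) R) (F : MvPolynomial (Fin 3) R) :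
    Tc (lin G F) = C (G.det ^ 4) * lin G (Tc F) := by
  unfold Tc
  rw [He_lin, Hmat_C_mul, Hmat_lin, Hmat_lin]
  have h := RingHom.map_adjugate (lin G).toRingHom (Hmat F)
  change (Hmat F).adjugate.map (lin G) = ((Hmat F).map (lin G)).adjugate at h
  have h2 : lin G ((Hmat F).adjugate * Hmat (He F)).trace =
      (((Hmat F).adjugate.map (lin G)) * (Hmat (He F)).map (lin G)).trace := by
    simp [Matrix.trace, Matrix.mul_apply]
  rw [h2, h]
  generalize (Hmat F).map (lin G) = M
  generalize (Hmat (He F)).map (lin G) = N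
  rw [Matrix.adjugate_mul_distrib, Matrix.adjugate_mul_distrib]
  generalize hg : G.map (C : R →+* MvPolynomial (Fin 3) R) = g
  have hd : g.det = C G.det := by rw [← hg, det_C]
  rw [Matrix.mul_smul, Matrix.trace_smul]
  have e1 : g.adjugate * (M.adjugate * g.transpose.adjugate) * (g.transpose * N * g) =
      g.adjugate * (M.adjugate * (g.transpose.adjugate * g.transpose) * N * g) := by
    simp only [Matrix.mul_assoc]
  rw [e1, Matrix.adjugate_mul, Matrix.trace_mul_comm, Matrix.det_transpose]
  rw [Matrix.mul_assoc, Matrix.mul_adjugate, hd]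
  simp only [Matrix.mul_smul, Matrix.smul_mul, Matrix.mul_one, Matrix.trace_smul, smul_eq_mul, C_pow]
  ring

theorem He_hom {F : MvPolynomial (Fin 3) R} (hF : F.IsHomogeneous 3) : (He F).IsHomogeneous 3 := by
  have h : ∀ i j, (Hmat F i j).IsHomogeneous 1 := fun i j => (hF.pderiv (i := j)).pderiv (i := i)
  unfold He
  rw [Matrix.det_fin_three]
  have m : ∀ i j k l u v, (Hmat F i j * Hmat F k l * Hmat F u v).IsHomogeneous 3 := fun i j k l u v =>
    ((h i j).mul (h k l)).mul (h u v)
  exact (((((m _ _ _ _ _ _).sub (m _ _ _ _ _ _)).sub (m _ _ _ _ _ _)).add (m _ _ _ _ _ _)).add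
    (m _ _ _ _ _ _)).sub (m _ _ _ _ _ _)

theorem Hmat_cub (a b c d e f g h i j : R) : Hmat (cub a b c d e f g h i j) =
    !![6 * C a * X 0 + 2 * C b * X 1 + 2 * C c * X 2, 2 * C b * X 0 + 2 * C d * X 1 + C e * X 2,
        2 * C c * X 0 + C e * X 1 + 2 * C f * X 2;
      2 * C b * X 0 + 2 * C d * X 1 + C e * X 2, 2 * C d * X 0 + 6 * C g * X 1 + 2 * C h * X 2,
        C e * X 0 + 2 * C h * X 1 + 2 * C i * X 2;
      2 * C c * X 0 + C e * X 1 + 2 * C f * X 2, C e * X 0 + 2 * C h * X 1 + 2 * C i * X 2,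
        2 * C f * X 0 + 2 * C i * X 1 + 6 * C j * X 2] := by
  have hn : ∀ (i : Fin 3) (n : ℕ) [n.AtLeastTwo], pderiv i (ofNat(n) : MvPolynomial (Fin 3) R) = 0 := by
    intro i n _
    exact Derivation.map_natCast _ n
  ext1 k l
  unfold Hmat cub
  fin_cases k <;> fin_cases l <;> simp [pderiv_X, Pi.single_apply, hn] <;> ring

theorem wei_cub (a b : R) : wei a b = cub (-b) (-a) 0 0 0 1 (-1) 0 0 0 := by
  simp only [wei, cub, map_neg, map_zero, map_one]
  ring

theorem He_wei (a b : R) : He (wei a b) = cub (-(8 * a ^ 2)) (72 * b) 0 (24 * a) 0 0 0 0 24 0 := by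
  unfold He
  rw [wei_cub, Hmat_cub, Matrix.det_fin_three]
  simp [cub, map_ofNat C]
  ring

theorem Tc_wei (a b : R) : Tc (wei a b) = C (-576 * a) * wei a b := by
  unfold Tc
  rw [He_wei, wei_cub, Hmat_cub, Hmat_cub, Matrix.adjugate_fin_three_of]
  simp [Matrix.trace, Matrix.mul_apply, Fin.sum_univ_three, cub, map_ofNat C]
  ring

theorem HeHe_wei (a b : R) : He (He (wei a b)) = C (110592 * a ^ 2) * wei a b + C (-13824 * b) * He (wei a b) := by
  rw [He_wei]
  unfold He
  rw [wei_cub, Hmat_cub, Matrix.det_fin_three]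
  simp [cub, map_ofNat C]
  ring
end Hess
end EK

end

section
namespace EK
open MvPolynomial

/-- step lemmas: `Cls` given not singular -/
theorem step (F H : MvPolynomial (Fin 3) ℂ) (G G' : Matrix (Fin 3) (Fin 3) ℂ) (hG : G * G' = 1)
    (e : lin G F = H) (hs : ¬ Sing F) (h : ¬ Sing H → Cls H) : Cls F := by
  apply cls_lin G G' hG
  rw [e]
  apply h
  rw [← e]
  exact fun h => hs (sing_lin G G' hG h)

theorem pderiv_ofNat' {R : Type*} [CommRing R] (i : Fin 3) (n : ℕ) [n.AtLeastTwo] :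
    pderiv i (ofNat(n) : MvPolynomial (Fin 3) R) = 0 := Derivation.map_natCast _ n

theorem sm5 (a b : ℂ) (hs : ¬ Sing (wei a b)) : Cls (wei a b) := by
  refine Or.inr (Or.inr ⟨1, 1, a, b, Matrix.one_mul _, ?_, lin_one _⟩)
  intro h0
  apply hs
  by_cases ha : a = 0
  · have hb : b = 0 := by
      rw [ha] at h0
      simpa using h0
    refine ⟨![1, 0, 0], fun h => by simpa using congrFun h 0, fun i => ?_⟩
    fin_cases i <;> simp [wei, ha, hb, pderiv_X, Pi.single_apply, pderiv_ofNat']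
  · refine ⟨![1, -3 * b / (2 * a), 0], fun h => by simpa using congrFun h 0, fun i => ?_⟩
    fin_cases i <;> simp [wei, pderiv_X, Pi.single_apply, pderiv_ofNat']
    · field_simp
      ring
    · field_simp
      linear_combination (-1 : ℂ) * h0

theorem lin_cub (G : Matrix (Fin 3) (Fin 3) ℂ) (a b c d e f g h i j : ℂ) :
    lin G (cub a b c d e f g h i j) =
      let Z := C (G 0 0) * X 0 + C (G 0 1) * X 1 + C (G 0 2) * X 2
      let U := C (G 1 0) * X 0 + C (G 1 1) * X 1 + C (G 1 2) * X 2
      let Y := C (G 2 0) * X 0 + C (G 2 1) * X 1 + C (G 2 2) * X 2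
      C a * Z ^ 3 + C b * Z ^ 2 * U + C c * Z ^ 2 * Y + C d * Z * U ^ 2 + C e * Z * U * Y +
        C f * Z * Y ^ 2 + C g * U ^ 3 + C h * U ^ 2 * Y + C i * U * Y ^ 2 + C j * Y ^ 3 := by
  simp only [cub, map_add, map_mul, map_pow, lin_X, lin_C, Fin.sum_univ_three]

theorem sm4 (a b t : ℂ) (hs : ¬ Sing (cub a b 0 (3 * t) 0 1 (-1) 0 0 0)) :
    Cls (cub a b 0 (3 * t) 0 1 (-1) 0 0 0) := by
  refine step _ (wei (-(b + 3 * t ^ 2)) (-(a + b * t + 2 * t ^ 3)))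
    !![1, 0, 0; t, 1, 0; 0, 0, 1] !![1, 0, 0; -t, 1, 0; 0, 0, 1] ?_ ?_ hs (sm5 _ _)
  · ext i j
    fin_cases i <;> fin_cases j <;> simp [Matrix.mul_apply, Fin.sum_univ_three]
  · rw [lin_cub]
    simp [wei, map_ofNat C]
    ring

theorem sm3 (a b d g : ℂ) (hs : ¬ Sing (cub a b 0 d 0 1 g 0 0 0)) : Cls (cub a b 0 d 0 1 g 0 0 0) := by
  by_cases hg : g = 0
  · exfalso
    apply hs
    obtain ⟨s, h⟩ := IsAlgClosed.exists_pow_nat_eq (-d) (n := 2) (by norm_num)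
    refine ⟨![0, 1, s], fun h => by simpa using congrFun h 1, fun i => ?_⟩
    fin_cases i <;> simp [cub, hg, h, pderiv_X, Pi.single_apply, pderiv_ofNat']
  · obtain ⟨t, ht⟩ := IsAlgClosed.exists_pow_nat_eq (-g⁻¹) (n := 3) (by norm_num)
    have ht0 : t ≠ 0 := by
      rintro rfl
      simp at ht
      exact hg ht
    have hgt : g * t ^ 3 = -1 := by rw [ht]; field_simp
    refine step _ (cub a (b * t) 0 (3 * (d * t ^ 2 / 3)) 0 1 (-1) 0 0 0)
      !![1, 0, 0; 0, t, 0; 0, 0, 1] !![1, 0, 0; 0, t⁻¹, 0; 0, 0, 1] ?_ ?_ hs (sm4 _ _ _)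
    · ext i j
      fin_cases i <;> fin_cases j <;> simp [Matrix.mul_apply, Fin.sum_univ_three, ht0]
    · rw [lin_cub, ← hgt, mul_div_cancel₀ _ (by norm_num)]
      simp [cub]
      ring

theorem sm2 (a b c d e g : ℂ) (hs : ¬ Sing (cub a b (2 * c) d (2 * e) 1 g 0 0 0)) :
    Cls (cub a b (2 * c) d (2 * e) 1 g 0 0 0) := by
  refine step _ (cub (a - c ^ 2) (b - 2 * c * e) 0 (d - e ^ 2) 0 1 g 0 0 0)
    !![1, 0, 0; 0, 1, 0; -c, -e, 1] !![1, 0, 0; 0, 1, 0; c, e, 1] ?_ ?_ hs (sm3 _ _ _ _)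
  · ext i j
    fin_cases i <;> fin_cases j <;> simp [Matrix.mul_apply, Fin.sum_univ_three]
  · rw [lin_cub]
    simp [cub, map_ofNat C]
    ring

theorem sm1 (a b c d e g : ℂ) (hs : ¬ Sing (cub a b c d e 1 g 0 0 0)) :
    Cls (cub a b c d e 1 g 0 0 0) := by
  have := sm2 a b (c / 2) d (e / 2) g
  rw [mul_div_cancel₀ _ (by norm_num), mul_div_cancel₀ _ (by norm_num)] at this
  exact this hs

theorem sm0 (a b c d e f g h i : ℂ) (hf : f ≠ 0) (hh : c * i ^ 2 - e * f * i + f ^ 2 * h = 0)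
    (hs : ¬ Sing (cub a b c d e f g h i 0)) : Cls (cub a b c d e f g h i 0) := by
  obtain ⟨u, hu⟩ : ∃ u, f * u = 1 := ⟨f⁻¹, mul_inv_cancel₀ hf⟩
  obtain ⟨w, hw⟩ : ∃ w, f * w + i = 0 := ⟨-i / f, by field_simp; ring⟩
  have hh2 : c * w ^ 2 + e * w + h = 0 := by
    have : f ^ 2 * (c * w ^ 2 + e * w + h) = 0 := by
      have hi : i = - (f * w) := by linear_combination hw
      rw [hi] at hh
      linear_combination hh
    exact (mul_eq_zero.1 this).resolve_left (pow_ne_zero _ hf)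
  refine step _ (cub (a * u ^ 3) (3 * a * u ^ 2 * w + b * u ^ 2) (c * u ^ 2) (3 * a * u * w ^ 2 + 2 * b * u * w + d * u)
    (2 * c * u * w + e * u) 1 (a * w ^ 3 + b * w ^ 2 + d * w + g) 0 0 0)
    !![u, w, 0; 0, 1, 0; 0, 0, 1] !![f, i, 0; 0, 1, 0; 0, 0, 1] ?_ ?_ hs (sm1 _ _ _ _ _ _)
  · ext k l
    fin_cases k <;> fin_cases l <;> simp [Matrix.mul_apply, Fin.sum_univ_three]
    · linear_combination hu
    · linear_combination u * hw - w * hu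
  · have e1 := congrArg (C : ℂ → MvPolynomial (Fin 3) ℂ) hu
    have e2 := congrArg (C : ℂ → MvPolynomial (Fin 3) ℂ) hw
    have e3 := congrArg (C : ℂ → MvPolynomial (Fin 3) ℂ) hh2
    simp only [map_add, map_mul, map_pow, map_zero, map_one] at e1 e2 e3
    rw [lin_cub]
    simp [cub, map_ofNat C]
    linear_combination (X 0 * X 2 ^ 2) * e1 + X 1 * X 2 ^ 2 * e2 + X 1 ^ 2 * X 2 * e3

theorem cls_smooth {F : MvPolynomial (Fin 3) ℂ} (hF : F.IsHomogeneous 3) (hs : ¬ Sing F) : Cls F := by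
  obtain ⟨v, hv, h1, h2⟩ := common_zero F (He F) hF (He_hom hF) (by norm_num) (by norm_num)
  obtain ⟨G, G', hG, hGv⟩ := exists_col v hv 2
  refine step F _ G G' hG (cub_eq (lin_hom G hF)) hs ?_
  have h3 := single_lin (F := F) hGv
  have h4 : eval (Pi.single 2 1) (He (lin G F)) = 0 := by
    rw [He_lin, map_mul, single_lin hGv, h2, mul_zero]
  rw [h1] at h3
  rw [cub_eq (lin_hom G hF)] at h3 h4
  have h5 : coeff (ex 0 0 3) (lin G F) = 0 := by simpa [cub] using h3
  rw [h5] at h4 ⊢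
  generalize coeff (ex 3 0 0) (lin G F) = a at *
  generalize coeff (ex 2 1 0) (lin G F) = b at *
  generalize coeff (ex 2 0 1) (lin G F) = c at *
  generalize coeff (ex 1 2 0) (lin G F) = d at *
  generalize coeff (ex 1 1 1) (lin G F) = e at *
  generalize coeff (ex 1 0 2) (lin G F) = f at *
  generalize coeff (ex 0 3 0) (lin G F) = g at *
  generalize coeff (ex 0 2 1) (lin G F) = h at *
  generalize coeff (ex 0 1 2) (lin G F) = i at *
  have h6 : c * i ^ 2 - e * f * i + f ^ 2 * h = 0 := by
    unfold He at h4
    rw [Hmat_cub, Matrix.det_fin_three] at h4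
    simp at h4
    linear_combination (-1 / 8 : ℂ) * h4
  intro hs'
  by_cases hf : f = 0
  · by_cases hi : i = 0
    · exfalso
      apply hs'
      refine ⟨Pi.single 2 1, fun h => by simpa using congrFun h 2, fun k => ?_⟩
      fin_cases k <;> simp [cub, hf, hi, pderiv_X, Pi.single_apply, pderiv_ofNat']
    · have hc : c = 0 := by
        rw [hf] at h6
        simpa [hi] using h6
      refine step _ (cub g d h b e i a c f 0) !![0, 1, 0; 1, 0, 0; 0, 0, 1] !![0, 1, 0; 1, 0, 0; 0, 0, 1]
        ?_ ?_ hs' (sm0 _ _ _ _ _ _ _ _ _ hi ?_)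
      · ext k l
        fin_cases k <;> fin_cases l <;> simp [Matrix.mul_apply, Fin.sum_univ_three]
      · rw [lin_cub]
        simp [cub]
        ring
      · rw [hf, hc]; ring
  · exact sm0 _ _ _ _ _ _ _ _ _ hf h6 hs'

theorem cls_all {F : MvPolynomial (Fin 3) ℂ} {d : ℕ} (hF : F.IsHomogeneous d) (h0 : F ≠ 0) (h1 : 1 ≤ d)
    (h3 : d ≤ 3) : Cls F := by
  interval_cases d
  · exact cls_one hF h0
  · exact cls_two hF
  · by_cases hs : Sing F
    · exact cls_sing hF hs
    · exact cls_smooth hF hs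

end EK

end

section
namespace EK
open MvPolynomial

theorem wei_rat (f : MvPolynomial (Fin 3) ℤ) (hf0 : f ≠ 0) (G G' : Matrix (Fin 3) (Fin 3) ℂ) (hG : G * G' = 1)
    (a b : ℂ) (hab : 4 * a ^ 3 + 27 * b ^ 2 ≠ 0) (hw : lin G (map (Int.castRingHom ℂ) f) = wei a b) :
    ∃ n0 m0 : ℤ, m0 ≠ 0 ∧ (m0 : ℂ) * (1728 * (4 * a ^ 3)) = n0 * (4 * a ^ 3 + 27 * b ^ 2) := by
  set F := map (Int.castRingHom ℂ) f with hFdef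
  have hd : G.det ≠ 0 := by
    have := congrArg Matrix.det hG
    rw [Matrix.det_mul, Matrix.det_one] at this
    exact left_ne_zero_of_mul_eq_one this
  generalize hδ : G.det = δ at hd
  have back : ∀ P, lin G' (lin G P) = P := fun P => by rw [lin_lin, hG, lin_one]
  -- first invariant
  have t1 : C (δ ^ 4) * Tc F = C (-576 * a) * F := by
    have h1 := Tc_lin G F
    rw [hw, Tc_wei, ← hw, hδ] at h1
    have h2 := congrArg (lin G') h1
    simp only [map_mul, lin_C, back] at h2
    simp only [map_mul]
    linear_combination -h2
  -- second invariant
  have t2 : C (δ ^ 8) * He (He F) = C (110592 * a ^ 2) * F + C (-13824 * b * δ ^ 2) * He F := by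
    have h1 := He_lin G F
    have h2 : He (He (lin G F)) = C (δ ^ 8) * lin G (He (He F)) := by
      rw [h1, He_C_mul, He_lin, hδ, ← mul_assoc, ← C_mul]
      congr 2; ring
    have h3 := HeHe_wei a b
    rw [← hw, h2, h1, hδ] at h3
    have h4 := congrArg (lin G') h3
    simp only [map_mul, map_add, lin_C, back] at h4
    rw [h4]
    simp only [map_mul]
    ring
  have hne : He F ≠ 0 := by
    intro h0
    have h1 := He_lin G F
    rw [h0, map_zero, mul_zero, hw, He_wei, cub_mono] at h1
    have := congrArg (coeff (ex 0 1 2)) h1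
    simp [coeff_monomial] at this
  have cF : ∀ e, coeff e F = ((coeff e f : ℤ) : ℂ) := fun e => by rw [hFdef, coeff_map]; rfl
  have cT : ∀ e, coeff e (Tc F) = ((coeff e (Tc f) : ℤ) : ℂ) := fun e => by
    rw [hFdef, Tc_map, coeff_map]; rfl
  have cH : ∀ e, coeff e (He F) = ((coeff e (He f) : ℤ) : ℂ) := fun e => by
    rw [hFdef, He_map, coeff_map]; rfl
  have cHH : ∀ e, coeff e (He (He F)) = ((coeff e (He (He f)) : ℤ) : ℂ) := fun e => by
    rw [hFdef, He_map, He_map, coeff_map]; rfl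
  obtain ⟨q1, hq1⟩ : ∃ q : ℚ, a = δ ^ 4 * q := by
    obtain ⟨e, he⟩ := ne_zero_iff.1 hf0
    have := congrArg (coeff e) t1
    rw [coeff_C_mul, coeff_C_mul, cF, cT] at this
    refine ⟨((coeff e (Tc f) : ℤ) : ℚ) / (-576 * ((coeff e f : ℤ) : ℚ)), ?_⟩
    have he' : ((coeff e f : ℤ) : ℂ) ≠ 0 := by exact_mod_cast he
    push_cast
    field_simp
    linear_combination this
  obtain ⟨q2, hq2⟩ : ∃ q : ℚ, b = δ ^ 6 * q := by
    obtain ⟨e, he⟩ := ne_zero_iff.1 hne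
    have := congrArg (coeff e) t2
    rw [coeff_C_mul, coeff_add, coeff_C_mul, coeff_C_mul, cF, cHH, cH, hq1] at this
    rw [cH] at he
    refine ⟨(110592 * q1 ^ 2 * ((coeff e f : ℤ) : ℚ) - ((coeff e (He (He f)) : ℤ) : ℚ)) / (13824 * ((coeff e (He f) : ℤ) : ℚ)), ?_⟩
    push_cast
    field_simp
    have h2 : δ ^ 2 ≠ 0 := pow_ne_zero _ hd
    apply mul_left_cancel₀ h2
    linear_combination this
  have hq : 4 * q1 ^ 3 + 27 * q2 ^ 2 ≠ 0 := by
    intro h0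
    apply hab
    have h1 : (4 * (q1 : ℂ) ^ 3 + 27 * (q2 : ℂ) ^ 2) = 0 := by exact_mod_cast h0
    rw [hq1, hq2]
    linear_combination δ ^ 12 * h1
  let r : ℚ := 1728 * (4 * q1 ^ 3) / (4 * q1 ^ 3 + 27 * q2 ^ 2)
  have hr : (r.den : ℚ) * (1728 * (4 * q1 ^ 3)) = r.num * (4 * q1 ^ 3 + 27 * q2 ^ 2) := by
    have h1 : r * (4 * q1 ^ 3 + 27 * q2 ^ 2) = 1728 * (4 * q1 ^ 3) := div_mul_cancel₀ _ hq
    rw [← h1, ← mul_assoc, Rat.den_mul_eq_num]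
  refine ⟨r.num, r.den, by exact_mod_cast r.den_nz, ?_⟩
  have hr' : (r.den : ℂ) * (1728 * (4 * (q1 : ℂ) ^ 3)) = r.num * (4 * (q1 : ℂ) ^ 3 + 27 * (q2 : ℂ) ^ 2) := by
    exact_mod_cast hr
  rw [hq1, hq2, Int.cast_natCast]
  linear_combination δ ^ 12 * hr'

theorem dir12 (f : MvPolynomial (Fin 3) ℤ) (d : ℕ) (hf0 : f ≠ 0)
    (hfhom : f.IsHomogeneous d) (hd1 : 1 ≤ d) (hd3 : d ≤ 3)
    (hsp : ∃ N : ℕ, ∀ p : ℕ, p.Prime → N ≤ p →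
        IsFSplit p (MvPolynomial (Fin 3) (ZMod p) ⧸
          Ideal.span {MvPolynomial.map (Int.castRingHom (ZMod p)) f})) :
    Good (MvPolynomial.map (Int.castRingHom ℂ) f) := by
  have hinj : Function.Injective (map (σ := Fin 3) (Int.castRingHom ℂ)) :=
    map_injective _ Int.cast_injective
  have h0 : map (Int.castRingHom ℂ) f ≠ 0 := by
    intro h
    exact hf0 (hinj (by rw [h, map_zero]))
  rcases cls_all (hfhom.map (Int.castRingHom ℂ)) h0 hd1 hd3 with h | ⟨G, G', w, hG, hw⟩ | ⟨G, G', a, b, hG, hab, hw⟩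
  · exact h
  · exact (bad_weight f d hf0 hfhom hd1 hsp G G' hG w hw).elim
  · obtain ⟨n0, m0, hm0, hj⟩ := wei_rat f hf0 G G' hG a b hab hw
    exact (bad_wei f d hf0 hfhom hd1 hsp G G' hG a b hw hab n0 m0 hm0 hj).elim

end EK

end

open MvPolynomial

/-- for a nonzero homogeneous `f ∈ ℤ[X,Y,Z]` of degree `1 ≤ d ≤ 3`,
`𝔽_p[X,Y,Z]/(f_p)` is `F`-split for all primes `p ≫ 0` iff, after a `ℂ`-algebra
automorphism, `f_ℂ` has a squarefree leading monomial for some monomial order. -/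
theorem statement0 (f : MvPolynomial (Fin 3) ℤ) (d : ℕ) (hf0 : f ≠ 0)
    (hfhom : f.IsHomogeneous d) (hd1 : 1 ≤ d) (hd3 : d ≤ 3) :
    (∃ N : ℕ, ∀ p : ℕ, p.Prime → N ≤ p →
        IsFSplit p (MvPolynomial (Fin 3) (ZMod p) ⧸
          Ideal.span {MvPolynomial.map (Int.castRingHom (ZMod p)) f})) ↔
      (∃ φ : MvPolynomial (Fin 3) ℂ ≃ₐ[ℂ] MvPolynomial (Fin 3) ℂ,
        ∃ lt : (Fin 3 →₀ ℕ) → (Fin 3 →₀ ℕ) → Prop, IsMonomialOrder lt ∧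
          ∃ m : Fin 3 →₀ ℕ,
            IsLeadingMonomial lt (φ (MvPolynomial.map (Int.castRingHom ℂ) f)) m ∧
              ∀ i, m i ≤ 1) := by
  constructor
  · intro h
    exact EK.dir12 f d hf0 hfhom hd1 hd3 h
  · rintro ⟨φ, lt, hlt, m, hl, hm⟩
    exact EK.dir21 f φ lt hlt m hl hm
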